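/- arXiv:1712.09861 — 4 statements merged into one kernel-verified Lean document; each statement's English description precedes it below -/
import Mathlib

section
/- Let q be a power of an odd prime p and let n ≥ 3 be a positive integer such that either gcd(p, n) = 1 or p ≥ 5. Then for every α ∈ F_q there exists a 2-primitive element β ∈ F_{q^n} such that Tr_{F_{q^n}/F_q}(β) = α. -/
open Finset

/-- The sum of `z v ^ k` over those `v ∈ V` with `z v ^ (M / ℓ) ≠ 1` for all `ℓ ∈ T`. -/
noncomputable def sieveSum {ι : Type*} (V : Finset ι) (z : ι → ℂ) (M : ℕ) (T : Finset ℕ)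
    (k : ℕ) : ℂ :=
  ∑ v ∈ V, z v ^ k * ∏ ℓ ∈ T, (if z v ^ (M / ℓ) = 1 then 0 else 1)

/-- The elements of `V` with `z v ^ (M / ℓ) ≠ 1` for all `ℓ ∈ T`. -/
noncomputable def sieved {ι : Type*} (V : Finset ι) (z : ι → ℂ) (M : ℕ) (T : Finset ℕ) :
    Finset ι :=
  V.filter fun v => ∀ ℓ ∈ T, z v ^ (M / ℓ) ≠ 1

/-- The density `∏ (1 - 1 / ℓ)` over `ℓ ∈ T`. -/
noncomputable def density (T : Finset ℕ) : ℝ := ∏ ℓ ∈ T, (1 - 1 / (ℓ : ℝ))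

lemma one_sub_one_div_nonneg (ℓ : ℕ) : (0 : ℝ) ≤ 1 - 1 / (ℓ : ℝ) := by
  rcases Nat.eq_zero_or_pos ℓ with rfl | h
  · simp
  · rw [sub_nonneg, div_le_one (by positivity)]
    exact_mod_cast h

lemma density_pos {T : Finset ℕ} (hT : ∀ ℓ ∈ T, ℓ.Prime) : 0 < density T := by
  refine prod_pos fun ℓ hℓ => ?_
  have : (1 : ℝ) < ℓ := by exact_mod_cast (hT ℓ hℓ).one_lt
  rw [sub_pos, div_lt_one (by positivity)]
  exact this

lemma ite_pow_eq_one {w : ℂ} {ℓ : ℕ} (hℓ : ℓ ≠ 0) (hw : w ^ ℓ = 1) :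
    (if w = 1 then 0 else 1 : ℂ) =
      (1 - 1 / (ℓ : ℂ)) - 1 / (ℓ : ℂ) * ∑ j ∈ range (ℓ - 1), w ^ (j + 1) := by
  have h0 : (ℓ : ℂ) ≠ 0 := by exact_mod_cast hℓ
  have hs : ∑ j ∈ range ℓ, w ^ j = (∑ j ∈ range (ℓ - 1), w ^ (j + 1)) + 1 := by
    obtain ⟨m, rfl⟩ := Nat.exists_eq_succ_of_ne_zero hℓ
    rw [Finset.sum_range_succ']
    simp
  split_ifs with h
  · subst h
    have : ((ℓ - 1 : ℕ) : ℂ) = ℓ - 1 := by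
      rw [Nat.cast_sub (Nat.one_le_iff_ne_zero.2 hℓ)]; simp
    simp [this]
    field_simp
    ring
  · have hz : ∑ j ∈ range ℓ, w ^ j = 0 := by
      rw [geom_sum_eq h, hw]; simp
    rw [hs] at hz
    rw [eq_neg_of_add_eq_zero_left hz]
    ring

section Sieve

variable {ι : Type*} {V : Finset ι} {z : ι → ℂ} {M : ℕ}

lemma sieveSum_insert (hz : ∀ v ∈ V, z v ^ M = 1) {T : Finset ℕ} {ℓ : ℕ} (hℓT : ℓ ∉ T)
    (hℓ : ℓ ∣ M) (h0 : ℓ ≠ 0) (k : ℕ) :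
    sieveSum V z M (insert ℓ T) k = (1 - 1 / (ℓ : ℂ)) * sieveSum V z M T k -
      1 / (ℓ : ℂ) * ∑ j ∈ range (ℓ - 1), sieveSum V z M T (k + (j + 1) * (M / ℓ)) := by
  unfold sieveSum
  rw [Finset.sum_comm, Finset.mul_sum, Finset.mul_sum, ← Finset.sum_sub_distrib]
  refine Finset.sum_congr rfl fun v hv => ?_
  rw [Finset.prod_insert hℓT, ite_pow_eq_one h0 (by rw [← pow_mul, Nat.div_mul_cancel hℓ, hz v hv])]
  rw [sub_mul, mul_sub]
  congr 1
  · ring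
  · rw [← Finset.sum_mul]
    have : ∑ i ∈ range (ℓ - 1), z v ^ (k + (i + 1) * (M / ℓ)) =
        z v ^ k * ∑ j ∈ range (ℓ - 1), (z v ^ (M / ℓ)) ^ (j + 1) := by
      rw [Finset.mul_sum]
      refine Finset.sum_congr rfl fun j _ => ?_
      rw [pow_add, ← pow_mul, mul_comm (M / ℓ)]
    rw [this]; ring

lemma norm_one_sub_one_div (ℓ : ℕ) : ‖(1 - 1 / (ℓ : ℂ))‖ = 1 - 1 / (ℓ : ℝ) := by
  have : (1 - 1 / (ℓ : ℂ)) = ((1 - 1 / (ℓ : ℝ) : ℝ) : ℂ) := by push_cast; rfl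
  rw [this, Complex.norm_real, Real.norm_of_nonneg (one_sub_one_div_nonneg ℓ)]

lemma norm_average_le {ℓ : ℕ} (h0 : ℓ ≠ 0) {g : ℕ → ℂ} {C : ℝ}
    (h : ∀ j ∈ range (ℓ - 1), ‖g j‖ ≤ C) :
    ‖1 / (ℓ : ℂ) * ∑ j ∈ range (ℓ - 1), g j‖ ≤ (1 - 1 / (ℓ : ℝ)) * C := by
  have hpos : (0 : ℝ) < ℓ := by exact_mod_cast Nat.pos_of_ne_zero h0
  rw [norm_mul]
  have h1 : ‖∑ j ∈ range (ℓ - 1), g j‖ ≤ (ℓ - 1 : ℕ) * C := by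
    refine (norm_sum_le _ _).trans ((Finset.sum_le_sum h).trans ?_)
    simp
  have h2 : ((ℓ - 1 : ℕ) : ℝ) = ℓ - 1 := by
    rw [Nat.cast_sub (Nat.one_le_iff_ne_zero.2 h0)]; simp
  rw [h2] at h1
  have h3 : ‖1 / (ℓ : ℂ)‖ = 1 / (ℓ : ℝ) := by simp
  rw [h3]
  calc 1 / (ℓ : ℝ) * _ ≤ 1 / (ℓ : ℝ) * ((ℓ - 1) * C) := by gcongr
    _ = _ := by field_simp

variable {B : ℝ}

lemma norm_sieveSum_le (hz : ∀ v ∈ V, z v ^ M = 1)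
    (hB : ∀ k, ¬ M ∣ k → ‖∑ v ∈ V, z v ^ k‖ ≤ B)
    {T : Finset ℕ} (hT : ∀ ℓ ∈ T, ℓ ∣ M ∧ ℓ ≠ 0) :
    ∀ k, ¬ M ∣ k * ∏ ℓ ∈ T, ℓ → ‖sieveSum V z M T k‖ ≤ 2 ^ #T * density T * B := by
  induction T using Finset.induction_on with
  | empty =>
    intro k hk
    simpa [sieveSum, density] using hB k (by simpa using hk)
  | insert ℓ T hℓT ih =>
    intro k hk
    obtain ⟨hℓ, h0⟩ := hT ℓ (by simp)
    replace ih := ih fun ℓ' h => hT ℓ' (by simp [h])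
    rw [Finset.prod_insert hℓT] at hk
    rw [sieveSum_insert hz hℓT hℓ h0, Finset.card_insert_of_notMem hℓT]
    have h1 := ih k fun h => hk (by rw [mul_left_comm]; exact h.mul_left ℓ)
    have h2 := norm_average_le h0 (g := fun j => sieveSum V z M T (k + (j + 1) * (M / ℓ)))
      (C := 2 ^ #T * density T * B) fun j _ => ih _ fun h => hk (by
        have h3 : ℓ * ((k + (j + 1) * (M / ℓ)) * ∏ x ∈ T, x) =
            k * (ℓ * ∏ x ∈ T, x) + M * ((j + 1) * ∏ x ∈ T, x) := by
          obtain ⟨c, rfl⟩ := hℓ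
          rw [Nat.mul_div_cancel_left c (Nat.pos_of_ne_zero h0)]
          ring
        have h4 := h.mul_left ℓ
        rw [h3] at h4
        exact (Nat.dvd_add_left (Dvd.intro _ rfl)).1 h4)
    have h3 : ‖(1 - 1 / (ℓ : ℂ)) * sieveSum V z M T k‖ ≤
        (1 - 1 / (ℓ : ℝ)) * (2 ^ #T * density T * B) := by
      rw [norm_mul, norm_one_sub_one_div]
      exact mul_le_mul_of_nonneg_left h1 (one_sub_one_div_nonneg ℓ)
    refine (norm_sub_le _ _).trans ((add_le_add h3 h2).trans_eq ?_)
    simp only [density, Finset.prod_insert hℓT]; ring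

lemma sieveSum_zero (T : Finset ℕ) : sieveSum V z M T 0 = (#(sieved V z M T) : ℂ) := by
  classical
  simp only [sieveSum, sieved, pow_zero, one_mul, Finset.card_filter, Nat.cast_sum]
  refine Finset.sum_congr rfl fun v _ => ?_
  by_cases h : ∀ ℓ ∈ T, z v ^ (M / ℓ) ≠ 1
  · rw [if_pos h, Finset.prod_eq_one fun ℓ hℓ => if_neg (h ℓ hℓ)]; simp
  · rw [if_neg h]
    push Not at h
    obtain ⟨ℓ, hℓ, h1⟩ := h
    rw [Finset.prod_eq_zero hℓ (if_pos h1 : (if z v ^ (M / ℓ) = 1 then (0 : ℂ) else 1) = 0)]; simp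

lemma abs_card_sieved_insert_sub_le (hz : ∀ v ∈ V, z v ^ M = 1)
    (hB : ∀ k, ¬ M ∣ k → ‖∑ v ∈ V, z v ^ k‖ ≤ B)
    (hM : M ≠ 0) {T : Finset ℕ} {ℓ : ℕ} (hℓT : ℓ ∉ T)
    (hT : ∀ x ∈ insert ℓ T, x ∣ M ∧ x.Prime) :
    |(#(sieved V z M (insert ℓ T)) : ℝ) - (1 - 1 / (ℓ : ℝ)) * #(sieved V z M T)| ≤
      (1 - 1 / (ℓ : ℝ)) * (2 ^ #T * density T * B) := by
  obtain ⟨hℓ, hp⟩ := hT ℓ (by simp)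
  have hT' : ∀ x ∈ T, x ∣ M ∧ x.Prime := fun x hx => hT x (by simp [hx])
  have key := norm_average_le hp.ne_zero (g := fun j => sieveSum V z M T (0 + (j + 1) * (M / ℓ)))
      (C := 2 ^ #T * density T * B) fun j hj =>
      norm_sieveSum_le hz hB (fun x hx => ⟨(hT' x hx).1, (hT' x hx).2.ne_zero⟩) _ fun h => by
        have hpos : 0 < M / ℓ := Nat.div_pos (Nat.le_of_dvd (Nat.pos_of_ne_zero hM) hℓ) hp.pos
        have h1 : M / ℓ * ℓ ∣ M / ℓ * ((j + 1) * ∏ x ∈ T, x) := by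
          rw [Nat.div_mul_cancel hℓ]; convert h using 1; ring
        rcases hp.dvd_mul.1 ((Nat.mul_dvd_mul_iff_left hpos).1 h1) with h2 | h2
        · have := Nat.le_of_dvd (by simp) h2
          have := Finset.mem_range.1 hj
          omega
        · obtain ⟨x, hx, h3⟩ := (hp.prime.dvd_finsetProd_iff _).1 h2
          exact hℓT (((Nat.prime_dvd_prime_iff_eq hp (hT' x hx).2).1 h3) ▸ hx)
  have h2 := sieveSum_insert hz hℓT hℓ hp.ne_zero 0
  rw [sieveSum_zero, sieveSum_zero] at h2
  have h3 : ((#(sieved V z M (insert ℓ T)) - (1 - 1 / (ℓ : ℝ)) * #(sieved V z M T) : ℝ) : ℂ) =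
      -(1 / (ℓ : ℂ) * ∑ j ∈ range (ℓ - 1), sieveSum V z M T (0 + (j + 1) * (M / ℓ))) := by
    push_cast
    rw [h2]; ring
  rw [← Real.norm_eq_abs, ← Complex.norm_real, h3, norm_neg]
  exact key

lemma card_sieved_ge (hz : ∀ v ∈ V, z v ^ M = 1)
    (hB : ∀ k, ¬ M ∣ k → ‖∑ v ∈ V, z v ^ k‖ ≤ B)
    (hM : M ≠ 0) {T : Finset ℕ} (hT : ∀ x ∈ T, x ∣ M ∧ x.Prime) :
    density T * (#V - (2 ^ #T - 1) * B) ≤ #(sieved V z M T) := by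
  induction T using Finset.induction_on with
  | empty => simp [density, sieved]
  | insert ℓ T hℓT ih =>
    have h1 := (abs_le.1 (abs_card_sieved_insert_sub_le hz hB hM hℓT hT)).1
    have h2 := mul_le_mul_of_nonneg_left (ih fun x hx => hT x (by simp [hx]))
      (one_sub_one_div_nonneg ℓ)
    rw [Finset.card_insert_of_notMem hℓT]
    have h3 : density (insert ℓ T) = (1 - 1 / (ℓ : ℝ)) * density T := by
      simp [density, Finset.prod_insert hℓT]
    rw [h3, pow_succ]
    nlinarith

/-- The sieve with core `T` and sieving primes `U`. -/
lemma exists_of_sieve (hz : ∀ v ∈ V, z v ^ M = 1)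
    (hB : ∀ k, ¬ M ∣ k → ‖∑ v ∈ V, z v ^ k‖ ≤ B)
    (hM : M ≠ 0) {T U : Finset ℕ} (hTU : Disjoint T U)
    (hT : ∀ x ∈ T, x ∣ M ∧ x.Prime) (hU : ∀ x ∈ U, x ∣ M ∧ x.Prime)
    (hδ : 0 < 1 - ∑ ℓ ∈ U, 1 / (ℓ : ℝ))
    (h : 2 ^ #T * B * ∑ ℓ ∈ U, (1 - 1 / (ℓ : ℝ)) <
      (1 - ∑ ℓ ∈ U, 1 / (ℓ : ℝ)) * (#V - (2 ^ #T - 1) * B)) :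
    ∃ v ∈ V, ∀ ℓ ∈ T ∪ U, z v ^ (M / ℓ) ≠ 1 := by
  classical
  by_contra! hcon
  have hcov : sieved V z M T ⊆ U.biUnion fun ℓ => sieved V z M T \ sieved V z M (insert ℓ T) := by
    intro v hv
    simp only [sieved, mem_filter] at hv
    obtain ⟨ℓ, hℓ, h1⟩ := hcon v hv.1
    rcases Finset.mem_union.1 hℓ with h2 | h2
    · exact absurd h1 (hv.2 ℓ h2)
    · simp only [mem_biUnion, mem_sdiff, sieved, mem_filter]
      exact ⟨ℓ, h2, hv, fun h3 => h3.2 ℓ (by simp) h1⟩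
  have hcard : (#(sieved V z M T) : ℝ) ≤
      ∑ ℓ ∈ U, (1 / (ℓ : ℝ) * #(sieved V z M T) +
        (1 - 1 / (ℓ : ℝ)) * (2 ^ #T * density T * B)) := by
    have h1 := (Finset.card_le_card hcov).trans Finset.card_biUnion_le
    have h2 : (#(sieved V z M T) : ℝ) ≤
        ∑ ℓ ∈ U, (#(sieved V z M T \ sieved V z M (insert ℓ T)) : ℝ) := by exact_mod_cast h1
    refine h2.trans (Finset.sum_le_sum fun ℓ hℓ => ?_)
    have hsub : sieved V z M (insert ℓ T) ⊆ sieved V z M T := by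
      intro v hv
      simp only [sieved, mem_filter] at hv ⊢
      exact ⟨hv.1, fun x hx => hv.2 x (by simp [hx])⟩
    rw [Finset.cast_card_sdiff hsub]
    have h3 := (abs_le.1 (abs_card_sieved_insert_sub_le hz hB hM (T := T) (ℓ := ℓ)
      (fun h => Finset.disjoint_left.1 hTU h hℓ) (by
        intro x hx
        rcases Finset.mem_insert.1 hx with rfl | hx
        · exact hU _ hℓ
        · exact hT _ hx))).1
    linarith
  rw [Finset.sum_add_distrib, ← Finset.sum_mul, ← Finset.sum_mul] at hcard
  have h4 := mul_le_mul_of_nonneg_left (card_sieved_ge hz hB hM hT) hδ.le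
  have h5 := mul_lt_mul_of_pos_left h (density_pos fun x hx => (hT x hx).2)
  linarith

end Sieve

section TraceSums

variable {K L : Type*} [Field K] [Field L] [Algebra K L]

lemma norm_gaussSum_sq {F : Type*} [Field F] [Fintype F] {χ : MulChar F ℂ} (hχ : χ ≠ 1)
    {ψ : AddChar F ℂ} (hψ : ψ.IsPrimitive) : ‖gaussSum χ ψ‖ = √(Fintype.card F) := by
  have h := gaussSum_mul_gaussSum_eq_card hχ hψ
  rw [← star_gaussSum_eq] at h
  have h2 : ((‖gaussSum χ ψ‖ ^ 2 : ℝ) : ℂ) = ((Fintype.card F : ℝ) : ℂ) := by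
    rw [← Complex.normSq_eq_norm_sq, Complex.normSq_eq_conj_mul_self, mul_comm]
    simpa using h
  rw [← Complex.ofReal_inj.1 h2, Real.sqrt_sq (norm_nonneg _)]

/-- Restriction of a multiplicative character to a subfield. -/
noncomputable def MulChar.restrictField (K : Type*) {L : Type*} [Field K] [Field L] [Algebra K L]
    (φ : MulChar L ℂ) : MulChar K ℂ where
  toMonoidHom := (φ.toMonoidHom).comp (algebraMap K L : K →* L)
  map_nonunit' a ha := by
    have : a = 0 := by simpa using ha
    subst this
    simp

lemma MulChar.restrictField_apply (φ : MulChar L ℂ) (c : K) :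
    φ.restrictField K c = φ (algebraMap K L c) := rfl

/-- The pullback of an additive character along the trace. -/
noncomputable def traceAddChar (L : Type*) {K : Type*} [Field K] [Field L] [Algebra K L]
    (ψ : AddChar K ℂ) : AddChar L ℂ :=
  ψ.compAddMonoidHom (Algebra.trace K L).toAddMonoidHom

lemma traceAddChar_apply (ψ : AddChar K ℂ) (v : L) :
    traceAddChar L ψ v = ψ (Algebra.trace K L v) := rfl

variable [Fintype K] [Fintype L]

lemma traceAddChar_isPrimitive {ψ : AddChar K ℂ} (hψ : ψ.IsPrimitive) :
    (traceAddChar L ψ).IsPrimitive := by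
  refine AddChar.IsPrimitive.of_ne_one ?_
  obtain ⟨a, ha⟩ := AddChar.ne_one_iff.1 (hψ one_ne_zero)
  obtain ⟨b, hb⟩ := Algebra.trace_surjective K L a
  refine AddChar.ne_one_iff.2 ⟨b, ?_⟩
  rw [traceAddChar_apply, hb]
  simpa [AddChar.mulShift_apply] using ha

/-- The sum of a multiplicative character over the elements of given trace. -/
noncomputable def traceSum (φ : MulChar L ℂ) (α : K) : ℂ :=
  open Classical in ∑ v with Algebra.trace K L v = α, φ v

lemma card_mul_traceSum {φ : MulChar L ℂ} (hφ : φ ≠ 1) {ψ : AddChar K ℂ}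
    (hψ : ψ.IsPrimitive) (α : K) :
    Fintype.card K * traceSum φ α = gaussSum φ (traceAddChar L ψ) *
      gaussSum (φ.restrictField K)⁻¹ (ψ.mulShift (-α)) := by
  classical
  have h1 : ∀ v : L, (if Algebra.trace K L v = α then (Fintype.card K : ℂ) else 0) =
      ∑ c : K, ψ (c * (Algebra.trace K L v - α)) := by
    intro v
    rw [AddChar.sum_mulShift _ hψ]
    simp [sub_eq_zero]
  have h2 : (Fintype.card K : ℂ) * traceSum φ α =
      ∑ v : L, φ v * ∑ c : K, ψ (c * (Algebra.trace K L v - α)) := by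
    rw [traceSum, Finset.mul_sum, Finset.sum_filter]
    refine Finset.sum_congr rfl fun v _ => ?_
    rw [← h1 v]
    split_ifs <;> simp [mul_comm]
  have h3 : ∀ (c : K) (v : L), ψ (c * (Algebra.trace K L v - α)) =
      ψ (-α * c) * traceAddChar L ψ (algebraMap K L c * v) := by
    intro c v
    rw [traceAddChar_apply, ← Algebra.smul_def, map_smul, ← AddChar.map_add_eq_mul, smul_eq_mul]
    congr 1; ring
  rw [h2]
  simp_rw [Finset.mul_sum]
  rw [Finset.sum_comm]
  conv_rhs => rw [gaussSum, gaussSum, mul_comm, Finset.sum_mul]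
  refine Finset.sum_congr rfl fun c _ => ?_
  simp_rw [h3]
  rw [AddChar.mulShift_apply]
  rcases eq_or_ne c 0 with rfl | hc
  · rw [MulChar.map_zero]
    simp [MulChar.sum_eq_zero_of_ne_one hφ]
  · have hc' : algebraMap K L c ≠ 0 := by simpa using hc
    have h4 := gaussSum_mulShift_eq φ (traceAddChar L ψ) (Units.mk0 _ hc')
    simp only [gaussSum, Units.val_mk0, AddChar.mulShift_apply] at h4
    have h5 : (φ.restrictField K)⁻¹ c = φ⁻¹ (algebraMap K L c) := by
      rw [MulChar.inv_apply', MulChar.inv_apply', MulChar.restrictField_apply, map_inv₀]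
    rw [h5]
    calc ∑ v, φ v * (ψ (-α * c) * (traceAddChar L ψ) (algebraMap K L c * v))
        = ψ (-α * c) * ∑ v, φ v * (traceAddChar L ψ) (algebraMap K L c * v) := by
          rw [Finset.mul_sum]
          exact Finset.sum_congr rfl fun v _ => by ring
      _ = _ := by rw [h4]; ring

lemma exists_isPrimitive_addChar (F : Type*) [Field F] [Finite F] :
    ∃ ψ : AddChar F ℂ, ψ.IsPrimitive := by
  obtain ⟨ψ, hψ⟩ := (AddChar.exists_apply_ne_zero (a := (1 : F))).2 one_ne_zero
  exact ⟨ψ, AddChar.IsPrimitive.of_ne_one (AddChar.ne_one_iff.2 ⟨1, hψ⟩)⟩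

variable {q n : ℕ}

lemma norm_traceSum_le_of_ne_zero (hn : 1 ≤ n) (hK : Fintype.card K = q)
    (hL : Fintype.card L = q ^ n)
    {φ : MulChar L ℂ} (hφ : φ ≠ 1) {α : K} (hα : α ≠ 0) :
    ‖traceSum φ α‖ ≤ √((q : ℝ) ^ (n - 1)) := by
  obtain ⟨ψ, hψ⟩ := exists_isPrimitive_addChar K
  have h := congrArg (‖·‖) (card_mul_traceSum hφ hψ α)
  have hq : (1 : ℝ) < q := by rw [← hK]; exact_mod_cast Fintype.one_lt_card
  simp only [norm_mul, norm_gaussSum_sq hφ (traceAddChar_isPrimitive hψ), hK, hL] at h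
  have h1 : ‖gaussSum (φ.restrictField K)⁻¹ (ψ.mulShift (-α))‖ ≤ √q := by
    have hne := hψ (neg_ne_zero.2 hα)
    by_cases h1 : (φ.restrictField K)⁻¹ = 1
    · rw [h1, gaussSum_one_left hne]
      simp
      exact_mod_cast hq.le
    · rw [norm_gaussSum_sq h1 (AddChar.IsPrimitive.of_ne_one hne), hK]
  have h2 : (q : ℝ) * ‖traceSum φ α‖ ≤ q * √((q : ℝ) ^ (n - 1)) := by
    calc (q : ℝ) * ‖traceSum φ α‖ = _ := by simpa only [Complex.norm_natCast] using h
      _ ≤ √((q ^ n : ℕ) : ℝ) * √q := mul_le_mul_of_nonneg_left h1 (Real.sqrt_nonneg _)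
      _ = q * √((q : ℝ) ^ (n - 1)) := by
        rw [← Real.sqrt_mul (by positivity)]
        have : (((q ^ n : ℕ) : ℝ) * q) = q ^ 2 * q ^ (n - 1) := by
          push_cast
          rw [← pow_succ, ← pow_add]; congr 1; omega
        rw [this, Real.sqrt_mul (by positivity), Real.sqrt_sq (by positivity)]
  exact le_of_mul_le_mul_left h2 (by positivity)

lemma norm_traceSum_zero_le (hn : 2 ≤ n) (hK : Fintype.card K = q) (hL : Fintype.card L = q ^ n)
    {φ : MulChar L ℂ} (hφ : φ ≠ 1) :
    ‖traceSum φ (0 : K)‖ ≤ (q - 1) * √((q : ℝ) ^ (n - 2)) := by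
  classical
  obtain ⟨ψ, hψ⟩ := exists_isPrimitive_addChar K
  have h := congrArg (‖·‖) (card_mul_traceSum hφ hψ (0 : K))
  have hq : (1 : ℝ) < q := by rw [← hK]; exact_mod_cast Fintype.one_lt_card
  simp only [norm_mul, norm_gaussSum_sq hφ (traceAddChar_isPrimitive hψ), hK, hL] at h
  have h1 : ‖gaussSum (φ.restrictField K)⁻¹ (ψ.mulShift (-(0 : K)))‖ ≤ q - 1 := by
    rw [neg_zero, AddChar.mulShift_zero]
    by_cases h1 : (φ.restrictField K)⁻¹ = 1
    · rw [h1, gaussSum_one_one, Nat.card_eq_fintype_card, Fintype.card_units, hK]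
      rw [Complex.norm_natCast, Nat.cast_sub (by exact_mod_cast hq.le)]
      simp
    · rw [gaussSum_one_right h1, norm_zero]
      linarith
  have h2 : (q : ℝ) * ‖traceSum φ (0 : K)‖ ≤ q * ((q - 1) * √((q : ℝ) ^ (n - 2))) := by
    calc (q : ℝ) * ‖traceSum φ (0 : K)‖ = _ := by simpa only [Complex.norm_natCast] using h
      _ ≤ √((q ^ n : ℕ) : ℝ) * (q - 1) := mul_le_mul_of_nonneg_left h1 (Real.sqrt_nonneg _)
      _ = _ := by
        have : ((q ^ n : ℕ) : ℝ) = q ^ 2 * q ^ (n - 2) := by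
          push_cast
          rw [← pow_add]; congr 1; omega
        rw [this, Real.sqrt_mul (by positivity), Real.sqrt_sq (by positivity)]
        ring
  exact le_of_mul_le_mul_left h2 (by positivity)

lemma card_trace_eq (hn : 1 ≤ n) (hK : Fintype.card K = q)
    (hL : Fintype.card L = q ^ n) (α : K) [DecidableEq K] :
    #{v : L | Algebra.trace K L v = α} = q ^ (n - 1) := by
  classical
  have hq : 0 < q := by rw [← hK]; exact Fintype.card_pos
  have h1 : ∀ β : K, #{v : L | Algebra.trace K L v = β} = #{v : L | Algebra.trace K L v = α} := by
    intro β
    exact AddMonoidHom.card_fiber_eq_of_mem_range (Algebra.trace K L).toAddMonoidHom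
      (Algebra.trace_surjective K L β) (Algebra.trace_surjective K L α)
  have h2 := Finset.card_eq_sum_card_fiberwise (f := fun v : L => Algebra.trace K L v)
    (s := univ) (t := univ) (fun _ _ => by simp)
  simp only [h1, Finset.sum_const, Finset.card_univ, hK, hL, smul_eq_mul] at h2
  have h3 : q * q ^ (n - 1) = q * #{v : L | Algebra.trace K L v = α} := by
    rw [← h2, ← pow_succ']; congr 1; omega
  exact (Nat.eq_of_mul_eq_mul_left hq h3).symm

end TraceSums

/-- The numerical condition under which the sieve with core `T` and sieving primes `U` succeeds.
Here `κ` is the index of the group that is sieved, and `Z` is the ratio of the main term to the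
bound for the character sums. -/
def SieveCriterion (m κ : ℕ) (Z : ℝ) : Prop :=
  ∃ T U : Finset ℕ, m.primeFactors ⊆ T ∪ U ∧ 0 < 1 - ∑ u ∈ U, 1 / (u : ℝ) ∧
    κ * 2 ^ #T * ∑ u ∈ U, (1 - 1 / (u : ℝ)) <
      (1 - ∑ u ∈ U, 1 / (u : ℝ)) * (Z + 1 - κ * 2 ^ #T)

lemma SieveCriterion.exists_forall_pow_ne_one {ι : Type*} {V : Finset ι} {z : ι → ℂ} {M κ : ℕ}
    {B Z : ℝ} (h : SieveCriterion M κ Z) (hM : M ≠ 0) (hκ : 0 < κ) (hB0 : 0 < B)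
    (hz : ∀ v ∈ V, z v ^ M = 1) (hB : ∀ k, ¬ M ∣ k → ‖∑ v ∈ V, z v ^ k‖ ≤ B)
    (hV : B * (Z + 1 - κ) ≤ κ * #V) :
    ∃ v ∈ V, ∀ ℓ ∈ M.primeFactors, z v ^ (M / ℓ) ≠ 1 := by
  obtain ⟨T, U, hsub, hδ, hlt⟩ := h
  have hU : M.primeFactors \ T ⊆ U := by
    intro x hx
    rw [mem_sdiff] at hx
    exact (mem_union.1 (hsub hx.1)).resolve_left hx.2
  have hprime : ∀ x ∈ M.primeFactors, x ∣ M ∧ x.Prime := fun x hx =>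
    ⟨Nat.dvd_of_mem_primeFactors hx, Nat.prime_of_mem_primeFactors hx⟩
  have hδ' : ∑ u ∈ M.primeFactors \ T, 1 / (u : ℝ) ≤ ∑ u ∈ U, 1 / (u : ℝ) :=
    Finset.sum_le_sum_of_subset_of_nonneg hU fun _ _ _ => by positivity
  have hE' : ∑ u ∈ M.primeFactors \ T, (1 - 1 / (u : ℝ)) ≤ ∑ u ∈ U, (1 - 1 / (u : ℝ)) :=
    Finset.sum_le_sum_of_subset_of_nonneg hU fun u _ _ => one_sub_one_div_nonneg u
  have hE0 : 0 ≤ ∑ u ∈ M.primeFactors \ T, (1 - 1 / (u : ℝ)) :=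
    Finset.sum_nonneg fun u _ => one_sub_one_div_nonneg u
  have ht : (2 : ℝ) ^ #(M.primeFactors ∩ T) ≤ 2 ^ #T :=
    pow_le_pow_right₀ (by norm_num) (Finset.card_le_card inter_subset_right)
  set t' : ℝ := (2 : ℝ) ^ #(M.primeFactors ∩ T) with ht'
  set t : ℝ := (2 : ℝ) ^ #T
  set δ := 1 - ∑ u ∈ U, 1 / (u : ℝ)
  set E := ∑ u ∈ U, (1 - 1 / (u : ℝ))
  set E' := ∑ u ∈ M.primeFactors \ T, (1 - 1 / (u : ℝ))
  have hκ' : (0 : ℝ) < κ := by exact_mod_cast hκ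
  have ht0 : 0 < t' := by positivity
  have hpos : 0 < Z + 1 - κ * t := by
    have : 0 ≤ κ * t * E := mul_nonneg (by positivity) (hE0.trans hE')
    exact pos_of_mul_pos_right (this.trans_lt hlt) hδ.le
  have hlt' : κ * t' * E' < (1 - ∑ u ∈ M.primeFactors \ T, 1 / (u : ℝ)) * (Z + 1 - κ * t') := by
    calc κ * t' * E' ≤ κ * t * E := by gcongr
      _ < δ * (Z + 1 - κ * t) := hlt
      _ ≤ (1 - ∑ u ∈ M.primeFactors \ T, 1 / (u : ℝ)) * (Z + 1 - κ * t') := by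
        have : δ ≤ 1 - ∑ u ∈ M.primeFactors \ T, 1 / (u : ℝ) := by
          simp only [δ]; linarith
        gcongr
        exact hδ.le.trans this
  set δ' := 1 - ∑ u ∈ M.primeFactors \ T, 1 / (u : ℝ)
  have hδ0 : 0 < δ' := by simp only [δ, δ'] at hδ ⊢; linarith
  obtain ⟨v, hv, h2⟩ := exists_of_sieve hz hB hM (T := M.primeFactors ∩ T)
    (U := M.primeFactors \ T) (disjoint_sdiff.mono_left inter_subset_right)
    (fun x hx => hprime x (mem_inter.1 hx).1) (fun x hx => hprime x (mem_sdiff.1 hx).1) hδ0 (by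
      rw [← ht']
      have h1 := mul_lt_mul_of_pos_left hlt' hB0
      have h2 := mul_le_mul_of_nonneg_left hV hδ0.le
      refine lt_of_mul_lt_mul_left ?_ hκ'.le
      calc κ * (t' * B * E') = B * (κ * t' * E') := by ring
        _ < B * (δ' * (Z + 1 - κ * t')) := h1
        _ = δ' * (B * (Z + 1 - κ)) - δ' * (κ * ((t' - 1) * B)) := by ring
        _ ≤ δ' * (κ * #V) - δ' * (κ * ((t' - 1) * B)) := by linarith
        _ = κ * (δ' * (#V - (t' - 1) * B)) := by ring)
  refine ⟨v, hv, fun ℓ hℓ => h2 ℓ ?_⟩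
  by_cases hT : ℓ ∈ T
  · exact mem_union_left _ (mem_inter.2 ⟨hℓ, hT⟩)
  · exact mem_union_right _ (mem_sdiff.2 ⟨hℓ, hT⟩)

section Squares

variable {K L : Type*} [Field K] [Field L] [Algebra K L] [Fintype L] {M : ℕ}

lemma exists_mulChar_orderOf_eq_card_sub_one (L : Type*) [Field L] [Fintype L] :
    ∃ χ : MulChar L ℂ, orderOf χ = Fintype.card L - 1 := by
  have h : Fintype.card L - 1 ≠ 0 := by have := Fintype.one_lt_card (α := L); omega
  exact MulChar.exists_mulChar_orderOf L dvd_rfl (Complex.isPrimitiveRoot_exp _ h)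

lemma MulChar.apply_pow_eq_neg_one {χ : MulChar L ℂ} (hχ : χ ^ M ≠ 1)
    (hM : Fintype.card L - 1 = 2 * M) {v : L} (hv : v ≠ 0) (hv1 : v ^ M ≠ 1) :
    χ v ^ M = -1 := by
  have hneg : ∀ w : L, w ≠ 0 → w ^ M ≠ 1 → w ^ M = -1 := by
    intro w hw hw1
    have h := FiniteField.pow_card_sub_one_eq_one w hw
    rw [hM, mul_comm, pow_mul] at h
    exact (sq_eq_one_iff.1 h).resolve_left hw1
  obtain ⟨u, hu⟩ := MulChar.ne_one_iff.1 hχ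
  rw [MulChar.pow_apply_coe] at hu
  have hu1 : (u : L) ^ M = -1 := hneg u u.ne_zero fun h => hu (by rw [← map_pow, h, map_one])
  have h1 : χ v ^ M = χ u ^ M := by
    rw [← map_pow, ← map_pow, hu1, hneg v hv hv1]
  have h2 : (χ u ^ M) ^ 2 = 1 := by
    rw [← map_pow, ← map_pow, hu1]; simp
  rw [h1]
  exact (sq_eq_one_iff.1 h2).resolve_left hu

/-- The squares of given trace, where `2 * M = #L - 1`. -/
noncomputable def squaresOfTrace (L : Type*) {K : Type*} [Field K] [Field L] [Algebra K L]
    [Fintype L] (M : ℕ) (α : K) : Finset L :=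
  open Classical in {v : L | v ^ M = 1 ∧ Algebra.trace K L v = α}

lemma mem_squaresOfTrace {α : K} {v : L} :
    v ∈ squaresOfTrace L M α ↔ v ^ M = 1 ∧ Algebra.trace K L v = α := by
  simp [squaresOfTrace]

lemma sum_squaresOfTrace {χ : MulChar L ℂ} (hχ : χ ^ M ≠ 1) (hM : Fintype.card L - 1 = 2 * M)
    (α : K) (k : ℕ) : ∑ v ∈ squaresOfTrace L M α, χ v ^ k =
      (traceSum (χ ^ k) α + traceSum (χ ^ (k + M)) α) / 2 := by
  classical
  have hM0 : M ≠ 0 := by rintro rfl; simp at hχ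
  have hset : squaresOfTrace L M α = ({v : L | Algebra.trace K L v = α} : Finset L).filter
      fun v => v ^ M = 1 := by
    ext v
    simp [mem_squaresOfTrace, and_comm]
  rw [hset, Finset.sum_filter, traceSum, traceSum, ← Finset.sum_add_distrib, Finset.sum_div]
  refine Finset.sum_congr (by congr) fun v _ => ?_
  by_cases hv : v = 0
  · subst hv
    simp [hM0, MulChar.map_zero]
  · lift v to Lˣ using IsUnit.mk0 v hv
    rw [MulChar.pow_apply_coe, MulChar.pow_apply_coe, pow_add]
    split_ifs with h1
    · rw [← map_pow χ _ M, h1, map_one]; ring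
    · rw [MulChar.apply_pow_eq_neg_one hχ hM v.ne_zero h1]; ring

lemma traceSum_one [Fintype K] [DecidableEq K] {n q : ℕ} (hn : 1 ≤ n) (hK : Fintype.card K = q)
    (hL : Fintype.card L = q ^ n) (α : K) :
    traceSum (1 : MulChar L ℂ) α = (q : ℂ) ^ (n - 1) - if α = 0 then 1 else 0 := by
  classical
  have h := card_trace_eq hn hK hL α
  have h1 : ∀ v : L, (1 : MulChar L ℂ) v = 1 - if v = 0 then 1 else 0 := by
    intro v
    by_cases hv : v = 0
    · simp [hv, MulChar.map_zero]
    · simp [hv, MulChar.one_apply (IsUnit.mk0 v hv)]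
  rw [traceSum]
  simp_rw [h1]
  rw [Finset.sum_sub_distrib, Finset.sum_ite_eq' _ (0 : L)]
  simp only [sum_const, nsmul_eq_mul, mul_one, mem_filter, mem_univ, true_and, map_zero]
  congr 1
  · rw [← Nat.cast_pow, ← h]
    congr!
  · simp [eq_comm]

end Squares

lemma exists_coprime_add_mul {a r M : ℕ} (har : a.Coprime r) (hM : M ≠ 0) :
    ∃ b, (a + r * b).Coprime M := by
  refine ⟨∏ ℓ ∈ M.primeFactors with ¬ ℓ ∣ a, ℓ, ?_⟩
  refine Nat.coprime_of_dvd fun ℓ hℓ h1 h2 => ?_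
  by_cases h : ℓ ∣ a
  · have h3 := (Nat.dvd_add_right h).1 h1
    rcases hℓ.dvd_mul.1 h3 with h4 | h4
    · exact hℓ.one_lt.ne' (Nat.eq_one_of_dvd_coprimes har h h4)
    · obtain ⟨x, hx, h5⟩ := (hℓ.prime.dvd_finsetProd_iff _).1 h4
      rw [mem_filter] at hx
      exact hx.2 ((Nat.prime_dvd_prime_iff_eq hℓ (Nat.prime_of_mem_primeFactors hx.1)).1 h5 ▸ h)
  · have h3 : ℓ ∣ r * ∏ ℓ ∈ M.primeFactors with ¬ ℓ ∣ a, ℓ :=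
      (Finset.dvd_prod_of_mem _ (by simp [h, h2, hℓ, hM])).mul_left r
    exact h ((Nat.dvd_add_left h3).1 h1)

/-- An element whose `s`-th power has the largest possible order among elements of `⟨h⟩` can be
moved to a generator of `⟨h⟩` by an element of exponent `s`. -/
lemma exists_mul_orderOf_eq {G : Type*} [CommGroup G] {h : G} {s r M a : ℕ} (hM : M ≠ 0)
    (hh : orderOf h = M) (hs : orderOf (h ^ s) = r) (ha : orderOf ((h ^ a) ^ s) = r) :
    ∃ c : G, c ^ s = 1 ∧ orderOf (h ^ a * c) = M := by
  have hr : r ≠ 0 := by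
    rintro rfl
    rw [orderOf_eq_zero_iff'] at hs
    exact hs M (by omega) (by rw [← pow_mul, mul_comm, pow_mul, ← hh, pow_orderOf_eq_one, one_pow])
  have har : a.Coprime r := by
    rw [← pow_mul, mul_comm, pow_mul,
      IsOfFinOrder.orderOf_pow _ _ (orderOf_ne_zero_iff.1 (hs ▸ hr)), hs,
      Nat.div_eq_self] at ha
    exact (Nat.gcd_comm a r).trans (ha.resolve_left hr)
  obtain ⟨b, hb⟩ := exists_coprime_add_mul har hM
  refine ⟨h ^ (r * b), ?_, ?_⟩
  · rw [← pow_mul, mul_comm, pow_mul, pow_mul, ← hs, pow_orderOf_eq_one, one_pow]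
  · rw [← pow_add, ← hh]
    exact Nat.Coprime.orderOf_pow (by rw [hh]; exact hb.symm)

section Field

variable {K L : Type*} [Field K] [Field L] [Algebra K L] [Fintype K] [Fintype L] {M q n : ℕ}

lemma trace_mul_eq_zero {v c : L} (hK : Fintype.card K = q) (hc : c ^ (q - 1) = 1)
    (hv : Algebra.trace K L v = 0) : Algebra.trace K L (v * c) = 0 := by
  apply (algebraMap K L).injective
  have h := FiniteField.algebraMap_trace_eq_sum_pow K L v
  rw [hv, map_zero] at h
  rw [map_zero, FiniteField.algebraMap_trace_eq_sum_pow]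
  have hcq : c ^ Nat.card K = c := by
    rw [Nat.card_eq_fintype_card, hK]
    obtain ⟨m, hm⟩ : ∃ m, q = m + 1 := ⟨q - 1, by have := Fintype.card_pos (α := K); omega⟩
    rw [hm, pow_succ, ← Nat.add_sub_cancel (n := m) (m := 1), ← hm, hc, one_mul]
  have hci : ∀ i, c ^ Nat.card K ^ i = c := by
    intro i
    induction i with
    | zero => simp
    | succ i ih => rw [pow_succ, pow_mul, ih, hcq]
  simp_rw [mul_pow, hci, ← Finset.sum_mul, ← h, zero_mul]

lemma MulChar.pow_apply_eq_one_iff {χ : MulChar L ℂ} (hχ : orderOf χ = Fintype.card L - 1)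
    {v : L} (hv : v ≠ 0) (k : ℕ) : χ v ^ k = 1 ↔ v ^ k = 1 := by
  constructor
  · intro h
    obtain ⟨g, hg⟩ := IsCyclic.exists_generator (α := Lˣ)
    lift v to Lˣ using IsUnit.mk0 v hv
    obtain ⟨i, rfl⟩ := mem_powers_iff_mem_zpowers.2 (hg v)
    have h1 : χ ^ (i * k) = 1 := by
      rw [MulChar.eq_iff hg, MulChar.pow_apply_coe, MulChar.one_apply_coe, pow_mul]
      simpa using h
    have h2 := orderOf_dvd_of_pow_eq_one h1
    rw [hχ] at h2
    obtain ⟨c, hc⟩ := h2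
    simp only [Units.val_pow_eq_pow_val]
    rw [← pow_mul, hc, pow_mul, FiniteField.pow_card_sub_one_eq_one _ g.ne_zero, one_pow]
  · intro h
    rw [← map_pow, h, map_one]

lemma orderOf_eq_of_mulChar {χ : MulChar L ℂ} (hχ : orderOf χ = Fintype.card L - 1) {v : L}
    (hv : v ≠ 0) {s r : ℕ} (hr : r ≠ 0) (h1 : (χ v ^ s) ^ r = 1)
    (h2 : ∀ ℓ ∈ r.primeFactors, (χ v ^ s) ^ (r / ℓ) ≠ 1) : orderOf (v ^ s) = r := by
  refine orderOf_eq_of_pow_and_pow_div_prime (Nat.pos_of_ne_zero hr) ?_ fun ℓ hℓ hd => ?_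
  · rw [← pow_mul] at h1 ⊢
    exact (MulChar.pow_apply_eq_one_iff hχ hv _).1 h1
  · have := h2 ℓ (by simp [hℓ, hd, hr])
    rw [← pow_mul] at this ⊢
    exact fun h => this ((MulChar.pow_apply_eq_one_iff hχ hv _).2 h)

lemma card_squaresOfTrace_ge [DecidableEq K] {χ : MulChar L ℂ} (hχ : χ ^ M ≠ 1) (hn : 1 ≤ n)
    (hK : Fintype.card K = q) (hL : Fintype.card L = q ^ n) (hM : q ^ n - 1 = 2 * M) (α : K)
    {B : ℝ} (hB : ‖traceSum (χ ^ M) α‖ ≤ B) :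
    (q : ℝ) ^ (n - 1) - (if α = 0 then 1 else 0) - B ≤ 2 * #(squaresOfTrace L M α) := by
  have h := sum_squaresOfTrace hχ (by rw [hL, hM]) α 0
  simp only [pow_zero, sum_const, nsmul_eq_mul, mul_one, zero_add] at h
  rw [traceSum_one hn hK hL, eq_div_iff two_ne_zero] at h
  have h1 : traceSum (χ ^ M) α = (((#(squaresOfTrace L M α) : ℝ) * 2 -
      ((q : ℝ) ^ (n - 1) - (if α = 0 then 1 else 0)) : ℝ) : ℂ) := by
    push_cast
    rw [h]
    split_ifs <;> simp
  rw [h1, Complex.norm_real, Real.norm_eq_abs, abs_le] at hB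
  linarith [hB.1]

lemma exists_orderOf_eq_of_ne_zero (hn : 1 ≤ n) (hK : Fintype.card K = q)
    (hL : Fintype.card L = q ^ n) (hM : q ^ n - 1 = 2 * M) {α : K} (hα : α ≠ 0)
    (hs : SieveCriterion M 2 (√((q : ℝ) ^ (n - 1)))) :
    ∃ β : L, orderOf β = M ∧ Algebra.trace K L β = α := by
  classical
  have hq : 0 < q := hK ▸ Fintype.card_pos
  have hM0 : M ≠ 0 := by
    have := Fintype.one_lt_card (α := L); omega
  obtain ⟨χ, hχ⟩ := exists_mulChar_orderOf_eq_card_sub_one L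
  rw [hL, hM] at hχ
  have hχk : ∀ k, ¬ 2 * M ∣ k → χ ^ k ≠ 1 := fun k hk h =>
    hk (hχ ▸ orderOf_dvd_of_pow_eq_one h)
  have hχM : χ ^ M ≠ 1 := hχk M fun h => by have := Nat.le_of_dvd (by omega) h; omega
  have hX : (0 : ℝ) < √((q : ℝ) ^ (n - 1)) := by positivity
  obtain ⟨v, hv, h⟩ := hs.exists_forall_pow_ne_one (V := squaresOfTrace L M α) (z := fun v => χ v)
    (B := √((q : ℝ) ^ (n - 1))) hM0 two_pos hX
    (fun v hv => by rw [← map_pow, (mem_squaresOfTrace.1 hv).1, map_one])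
    (fun k hk => by
      rw [sum_squaresOfTrace hχM (by rw [hL, hM])]
      have h1 := norm_traceSum_le_of_ne_zero hn hK hL
        (hχk k fun h => hk ((Dvd.intro_left 2 rfl).trans h)) hα
      have h2 := norm_traceSum_le_of_ne_zero hn hK hL
        (hχk (k + M) fun h => hk ((Nat.dvd_add_left dvd_rfl).1 ((Dvd.intro_left 2 rfl).trans h))) hα
      rw [norm_div, Complex.norm_two, div_le_iff₀ two_pos]
      linarith [norm_add_le (traceSum (χ ^ k) α) (traceSum (χ ^ (k + M)) α)])
    (by
      have h1 := card_squaresOfTrace_ge hχM hn hK hL hM α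
        (norm_traceSum_le_of_ne_zero hn hK hL hχM hα)
      rw [if_neg hα] at h1
      have h2 := Real.mul_self_sqrt (show (0 : ℝ) ≤ (q : ℝ) ^ (n - 1) by positivity)
      push_cast
      linarith)
  obtain ⟨hv1, hv2⟩ := mem_squaresOfTrace.1 hv
  have hv0 : v ≠ 0 := by rintro rfl; simp [hM0] at hv1
  refine ⟨v, ?_, hv2⟩
  have := orderOf_eq_of_mulChar (s := 1) (by rw [hχ, hL, hM]) hv0 hM0
    (by rw [pow_one, ← map_pow, hv1, map_one]) (by simpa using h)
  simpa using this

lemma exists_squares_orderOf_pow {r : ℕ} {Z : ℝ} (hn : 2 ≤ n) (hK : Fintype.card K = q)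
    (hL : Fintype.card L = q ^ n) (hM : q ^ n - 1 = 2 * M) (hr : (q - 1) * r = M)
    (hZ : ((q : ℝ) - 1) * √((q : ℝ) ^ (n - 2)) * Z = (q : ℝ) ^ (n - 1) - 1)
    (hs : SieveCriterion r 2 Z) :
    ∃ v : L, v ^ M = 1 ∧ orderOf (v ^ (q - 1)) = r ∧ Algebra.trace K L v = 0 := by
  classical
  have hq : 1 < q := hK ▸ Fintype.one_lt_card
  have hM0 : M ≠ 0 := by
    have := Fintype.one_lt_card (α := L); omega
  have hr0 : r ≠ 0 := by rintro rfl; omega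
  have hq1 : 0 < q - 1 := by omega
  obtain ⟨χ, hχ⟩ := exists_mulChar_orderOf_eq_card_sub_one L
  rw [hL, hM] at hχ
  have hχk : ∀ k, ¬ 2 * M ∣ k → χ ^ k ≠ 1 := fun k hk h =>
    hk (hχ ▸ orderOf_dvd_of_pow_eq_one h)
  have hχM : χ ^ M ≠ 1 := hχk M fun h => by have := Nat.le_of_dvd (by omega) h; omega
  have hq' : (0 : ℝ) < q - 1 := by rw [sub_pos]; exact_mod_cast hq
  obtain ⟨v, hv, h⟩ := hs.exists_forall_pow_ne_one (V := squaresOfTrace L M (0 : K))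
    (z := fun v => χ v ^ (q - 1)) (B := (q - 1) * √((q : ℝ) ^ (n - 2))) hr0 two_pos
    (by positivity)
    (fun v hv => by rw [← pow_mul, hr, ← map_pow, (mem_squaresOfTrace.1 hv).1, map_one])
    (fun k hk => by
      have hk' : ¬ M ∣ (q - 1) * k := by
        rw [← hr]
        exact fun h => hk ((Nat.mul_dvd_mul_iff_left hq1).1 h)
      simp_rw [← pow_mul]
      rw [sum_squaresOfTrace hχM (by rw [hL, hM])]
      have h1 := norm_traceSum_zero_le (K := K) hn hK hL
        (hχk ((q - 1) * k) fun h => hk' ((Dvd.intro_left 2 rfl).trans h))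
      have h2 := norm_traceSum_zero_le (K := K) hn hK hL
        (hχk ((q - 1) * k + M) fun h =>
          hk' ((Nat.dvd_add_left dvd_rfl).1 ((Dvd.intro_left 2 rfl).trans h)))
      rw [norm_div, Complex.norm_two, div_le_iff₀ two_pos]
      linarith [norm_add_le (traceSum (χ ^ ((q - 1) * k)) (0 : K))
        (traceSum (χ ^ ((q - 1) * k + M)) (0 : K))])
    (by
      have h1 := card_squaresOfTrace_ge hχM (by omega) hK hL hM (0 : K)
        (norm_traceSum_zero_le hn hK hL hχM)
      rw [if_pos rfl] at h1
      push_cast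
      linarith)
  obtain ⟨hv1, hv2⟩ := mem_squaresOfTrace.1 hv
  have hv0 : v ≠ 0 := by rintro rfl; simp [hM0] at hv1
  refine ⟨v, hv1, orderOf_eq_of_mulChar (by rw [hχ, hL, hM]) hv0 hr0 ?_ h, hv2⟩
  rw [← pow_mul, hr, ← map_pow, hv1, map_one]

lemma exists_trace_zero_orderOf_pow {r : ℕ} {Z : ℝ} (hn : 2 ≤ n) (hK : Fintype.card K = q)
    (hL : Fintype.card L = q ^ n) (hr : (q - 1) * r = q ^ n - 1)
    (hZ : ((q : ℝ) - 1) * √((q : ℝ) ^ (n - 2)) * Z = (q : ℝ) ^ (n - 1) - 1)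
    (hs : SieveCriterion r 1 Z) :
    ∃ v : L, v ≠ 0 ∧ orderOf (v ^ (q - 1)) = r ∧ Algebra.trace K L v = 0 := by
  classical
  have hq : 1 < q := hK ▸ Fintype.one_lt_card
  have hr0 : r ≠ 0 := by
    rintro rfl
    have := Fintype.one_lt_card (α := L); omega
  have hq1 : 0 < q - 1 := by omega
  obtain ⟨χ, hχ⟩ := exists_mulChar_orderOf_eq_card_sub_one L
  rw [hL] at hχ
  have hq' : (0 : ℝ) < q - 1 := by rw [sub_pos]; exact_mod_cast hq
  have hone : ∀ v : L, v ≠ 0 → (χ v ^ (q - 1)) ^ r = 1 := fun v hv => by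
    rw [← pow_mul, hr, ← hL, ← map_pow, FiniteField.pow_card_sub_one_eq_one v hv, map_one]
  have hsum : ∀ φ : MulChar L ℂ, ∑ v with Algebra.trace K L v = 0 ∧ v ≠ 0, φ v =
      traceSum φ (0 : K) := by
    intro φ
    rw [traceSum, ← Finset.filter_filter]
    refine Finset.sum_filter_of_ne (p := fun v => v ≠ 0) fun v _ h hv => h ?_
    rw [hv, MulChar.map_zero]
  obtain ⟨v, hv, h⟩ := hs.exists_forall_pow_ne_one
    (V := {v : L | Algebra.trace K L v = 0 ∧ v ≠ 0})
    (z := fun v => χ v ^ (q - 1)) (B := (q - 1) * √((q : ℝ) ^ (n - 2))) hr0 one_pos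
    (by positivity) (fun v hv => hone v (mem_filter.1 hv).2.2)
    (fun k hk => by
      have hk' : χ ^ ((q - 1) * k) ≠ 1 := fun h => by
        have := orderOf_dvd_of_pow_eq_one h
        rw [hχ, ← hr] at this
        exact hk ((Nat.mul_dvd_mul_iff_left hq1).1 this)
      have := hsum (χ ^ ((q - 1) * k))
      refine le_trans (le_of_eq ?_) (norm_traceSum_zero_le (K := K) hn hK hL hk')
      rw [← this]
      refine congrArg _ (Finset.sum_congr rfl fun v hv => ?_)
      rw [← pow_mul, MulChar.pow_apply' _ (by rintro h; simp [h] at hk')])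
    (by
      have h1 := hsum 1
      rw [traceSum_one (by omega) hK hL, if_pos rfl,
        Finset.sum_congr rfl (g := fun _ => (1 : ℂ)) fun v hv =>
          MulChar.one_apply (IsUnit.mk0 v (mem_filter.1 hv).2.2)] at h1
      simp only [sum_const, nsmul_eq_mul, mul_one] at h1
      have h2 : (#{v : L | Algebra.trace K L v = 0 ∧ v ≠ 0} : ℝ) = (q : ℝ) ^ (n - 1) - 1 := by
        apply Complex.ofReal_injective
        push_cast
        exact h1
      rw [h2]
      push_cast
      linarith)
  obtain ⟨-, hv2, hv0⟩ := mem_filter.1 hv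
  exact ⟨v, hv0, orderOf_eq_of_mulChar (by rw [hχ, hL]) hv0 hr0 (hone v hv0) h, hv2⟩

lemma exists_orderOf_eq_of_orderOf_pow {h : Lˣ} {r a : ℕ} (hM : M ≠ 0)
    (hK : Fintype.card K = q) (hh : orderOf h = M) (hs : orderOf (h ^ (q - 1)) = r)
    (ha : orderOf ((h ^ a) ^ (q - 1)) = r) (htr : Algebra.trace K L (h ^ a : Lˣ) = 0) :
    ∃ β : L, orderOf β = M ∧ Algebra.trace K L β = 0 := by
  obtain ⟨c, hc, h1⟩ := exists_mul_orderOf_eq hM hh hs ha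
  refine ⟨(h ^ a * c : Lˣ), by rw [orderOf_units, h1], ?_⟩
  rw [Units.val_mul]
  refine trace_mul_eq_zero hK ?_ htr
  rw [← Units.val_pow_eq_pow_val, hc, Units.val_one]

lemma exists_units_generator (hL : Fintype.card L = q ^ n) :
    ∃ g : Lˣ, orderOf g = q ^ n - 1 ∧ ∀ v : Lˣ, ∃ i : ℕ, g ^ i = v := by
  obtain ⟨g, hg⟩ := IsCyclic.exists_generator (α := Lˣ)
  refine ⟨g, ?_, fun v => mem_powers_iff_mem_zpowers.2 (hg v)⟩
  rw [orderOf_eq_card_of_forall_mem_zpowers hg, Nat.card_units, Nat.card_eq_fintype_card, hL]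

lemma exists_orderOf_eq_trace_zero_of_even {r : ℕ} {Z : ℝ} (hn : 2 ≤ n)
    (hK : Fintype.card K = q) (hL : Fintype.card L = q ^ n) (hM : q ^ n - 1 = 2 * M)
    (hr : (q - 1) * r = M)
    (hZ : ((q : ℝ) - 1) * √((q : ℝ) ^ (n - 2)) * Z = (q : ℝ) ^ (n - 1) - 1)
    (hs : SieveCriterion r 2 Z) :
    ∃ β : L, orderOf β = M ∧ Algebra.trace K L β = 0 := by
  have hM0 : M ≠ 0 := by
    have := Fintype.one_lt_card (α := L); omega
  have hq1 : q - 1 ≠ 0 := by rintro h; simp [h] at hr; omega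
  obtain ⟨v, hv1, hv2, hv3⟩ := exists_squares_orderOf_pow hn hK hL hM hr hZ hs
  obtain ⟨g, hg, hgen⟩ := exists_units_generator hL
  have hv0 : v ≠ 0 := by rintro rfl; simp [hM0] at hv1
  lift v to Lˣ using IsUnit.mk0 v hv0
  obtain ⟨i, rfl⟩ := hgen v
  have h2 : (2 : ℕ) ∣ i := by
    have h3 : g ^ (i * M) = 1 := by
      rw [pow_mul]; exact Units.ext hv1
    have h4 := orderOf_dvd_of_pow_eq_one h3
    rw [hg, hM] at h4
    exact (Nat.mul_dvd_mul_iff_right (Nat.pos_of_ne_zero hM0)).1 h4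
  obtain ⟨a, rfl⟩ := h2
  rw [← Units.val_pow_eq_pow_val, orderOf_units] at hv2
  rw [pow_mul] at hv2 hv3
  have hh : orderOf (g ^ 2) = M := by
    rw [orderOf_pow_of_dvd two_ne_zero (by rw [hg, hM]; exact Dvd.intro _ rfl), hg, hM,
      Nat.mul_div_cancel_left _ two_pos]
  refine exists_orderOf_eq_of_orderOf_pow hM0 hK hh ?_ hv2 hv3
  rw [orderOf_pow_of_dvd hq1 (by rw [hh, ← hr]; exact Dvd.intro _ rfl), hh, ← hr,
    Nat.mul_div_cancel_left _ (Nat.pos_of_ne_zero hq1)]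

lemma exists_orderOf_eq_trace_zero_of_odd {r : ℕ} {Z : ℝ} (hn : 2 ≤ n)
    (hK : Fintype.card K = q) (hL : Fintype.card L = q ^ n) (hM : q ^ n - 1 = 2 * M)
    (hr : (q - 1) * r = q ^ n - 1) (hodd : Odd r)
    (hZ : ((q : ℝ) - 1) * √((q : ℝ) ^ (n - 2)) * Z = (q : ℝ) ^ (n - 1) - 1)
    (hs : SieveCriterion r 1 Z) :
    ∃ β : L, orderOf β = M ∧ Algebra.trace K L β = 0 := by
  have hM0 : M ≠ 0 := by
    have := Fintype.one_lt_card (α := L); omega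
  have hq1 : q - 1 ≠ 0 := by rintro h; simp [h] at hr; omega
  obtain ⟨v, hv0, hv2, hv3⟩ := exists_trace_zero_orderOf_pow hn hK hL hr hZ hs
  obtain ⟨g, hg, hgen⟩ := exists_units_generator hL
  lift v to Lˣ using IsUnit.mk0 v hv0
  obtain ⟨j, rfl⟩ := hgen v
  obtain ⟨k, hk⟩ := hodd
  have hh : orderOf (g ^ 2) = M := by
    rw [orderOf_pow_of_dvd two_ne_zero (by rw [hg, hM]; exact Dvd.intro _ rfl), hg, hM,
      Nat.mul_div_cancel_left _ two_pos]
  have hgr : (g ^ r) ^ (q - 1) = 1 := by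
    rw [← pow_mul, mul_comm, hr, ← hg, pow_orderOf_eq_one]
  have ha : (g ^ 2) ^ (j * (k + 1)) = g ^ j * (g ^ r) ^ j := by
    rw [hk]; simp only [← pow_mul, ← pow_add]; congr 1; ring
  rw [← Units.val_pow_eq_pow_val, orderOf_units] at hv2
  have hgq : orderOf (g ^ (q - 1)) = r := by
    rw [orderOf_pow_of_dvd hq1 (by rw [hg, ← hr]; exact Dvd.intro _ rfl), hg, ← hr,
      Nat.mul_div_cancel_left _ (Nat.pos_of_ne_zero hq1)]
  refine exists_orderOf_eq_of_orderOf_pow (a := j * (k + 1)) hM0 hK hh (r := r) ?_ ?_ ?_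
  · rw [← pow_mul, mul_comm, pow_mul, Nat.Coprime.orderOf_pow, hgq]
    rw [hgq, hk]; simp
  · rw [ha, mul_pow, ← pow_mul (g ^ r) j, mul_comm j, pow_mul (g ^ r), hgr, one_pow, mul_one, hv2]
  · rw [ha, Units.val_mul]
    refine trace_mul_eq_zero hK ?_ hv3
    rw [← Units.val_pow_eq_pow_val, ← pow_mul, mul_comm, pow_mul, hgr, one_pow, Units.val_one]

end Field

lemma SieveCriterion.one_of_two {m : ℕ} {Z : ℝ} (h : SieveCriterion m 2 (2 * Z + 1)) :
    SieveCriterion m 1 Z := by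
  obtain ⟨T, U, hTU, hδ, h⟩ := h
  refine ⟨T, U, hTU, hδ, ?_⟩
  push_cast at h ⊢
  linarith

lemma sum_one_sub_one_div (U : Finset ℕ) :
    ∑ u ∈ U, (1 - 1 / (u : ℝ)) = #U - ∑ u ∈ U, 1 / (u : ℝ) := by
  simp [Finset.sum_sub_distrib]

lemma sieveCriterion_of_card_primeFactors {m κ : ℕ} {Z : ℝ}
    (h : κ * 2 ^ #m.primeFactors < Z + 1) : SieveCriterion m κ Z :=
  ⟨m.primeFactors, ∅, by simp, by simp, by simpa using h⟩

lemma sieveCriterion_of_lt_pow {m κ b k : ℕ} {Z δ : ℝ} (T S : Finset ℕ) (hb : 0 < b)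
    (hm0 : m ≠ 0) (hm : m < b ^ (k + 1)) (hsmall : ∀ ℓ ∈ m.primeFactors, ℓ < b → ℓ ∈ T ∪ S)
    (hδ0 : 0 < δ) (hδ : δ ≤ 1 - (∑ u ∈ S, 1 / (u : ℝ) + k / b)) (hS : S.Nonempty)
    (hZ : κ * 2 ^ #T * ((#S : ℝ) + k - 1) < δ * (Z + 1 - 2 * (κ * 2 ^ #T))) :
    SieveCriterion m κ Z := by
  set V := m.primeFactors.filter (b ≤ ·) with hV
  have hVk : #V ≤ k := by
    by_contra! hlt
    have h1 : b ^ #V ≤ ∏ ℓ ∈ V, ℓ :=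
      Finset.pow_card_le_prod _ _ _ fun ℓ hℓ => (mem_filter.1 hℓ).2
    have h2 : ∏ ℓ ∈ V, ℓ ∣ m :=
      (Finset.prod_dvd_prod_of_subset _ _ _ (filter_subset _ _)).trans (Nat.prod_primeFactors_dvd m)
    have h3 : b ^ (k + 1) ≤ b ^ #V := Nat.pow_le_pow_right hb hlt
    have h4 := Nat.le_of_dvd (Nat.pos_of_ne_zero hm0) h2
    omega
  have hVsum : ∑ u ∈ V, 1 / (u : ℝ) ≤ k / b := by
    have h1 : ∑ u ∈ V, 1 / (u : ℝ) ≤ #V • (1 / (b : ℝ)) := by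
      refine Finset.sum_le_card_nsmul _ _ _ fun u hu => ?_
      have : (b : ℝ) ≤ u := by exact_mod_cast (mem_filter.1 hu).2
      gcongr
    refine h1.trans ?_
    rw [nsmul_eq_mul, mul_one_div]
    gcongr
  have hsum : ∑ u ∈ S ∪ V, 1 / (u : ℝ) ≤ ∑ u ∈ S, 1 / (u : ℝ) + k / b := by
    have h1 := Finset.sum_union_inter (s₁ := S) (s₂ := V) (f := fun u : ℕ => 1 / (u : ℝ))
    have h2 : 0 ≤ ∑ u ∈ S ∩ V, 1 / (u : ℝ) := Finset.sum_nonneg fun _ _ => by positivity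
    linarith
  have hcard : (#(S ∪ V) : ℝ) ≤ #S + k := by
    exact_mod_cast (Finset.card_union_le S V).trans (by omega)
  have hS1 : (1 : ℝ) ≤ #S := by exact_mod_cast hS.card_pos
  have hk0 : (0 : ℝ) ≤ k := by positivity
  have hpos : 0 < Z + 1 - 2 * (κ * 2 ^ #T) := by
    refine pos_of_mul_pos_right (lt_of_le_of_lt ?_ hZ) hδ0.le
    exact mul_nonneg (by positivity) (by linarith)
  refine ⟨T, S ∪ V, fun ℓ hℓ => ?_, by linarith, ?_⟩
  · by_cases h : ℓ < b
    · rw [← union_assoc]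
      exact mem_union_left _ (hsmall ℓ hℓ h)
    · exact mem_union_right _ (mem_union_right _ (mem_filter.2 ⟨hℓ, not_lt.1 h⟩))
  · rw [sum_one_sub_one_div]
    set D := ∑ u ∈ S ∪ V, 1 / (u : ℝ)
    have h1 : κ * 2 ^ #T * ((#(S ∪ V) : ℝ) - 1) ≤ κ * 2 ^ #T * ((#S : ℝ) + k - 1) := by
      gcongr
    have h2 : δ * (Z + 1 - 2 * (κ * 2 ^ #T)) ≤ (1 - D) * (Z + 1 - 2 * (κ * 2 ^ #T)) := by
      gcongr
      linarith
    linarith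

lemma pow_card_primeFactors_mul_le {m c : ℕ} (hm : m ≠ 0) (S : Finset ℕ) (hS : ∀ ℓ ∈ S, ℓ ≤ c)
    (hsmall : ∀ ℓ ∈ m.primeFactors, ℓ < c → ℓ ∈ S) :
    c ^ #m.primeFactors * ∏ ℓ ∈ S, ℓ ≤ c ^ #S * m := by
  set P := m.primeFactors
  have h1 : c ^ #(P \ S) ≤ ∏ ℓ ∈ P \ S, ℓ := Finset.pow_card_le_prod _ _ _ fun ℓ hℓ => by
    rw [mem_sdiff] at hℓ
    by_contra! h
    exact hℓ.2 (hsmall ℓ hℓ.1 h)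
  have h2 : ∏ ℓ ∈ S \ P, ℓ ≤ c ^ #(S \ P) := Finset.prod_le_pow_card _ _ _ fun ℓ hℓ =>
    hS ℓ (mem_sdiff.1 hℓ).1
  have h3 : ∏ ℓ ∈ P, ℓ ≤ m := Nat.le_of_dvd (Nat.pos_of_ne_zero hm) (Nat.prod_primeFactors_dvd m)
  rw [← Finset.prod_inter_mul_prod_sdiff P S] at h3
  rw [← Finset.prod_inter_mul_prod_sdiff S P, ← Finset.card_inter_add_card_sdiff P S,
    ← Finset.card_inter_add_card_sdiff S P, inter_comm S P, pow_add, pow_add]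
  calc c ^ #(P ∩ S) * c ^ #(P \ S) * ((∏ x ∈ P ∩ S, x) * ∏ x ∈ S \ P, x)
      ≤ c ^ #(P ∩ S) * (∏ ℓ ∈ P \ S, ℓ) * ((∏ x ∈ P ∩ S, x) * c ^ #(S \ P)) := by gcongr
    _ = c ^ #(P ∩ S) * c ^ #(S \ P) * ((∏ x ∈ P ∩ S, x) * ∏ ℓ ∈ P \ S, ℓ) := by ring
    _ ≤ _ := by gcongr

lemma Nat.Prime.mem_of_lt_seventeen {ℓ : ℕ} (hℓ : ℓ.Prime) (h : ℓ < 17) :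
    ℓ ∈ ({2, 3, 5, 7, 11, 13} : Finset ℕ) := by
  interval_cases ℓ <;> first | decide | (exact absurd hℓ (by norm_num))

/-- The sieve criterion for large arguments. -/
lemma sieveCriterion_two_of_large {m : ℕ} {x : ℝ} (hm0 : m ≠ 0) (hm : (m : ℝ) ≤ x ^ 3 / 2)
    (hx : 763 ≤ x) : SieveCriterion m 2 x := by
  rcases le_or_gt 4470 x with h | h
  · apply sieveCriterion_of_card_primeFactors
    have h1 := pow_card_primeFactors_mul_le (c := 16) hm0 {2, 3, 5, 7, 11, 13} (by decide)
      fun ℓ hℓ h => (Nat.prime_of_mem_primeFactors hℓ).mem_of_lt_seventeen (by omega)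
    have h2 : ((16 : ℝ) ^ #m.primeFactors) * 30030 ≤ 16 ^ 6 * m := by
      exact_mod_cast h1
    have h3 : (2 * (2 : ℝ) ^ #m.primeFactors) ^ 4 < x ^ 4 := by
      have h4 : (2 * (2 : ℝ) ^ #m.primeFactors) ^ 4 = 16 * 16 ^ #m.primeFactors := by
        rw [mul_pow, ← pow_mul, mul_comm _ 4, pow_mul]; norm_num
      rw [h4]
      have h5 : 4470 * x ^ 3 ≤ x ^ 4 := by
        rw [pow_succ x 3, mul_comm]; gcongr
      have h6 : 0 < x ^ 3 := by positivity
      norm_num at h2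
      linarith
    have := lt_of_pow_lt_pow_left₀ 4 (by linarith) h3
    push_cast
    linarith
  · refine sieveCriterion_of_lt_pow (b := 17) (k := 8) (δ := 0.2187) {2, 3, 5} {7, 11, 13}
      (by norm_num) hm0 ?_
      (fun ℓ hℓ h => (Nat.prime_of_mem_primeFactors hℓ).mem_of_lt_seventeen h)
      (by norm_num) (by norm_num) (by simp) ?_
    · have : x ^ 3 ≤ 4470 ^ 3 := by gcongr
      have h2 : (m : ℝ) < 118587876497 := by norm_num at this; linarith
      exact_mod_cast h2
    · have h3 : #({2, 3, 5} : Finset ℕ) = 3 := rfl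
      have h4 : #({7, 11, 13} : Finset ℕ) = 3 := rfl
      rw [h3, h4]
      push_cast
      linarith

set_option synthInstance.maxHeartbeats 200000 in
set_option synthInstance.maxSize 2000 in
lemma mem_of_mod_sq_add_add_one : ∀ ℓ < 64, (∀ d < 8, d ∣ ℓ → d = 1 ∨ d = ℓ) → ℓ ≠ 1 →
    ∀ r < ℓ, (r ^ 2 + r + 1) % ℓ = 0 → ℓ ∈ ({3, 7, 13, 19, 31, 37, 43, 61} : Finset ℕ) := by
  decide +kernel

lemma primeFactors_sq_add_add_one {q ℓ : ℕ} (hℓ : ℓ ∈ (q ^ 2 + q + 1).primeFactors)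
    (h : ℓ < 64) : ℓ ∈ ({3, 7, 13, 19, 31, 37, 43, 61} : Finset ℕ) := by
  have hp := Nat.prime_of_mem_primeFactors hℓ
  refine mem_of_mod_sq_add_add_one ℓ h (fun d _ hd => (Nat.dvd_prime hp).1 hd) hp.ne_one (q % ℓ)
    (Nat.mod_lt _ hp.pos) ?_
  have := Nat.mod_eq_zero_of_dvd (Nat.dvd_of_mem_primeFactors hℓ)
  rw [← this]
  exact ((((Nat.mod_modEq q ℓ).pow 2).add (Nat.mod_modEq q ℓ)).add_right 1)

/-- The sieve criterion for cubic extensions and trace zero. -/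
lemma sieveCriterion_cubic {q : ℕ} {Z : ℝ} (hq : 770 ≤ q) (hZ0 : 0 ≤ Z)
    (hZ : q * Z ^ 2 = ((q : ℝ) + 1) ^ 2) : SieveCriterion (q ^ 2 + q + 1) 1 Z := by
  have hq' : (770 : ℝ) ≤ q := by exact_mod_cast hq
  have hZ2 : (q : ℝ) + 2 < Z ^ 2 := by
    have h1 : (q : ℝ) * (q + 2) < q * Z ^ 2 := by rw [hZ]; linarith
    exact lt_of_mul_lt_mul_left h1 (by positivity)
  rcases le_or_gt 18040 q with h | h
  · apply sieveCriterion_of_card_primeFactors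
    have h1 := pow_card_primeFactors_mul_le (c := 64) (m := q ^ 2 + q + 1) (by positivity)
      {3, 7, 13, 19, 31, 37, 43, 61} (by decide)
      fun ℓ hℓ h => primeFactors_sq_add_add_one hℓ h
    set w := #(q ^ 2 + q + 1).primeFactors
    have h2 : ((64 : ℝ) ^ w) * 15605509647 ≤ 64 ^ 8 * (q ^ 2 + q + 1) := by
      exact_mod_cast h1
    have h : (18040 : ℝ) ≤ q := by exact_mod_cast h
    have h3 : ((2 : ℝ) ^ w) ^ 6 < Z ^ 6 := by
      have h4 : ((2 : ℝ) ^ w) ^ 6 = 64 ^ w := by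
        rw [← pow_mul, mul_comm, pow_mul]; norm_num
      rw [h4]
      have h5 : ((q : ℝ) + 2) ^ 3 < (Z ^ 2) ^ 3 := by gcongr
      rw [← pow_mul] at h5
      norm_num at h2 h5
      nlinarith
    have := lt_of_pow_lt_pow_left₀ 6 hZ0 h3
    push_cast
    linarith
  · refine sieveCriterion_of_lt_pow (b := 31) (k := 5) (δ := 0.566) {3} {7, 13, 19}
      (by norm_num) (by positivity) ?_
      (fun ℓ hℓ h => ?_)
      (by norm_num) (by norm_num) (by simp) ?_
    · have : q ^ 2 ≤ 18040 ^ 2 := by gcongr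
      norm_num at this ⊢
      omega
    · have := primeFactors_sq_add_add_one hℓ (by omega)
      simp only [mem_insert, mem_singleton, mem_union] at this ⊢
      omega
    · have h3 : #({3} : Finset ℕ) = 1 := rfl
      have h4 : #({7, 13, 19} : Finset ℕ) = 3 := rfl
      rw [h3, h4]
      have : (27.75 : ℝ) < Z := by
        refine lt_of_pow_lt_pow_left₀ 2 hZ0 ?_
        norm_num
        linarith
      push_cast
      linarith

/-- Trial division with bounded fuel, starting at the divisor `d`. -/
def trialDivision : ℕ → ℕ → ℕ → Option (List ℕ)
  | 0, _, _ => none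
  | fuel + 1, d, m =>
    bif (d * d).ble m then
      bif (m % d).beq 0 then (trialDivision fuel d (m / d)).map (d :: ·)
      else trialDivision fuel (d + 1) m
    else some (if m = 1 then [] else [m])

lemma mem_of_trialDivision {fuel d m : ℕ} {P : List ℕ} (hd : 2 ≤ d) (hm : m ≠ 0)
    (hP : trialDivision fuel d m = some P) (h : ∀ ℓ : ℕ, ℓ.Prime → ℓ ∣ m → d ≤ ℓ) :
    ∀ ℓ : ℕ, ℓ.Prime → ℓ ∣ m → ℓ ∈ P := by
  induction fuel generalizing d m P with
  | zero => simp [trialDivision] at hP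
  | succ fuel ih =>
    simp only [trialDivision, Bool.cond_eq_ite, Nat.ble_eq, Nat.beq_eq] at hP
    split_ifs at hP with h1 h3 h2
    · rw [Option.map_eq_some_iff] at hP
      obtain ⟨P', hP', rfl⟩ := hP
      have hdm : d ∣ m := Nat.dvd_of_mod_eq_zero h3
      obtain ⟨c, rfl⟩ := hdm
      rw [Nat.mul_div_cancel_left _ (by omega)] at hP'
      have := ih hd (by rintro rfl; simp at hm) hP' fun ℓ hℓ h4 => h ℓ hℓ (h4.mul_left d)
      intro ℓ hℓ h4
      rcases hℓ.dvd_mul.1 h4 with h5 | h5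
      · have h6 := h ℓ hℓ h4
        have h7 := Nat.le_of_dvd (by omega) h5
        simp [le_antisymm h7 h6]
      · exact List.mem_cons_of_mem _ (this ℓ hℓ h5)
    · refine ih (by omega) hm hP fun ℓ hℓ h4 => ?_
      refine Nat.lt_of_le_of_ne (h ℓ hℓ h4) ?_
      rintro rfl
      exact h3 (Nat.mod_eq_zero_of_dvd h4)
    · subst h2
      intro ℓ hℓ h4
      exact absurd (Nat.dvd_one.1 h4) hℓ.ne_one
    · intro ℓ hℓ h4
      have hprime : m.Prime := by
        by_contra hnp
        have h5 := Nat.minFac_sq_le_self (Nat.pos_of_ne_zero hm) hnp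
        have h6 := h _ (Nat.minFac_prime h2) (Nat.minFac_dvd m)
        exact h1 ((Nat.mul_le_mul h6 h6).trans (by rwa [← sq]))
      have := (Nat.prime_dvd_prime_iff_eq hℓ hprime).1 h4
      simp only [Option.some.injEq] at hP
      simp [← hP, this]

/-- The sieve criterion for the core `P.take t` and the sieving primes `P.drop t`, where the main
term satisfies `Z ^ 2 = N / D`. -/
def sieveCheckAt (κ N D : ℕ) (P : List ℕ) (t : ℕ) : Bool :=
  let U := P.drop t
  let b := U.prod
  let e := (U.map (b / ·)).sum
  e < b && (κ * 2 ^ t * (U.length * b + 2 * (b - e) - b) - (b - e)) ^ 2 * D < (b - e) ^ 2 * N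

lemma sieveCriterion_of_sieveCheckAt {m κ N D t : ℕ} {P : List ℕ} {Z : ℝ} (hP : P.Nodup)
    (hmem : ∀ ℓ ∈ m.primeFactors, ℓ ∈ P) (hZ0 : 0 ≤ Z) (hD : 0 < D) (hZ : Z ^ 2 * D = N)
    (h : sieveCheckAt κ N D P t = true) : SieveCriterion m κ Z := by
  simp only [sieveCheckAt, Bool.and_eq_true, decide_eq_true_eq] at h
  set U := P.drop t with hU
  set b := U.prod with hb
  set e := (U.map (b / ·)).sum with he
  obtain ⟨heb, hlt⟩ := h
  have hUnd : U.Nodup := hP.sublist (List.drop_sublist _ _)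
  have hb0 : (0 : ℝ) < b := by exact_mod_cast (Nat.zero_le e).trans_lt heb
  have heD : (e : ℝ) = b * ∑ u ∈ U.toFinset, 1 / (u : ℝ) := by
    rw [he, ← List.sum_toFinset _ hUnd, Nat.cast_sum, Finset.mul_sum]
    refine Finset.sum_congr rfl fun u hu => ?_
    have hub : u ∣ b := List.dvd_prod (List.mem_toFinset.1 hu)
    have hu0 : (u : ℝ) ≠ 0 := by
      rintro h0
      rw [Nat.cast_eq_zero] at h0
      rw [h0, zero_dvd_iff] at hub
      simp [hub] at hb0
    rw [Nat.cast_div hub hu0, mul_one_div]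
  have hcardU : #U.toFinset = U.length := List.toFinset_card_of_nodup hUnd
  have hcardT : #(P.take t).toFinset ≤ t :=
    (List.toFinset_card_le _).trans (by simp)
  set δ := 1 - ∑ u ∈ U.toFinset, 1 / (u : ℝ) with hδ
  have ha : ((b - e : ℕ) : ℝ) = b * δ := by
    rw [Nat.cast_sub heb.le, heD, hδ]; ring
  have ha0 : (0 : ℝ) < (b - e : ℕ) := by exact_mod_cast Nat.sub_pos_of_lt heb
  have hδ0 : 0 < δ := by
    rw [ha] at ha0
    exact pos_of_mul_pos_right ha0 hb0.le
  refine ⟨(P.take t).toFinset, U.toFinset, fun ℓ hℓ => ?_, hδ0, ?_⟩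
  · rw [← List.toFinset_append, List.take_append_drop, List.mem_toFinset]
    exact hmem ℓ hℓ
  have hk : U.length * b + 2 * (b - e) - b + b = U.length * b + 2 * (b - e) := by
    refine Nat.sub_add_cancel ?_
    rcases Nat.eq_zero_or_pos U.length with h0 | h0
    · rw [List.length_eq_zero_iff] at h0
      have : e = 0 := by simp [he, h0]
      omega
    · nlinarith
  set k := U.length * b + 2 * (b - e) - b
  have hk' : (k : ℝ) = b * (U.length + 2 * δ - 1) := by
    have : (k : ℝ) + b = U.length * b + 2 * (b - e : ℕ) := by exact_mod_cast hk
    rw [ha] at this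
    linarith
  have hsq : ((κ * 2 ^ t * k - (b - e) : ℕ) : ℝ) ^ 2 < ((b - e : ℕ) * Z) ^ 2 := by
    have h1 : ((κ * 2 ^ t * k - (b - e) : ℕ) : ℝ) ^ 2 * D < ((b - e : ℕ) : ℝ) ^ 2 * N := by
      exact_mod_cast hlt
    rw [← hZ, ← mul_assoc, ← mul_pow] at h1
    exact lt_of_mul_lt_mul_right h1 (by positivity)
  have hlt' := lt_of_pow_lt_pow_left₀ 2 (by positivity) hsq
  have h2 : ((κ * 2 ^ t * k : ℕ) : ℝ) - (b - e : ℕ) ≤ ((κ * 2 ^ t * k - (b - e) : ℕ) : ℝ) := by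
    rw [sub_le_iff_le_add]
    exact_mod_cast le_tsub_add
  push_cast at h2
  rw [hk'] at h2
  have h3 : κ * 2 ^ t * (U.length + 2 * δ - 1) < δ * (Z + 1) := by
    refine lt_of_mul_lt_mul_left ?_ hb0.le
    rw [ha] at hlt' h2
    linarith
  rw [sum_one_sub_one_div, hcardU]
  have h4 : (2 : ℝ) ^ #(P.take t).toFinset ≤ 2 ^ t := pow_le_pow_right₀ (by norm_num) hcardT
  have h5 : ∑ u ∈ U.toFinset, 1 / (u : ℝ) = 1 - δ := by rw [hδ]; ring
  rw [h5]
  have h6 : 0 ≤ (U.length : ℝ) + 2 * δ - 1 := by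
    have : (0 : ℝ) ≤ b * (U.length + 2 * δ - 1) := hk' ▸ Nat.cast_nonneg k
    exact nonneg_of_mul_nonneg_right this hb0
  have h7 : κ * 2 ^ #(P.take t).toFinset * (U.length + 2 * δ - 1) ≤
      κ * 2 ^ t * (U.length + 2 * δ - 1) := by gcongr
  linarith

/-- The sieve criterion for a product, tested for all cores consisting of the smallest primes. -/
def sieveCheck (κ N D : ℕ) (m₁ m₂ : ℕ) : Bool :=
  match trialDivision 10000 2 m₁, trialDivision 10000 2 m₂ with
  | some P₁, some P₂ =>
    let P := (P₁ ++ P₂).dedup.insertionSort (· ≤ ·)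
    (List.range (P.length + 1)).any (sieveCheckAt κ N D P)
  | _, _ => false

lemma sieveCriterion_of_sieveCheck {m κ N D m₁ m₂ : ℕ} {Z : ℝ} (hm₁ : m₁ ≠ 0) (hm₂ : m₂ ≠ 0)
    (hm : m ∣ m₁ * m₂) (hZ0 : 0 ≤ Z) (hD : 0 < D) (hZ : Z ^ 2 * D = N)
    (h : sieveCheck κ N D m₁ m₂ = true) : SieveCriterion m κ Z := by
  rw [sieveCheck] at h
  split at h
  · rename_i P₁ P₂ h₁ h₂
    obtain ⟨t, -, ht⟩ := List.any_eq_true.1 h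
    refine sieveCriterion_of_sieveCheckAt ?_ (fun ℓ hℓ => ?_) hZ0 hD hZ ht
    · exact (List.perm_insertionSort _ _).nodup_iff.2 (List.nodup_dedup _)
    · rw [(List.perm_insertionSort _ _).mem_iff, List.mem_dedup, List.mem_append]
      have hp := Nat.prime_of_mem_primeFactors hℓ
      refine (hp.dvd_mul.1 ((Nat.dvd_of_mem_primeFactors hℓ).trans hm)).imp ?_ ?_
      · exact mem_of_trialDivision le_rfl hm₁ h₁ (fun ℓ hℓ _ => hℓ.two_le) ℓ hp
      · exact mem_of_trialDivision le_rfl hm₂ h₂ (fun ℓ hℓ _ => hℓ.two_le) ℓ hp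
  · simp at h

lemma sieveCheck_cubic : ∀ i < 380, i ∉ [0, 1, 3, 5] →
    sieveCheck 2 ((2 * i + 3) ^ 2) 1 (i + 1) ((2 * i + 3) ^ 2 + (2 * i + 3) + 1) = true := by
  decide +kernel

lemma sieveCheck_quartic : ∀ i < 41, i ∉ [0, 1] →
    sieveCheck 2 ((2 * i + 3) ^ 3) 1 ((i + 1) * (2 * i + 4)) ((2 * i + 3) ^ 2 + 1) = true := by
  decide +kernel

lemma sieveCheck_of_lt : ∀ n < 14, 5 ≤ n → ∀ i < 13, (2 * i + 3) ^ (n - 1) < 763 ^ 2 →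
    sieveCheck 2 ((2 * i + 3) ^ (n - 1)) 1 1 (((2 * i + 3) ^ n - 1) / 2) = true := by
  decide +kernel

lemma sieveCheck_trace_zero_cubic : ∀ i < 384,
    sieveCheck 1 ((2 * i + 4) ^ 2) (2 * i + 3) 1 ((2 * i + 3) ^ 2 + (2 * i + 3) + 1) = true := by
  decide +kernel

lemma sieveCheck_trace_zero_quartic : ∀ i < 380, i ∉ [0, 1, 3, 4, 5, 7, 10] →
    sieveCheck 2 (((2 * i + 3) ^ 2 + (2 * i + 3) + 1) ^ 2) ((2 * i + 3) ^ 2) (i + 2)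
      ((2 * i + 3) ^ 2 + 1) = true := by
  decide +kernel

lemma sieveCheck_trace_zero_even : ∀ n < 15, 6 ≤ n → n % 2 = 0 → ∀ i < 13,
    (2 * i + 3) ^ (n - 2) < 763 ^ 2 →
    sieveCheck 2 ((((2 * i + 3) ^ (n - 1) - 1) / (2 * i + 2)) ^ 2) ((2 * i + 3) ^ (n - 2)) 1
      (((2 * i + 3) ^ n - 1) / (2 * i + 2) / 2) = true := by
  decide +kernel

lemma sieveCheck_trace_zero_odd : ∀ n < 13, 5 ≤ n → n % 2 = 1 → ∀ i < 25,
    (2 * i + 3) ^ (n - 2) < 381 ^ 2 →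
    sieveCheck 1 ((((2 * i + 3) ^ (n - 1) - 1) / (2 * i + 2)) ^ 2) ((2 * i + 3) ^ (n - 2)) 1
      (((2 * i + 3) ^ n - 1) / (2 * i + 2)) = true := by
  decide +kernel

lemma le_sqrt_natCast_pow {a q k : ℕ} (h : a ^ 2 ≤ q ^ k) : (a : ℝ) ≤ √((q : ℝ) ^ k) :=
  Real.le_sqrt_of_sq_le (by exact_mod_cast h)

lemma exponent_lt_of_pow_lt {q k c a : ℕ} (hq : 3 ≤ q) (h : q ^ k < a) (ha : a ≤ 3 ^ c) :
    k < c := by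
  have h1 : 3 ^ k ≤ q ^ k := Nat.pow_le_pow_left hq k
  exact (Nat.pow_lt_pow_iff_right (by norm_num : 1 < 3)).1 (by omega)

lemma base_lt_of_pow_lt {q k j a c : ℕ} (hq : 1 ≤ q) (hjk : j ≤ k) (h : q ^ k < a)
    (ha : a ≤ c ^ j) : q < c := by
  by_contra! hc
  have h1 : c ^ j ≤ q ^ j := Nat.pow_le_pow_left hc j
  have h2 : q ^ j ≤ q ^ k := Nat.pow_le_pow_right hq hjk
  omega

lemma sieveCriterion_of_odd {q n M : ℕ} (hq : Odd q) (hq3 : 3 ≤ q) (hn : 3 ≤ n)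
    (hM : q ^ n - 1 = 2 * M) (h3 : n = 3 → q ∉ [3, 5, 9, 13]) (h4 : n = 4 → q ∉ [3, 5]) :
    SieveCriterion M 2 (√((q : ℝ) ^ (n - 1))) := by
  have hqn : 3 ≤ q ^ n := hq3.trans (Nat.le_self_pow (by omega) q)
  have hM0 : M ≠ 0 := by omega
  have hq0 : (1 : ℝ) ≤ q := by exact_mod_cast (by omega : 1 ≤ q)
  rcases le_or_gt (763 ^ 2) (q ^ (n - 1)) with h | h
  · refine sieveCriterion_two_of_large hM0 ?_ (by exact_mod_cast le_sqrt_natCast_pow h)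
    have h1 : (2 * M : ℝ) ≤ (q : ℝ) ^ n := by exact_mod_cast (by omega : 2 * M ≤ q ^ n)
    have h2 : (q : ℝ) ^ n ≤ (√((q : ℝ) ^ (n - 1))) ^ 3 := by
      refine le_of_sq_le_sq ?_ (by positivity)
      rw [pow_right_comm (√_), Real.sq_sqrt (by positivity), ← pow_mul, ← pow_mul]
      exact pow_le_pow_right₀ hq0 (by omega)
    linarith
  · have hsq : (√((q : ℝ) ^ (n - 1))) ^ 2 * (1 : ℕ) = (q ^ (n - 1) : ℕ) := by
      rw [Real.sq_sqrt (by positivity)]; simp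
    have hn14 := exponent_lt_of_pow_lt (c := 13) hq3 h (by norm_num)
    obtain ⟨i, rfl⟩ : ∃ i, q = 2 * i + 3 := by
      obtain ⟨j, hj⟩ := hq
      exact ⟨j - 1, by omega⟩
    obtain hn | hn | hn : n = 3 ∨ n = 4 ∨ 5 ≤ n := by omega
    · have hq' := base_lt_of_pow_lt (j := 2) (c := 763) (by omega) (by omega) h le_rfl
      have hi' : i ∉ [0, 1, 3, 5] := by
        have := h3 hn
        simp only [List.mem_cons, List.not_mem_nil, or_false, not_or] at this ⊢
        omega
      have := sieveCheck_cubic i (by omega) hi'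
      subst hn
      refine sieveCriterion_of_sieveCheck (by omega) (by omega) ?_ (by positivity) one_pos hsq
        (this)
      refine dvd_of_eq ?_
      have : (2 * i + 3) ^ 3 = 2 * ((i + 1) * ((2 * i + 3) ^ 2 + (2 * i + 3) + 1)) + 1 := by ring
      omega
    · have hq' := base_lt_of_pow_lt (j := 3) (c := 84) (by omega) (by omega) h (by norm_num)
      have hi' : i ∉ [0, 1] := by
        have := h4 hn
        simp only [List.mem_cons, List.not_mem_nil, or_false, not_or] at this ⊢
        omega
      have := sieveCheck_quartic i (by omega) hi'
      subst hn
      refine sieveCriterion_of_sieveCheck (by positivity) (by omega) ?_ (by positivity) one_pos hsq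
        (this)
      refine dvd_of_eq ?_
      have : (2 * i + 3) ^ 4 = 2 * ((i + 1) * (2 * i + 4) * ((2 * i + 3) ^ 2 + 1)) + 1 := by ring
      omega
    · have hq' := base_lt_of_pow_lt (j := 4) (c := 28) (by omega) (by omega) h (by norm_num)
      have := sieveCheck_of_lt n (by omega) hn i (by omega) (h)
      rw [hM, Nat.mul_div_cancel_left _ two_pos] at this
      exact sieveCriterion_of_sieveCheck one_ne_zero hM0 (by simp) (by positivity) one_pos hsq this

section TraceZero

variable {q n S : ℕ}

lemma sqrt_mul_add_le_of_geom (hq : 3 ≤ q) (hn : 4 ≤ n) (hS : (q - 1) * S = q ^ (n - 1) - 1) :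
    √((q : ℝ) ^ (n - 2)) ≤ S / √((q : ℝ) ^ (n - 2)) ∧
      (q : ℝ) * S + 1 ≤ (S / √((q : ℝ) ^ (n - 2))) ^ 3 := by
  set w := √((q : ℝ) ^ (n - 2)) with hw
  have hq1 : (3 : ℝ) ≤ q := by exact_mod_cast hq
  have hw2 : w ^ 2 = (q : ℝ) ^ (n - 2) := Real.sq_sqrt (by positivity)
  have hwq : (q : ℝ) ≤ w := le_sqrt_natCast_pow (Nat.pow_le_pow_right (by omega) (by omega))
  have hw0 : 0 < w := by linarith
  have hSw : w ^ 2 + 1 ≤ S := by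
    have h1 : (q ^ (n - 2) + 1 : ℕ) ≤ S := by
      refine Nat.le_of_mul_le_mul_left ?_ (by omega : 0 < q - 1)
      rw [hS]
      obtain ⟨a, rfl⟩ : ∃ a, q = a + 1 := ⟨q - 1, by omega⟩
      obtain ⟨k, rfl⟩ : ∃ k, n = k + 3 := ⟨n - 3, by omega⟩
      simp only [Nat.add_sub_cancel, show k + 3 - 2 = k + 1 by omega,
        show k + 3 - 1 = k + 2 by omega]
      have h2 : a + 1 ≤ (a + 1) ^ (k + 1) := Nat.le_self_pow (by omega) _
      have h3 : (a + 1) ^ (k + 2) = a * (a + 1) ^ (k + 1) + (a + 1) ^ (k + 1) := by ring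
      rw [Nat.mul_add]
      omega
    rw [hw2]
    exact_mod_cast h1
  have h1 : w ≤ S / w := by
    rw [le_div_iff₀ hw0]; nlinarith
  refine ⟨h1, ?_⟩
  have hS0 : (0 : ℝ) < S := by nlinarith
  rw [div_pow, le_div_iff₀ (by positivity)]
  have h2 : (w ^ 2 + 1) ^ 2 ≤ (S : ℝ) ^ 2 := by gcongr
  have h3 : w ≤ S := by nlinarith
  calc ((q : ℝ) * S + 1) * w ^ 3 ≤ (w * S + 1) * w ^ 3 := by gcongr
    _ = S * w ^ 4 + w * w ^ 2 := by ring
    _ ≤ S * w ^ 4 + S * w ^ 2 := by gcongr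
    _ ≤ S * (w ^ 2 + 1) ^ 2 := by
        have : 0 ≤ S * w ^ 2 := by positivity
        linarith
    _ ≤ S * S ^ 2 := by gcongr
    _ = _ := by ring

lemma geom_succ {R : ℕ} (hq : 3 ≤ q) (hn : 1 ≤ n) (hS : (q - 1) * S = q ^ (n - 1) - 1)
    (hR : (q - 1) * R = q ^ n - 1) : R = q * S + 1 := by
  refine Nat.eq_of_mul_eq_mul_left (by omega : 0 < q - 1) ?_
  rw [hR, mul_add, mul_left_comm, hS, Nat.mul_sub, ← pow_succ', Nat.sub_add_cancel hn]
  have : q ≤ q ^ n := Nat.le_self_pow (by omega) q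
  omega

lemma sq_div_sqrt_mul (hq : 3 ≤ q) :
    (S / √((q : ℝ) ^ (n - 2))) ^ 2 * (q ^ (n - 2) : ℕ) = (S ^ 2 : ℕ) := by
  have : (0 : ℝ) < (q : ℝ) ^ (n - 2) := by positivity
  rw [div_pow, Real.sq_sqrt this.le]
  push_cast
  field_simp

lemma sieveCriterion_trace_zero_of_even {r : ℕ} (hq : Odd q) (hq3 : 3 ≤ q) (hn : 4 ≤ n)
    (heven : n % 2 = 0) (hS : (q - 1) * S = q ^ (n - 1) - 1)
    (hr : (q - 1) * (2 * r) = q ^ n - 1) (h4 : n = 4 → q ∉ [3, 5, 9, 11, 13, 17, 23]) :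
    SieveCriterion r 2 (S / √((q : ℝ) ^ (n - 2))) := by
  have hR := geom_succ hq3 (by omega) hS hr
  have hr0 : r ≠ 0 := by omega
  obtain ⟨hw, hw3⟩ := sqrt_mul_add_le_of_geom hq3 hn hS
  rcases le_or_gt (763 ^ 2) (q ^ (n - 2)) with h | h
  · refine sieveCriterion_two_of_large hr0 ?_
      (le_trans (by exact_mod_cast le_sqrt_natCast_pow h) hw)
    have h1 : (2 * r : ℝ) = q * S + 1 := by exact_mod_cast hR
    linarith
  · have hsq := sq_div_sqrt_mul (S := S) (n := n) hq3
    have hn14 := exponent_lt_of_pow_lt (c := 13) hq3 h (by norm_num)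
    obtain ⟨i, rfl⟩ : ∃ i, q = 2 * i + 3 := by
      obtain ⟨j, hj⟩ := hq
      exact ⟨j - 1, by omega⟩
    have hpos : 0 < (2 * i + 3) ^ (n - 2) := by positivity
    obtain hn | hn : n = 4 ∨ 6 ≤ n := by omega
    · have hq' := base_lt_of_pow_lt (j := 2) (c := 763) (by omega) (by omega) h le_rfl
      have hi' : i ∉ [0, 1, 3, 4, 5, 7, 10] := by
        have := h4 hn
        simp only [List.mem_cons, List.not_mem_nil, or_false, not_or] at this ⊢
        omega
      have := sieveCheck_trace_zero_quartic i (by omega) hi'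
      subst hn
      have hS' : S = (2 * i + 3) ^ 2 + (2 * i + 3) + 1 := by
        refine Nat.eq_of_mul_eq_mul_left (by omega : 0 < 2 * i + 3 - 1) ?_
        rw [hS]
        have h1 : (2 * i + 3) ^ (4 - 1) =
          (2 * i + 2) * ((2 * i + 3) ^ 2 + (2 * i + 3) + 1) + 1 := by ring
        rw [h1]
        simp
      rw [← hS'] at this
      refine sieveCriterion_of_sieveCheck (by omega) (by omega) ?_ (by positivity) hpos hsq this
      refine dvd_of_eq (Nat.eq_of_mul_eq_mul_left two_pos ?_)
      rw [hR, hS']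
      ring
    · have hq' := base_lt_of_pow_lt (j := 4) (c := 28) (by omega) (by omega) h (by norm_num)
      have := sieveCheck_trace_zero_even n (by omega) hn heven i (by omega) h
      rw [← hr, ← hS, show 2 * i + 3 - 1 = 2 * i + 2 by omega,
        Nat.mul_div_cancel_left _ (by omega), Nat.mul_div_cancel_left _ (by omega),
        Nat.mul_div_cancel_left _ two_pos] at this
      exact sieveCriterion_of_sieveCheck one_ne_zero hr0 (by simp) (by positivity) hpos hsq this

lemma sieveCriterion_trace_zero_of_odd {r : ℕ} (hq : Odd q) (hq3 : 3 ≤ q) (hn : 3 ≤ n)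
    (hodd : n % 2 = 1) (hS : (q - 1) * S = q ^ (n - 1) - 1) (hr : (q - 1) * r = q ^ n - 1) :
    SieveCriterion r 1 (S / √((q : ℝ) ^ (n - 2))) := by
  have hR := geom_succ hq3 (by omega) hS hr
  have hr0 : r ≠ 0 := by omega
  have hsq := sq_div_sqrt_mul (S := S) (n := n) hq3
  obtain ⟨i, hi⟩ : ∃ i, q = 2 * i + 3 := by
    obtain ⟨j, hj⟩ := hq
    exact ⟨j - 1, by omega⟩
  have hpos : 0 < q ^ (n - 2) := by positivity
  obtain hn | hn : n = 3 ∨ 5 ≤ n := by omega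
  · subst hn
    have hS' : S = q + 1 := by
      refine Nat.eq_of_mul_eq_mul_left (by omega : 0 < q - 1) ?_
      rw [hS, hi, show 2 * i + 3 - 1 = 2 * i + 2 by omega]
      have h1 : (2 * i + 3) ^ (3 - 1) = (2 * i + 2) * (2 * i + 3 + 1) + 1 := by ring
      rw [h1]
      simp
    have hr' : r = q ^ 2 + q + 1 := by rw [hR, hS']; ring
    rcases le_or_gt 770 q with h | h
    · rw [hr']
      refine sieveCriterion_cubic h (by positivity) ?_
      rw [mul_comm]
      have : (S : ℝ) = q + 1 := by exact_mod_cast hS'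
      rw [this] at hsq ⊢
      simpa [hS'] using hsq
    · have := sieveCheck_trace_zero_cubic i (by omega)
      rw [show 2 * i + 4 = S by omega, ← hi] at this
      rw [← hr'] at this
      exact sieveCriterion_of_sieveCheck one_ne_zero hr0 (by simp) (by positivity) hpos hsq
        (by simpa using this)
  · obtain ⟨hw, hw3⟩ := sqrt_mul_add_le_of_geom hq3 (by omega) hS
    rcases le_or_gt (381 ^ 2) (q ^ (n - 2)) with h | h
    · have h2 : (381 : ℝ) ≤ S / √((q : ℝ) ^ (n - 2)) :=
        le_trans (by exact_mod_cast le_sqrt_natCast_pow h) hw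
      refine SieveCriterion.one_of_two (sieveCriterion_two_of_large hr0 ?_ (by linarith))
      have h1 : (r : ℝ) = q * S + 1 := by exact_mod_cast hR
      set Z := (S : ℝ) / √((q : ℝ) ^ (n - 2))
      have h3 : (2 * Z) ^ 3 ≤ (2 * Z + 1) ^ 3 := by gcongr; linarith
      have h4 : 0 ≤ Z ^ 3 := by positivity
      nlinarith
    · have hn14 := exponent_lt_of_pow_lt (c := 11) hq3 h (by norm_num)
      have hq' := base_lt_of_pow_lt (j := 3) (c := 53) (by omega) (by omega) h (by norm_num)
      have := sieveCheck_trace_zero_odd n (by omega) hn hodd i (by omega) (hi ▸ h)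
      rw [← hi, ← hr, ← hS, show 2 * i + 2 = q - 1 by omega,
        Nat.mul_div_cancel_left _ (by omega), Nat.mul_div_cancel_left _ (by omega)] at this
      exact sieveCriterion_of_sieveCheck one_ne_zero hr0 (by simp) (by positivity) hpos hsq this

end TraceZero

/-- The value at `x` of the polynomial with coefficient list `l`, lowest degree first. -/
def evalList {A : Type*} [CommRing A] (x : A) : List ℕ → A
  | [] => 0
  | a :: l => a + x * evalList x l

/-- Coefficientwise sum modulo `p`. -/
def addList (p : ℕ) : List ℕ → List ℕ → List ℕ
  | [], l => l
  | a :: l, [] => a :: l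
  | a :: l, b :: m => (a + b) % p :: addList p l m

/-- Multiplication by the scalar `t` modulo `p`. -/
def scaleList (p t : ℕ) (l : List ℕ) : List ℕ := l.map fun a => a * t % p

/-- Multiplication by `X` modulo `p` and modulo the relation `X ^ c.length = c`. -/
def mulXList (p : ℕ) (c l : List ℕ) : List ℕ :=
  if l.length = c.length then addList p (0 :: l.dropLast) (scaleList p (l.getLastD 0) c)
  else 0 :: l

/-- Multiplication modulo `p` and modulo the relation `X ^ c.length = c`. -/
def mulList (p : ℕ) (c : List ℕ) : List ℕ → List ℕ → List ℕ
  | [], _ => []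
  | a :: l, m => addList p (scaleList p a m) (mulXList p c (mulList p c l m))

/-- Binary powering modulo `p` and modulo the relation `X ^ c.length = c`. -/
def powList (p : ℕ) (c : List ℕ) : ℕ → List ℕ → ℕ → List ℕ
  | 0, _, _ => [1]
  | fuel + 1, b, k =>
    if k = 0 then [1]
    else if k % 2 = 1 then mulList p c b (powList p c fuel (mulList p c b b) (k / 2))
    else powList p c fuel (mulList p c b b) (k / 2)

/-- Whether a coefficient list represents the constant `a` modulo `p`. -/
def isConstList (p a : ℕ) : List ℕ → Bool
  | [] => a % p == 0
  | b :: l => b % p == a % p && l.all fun d => d % p == 0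

section evalList

variable {A : Type*} [CommRing A] {x : A} {p : ℕ} {c : List ℕ}

lemma natCast_mod_of_natCast_eq_zero (hp : (p : A) = 0) (a : ℕ) : ((a % p : ℕ) : A) = a := by
  conv_rhs => rw [← Nat.mod_add_div a p]
  simp [hp]

lemma evalList_append (l m : List ℕ) :
    evalList x (l ++ m) = evalList x l + x ^ l.length * evalList x m := by
  induction l with
  | nil => simp [evalList]
  | cons a l ih => simp only [List.cons_append, evalList, ih, List.length_cons, pow_succ]; ring

lemma map_evalList {B : Type*} [CommRing B] (φ : A →+* B) (l : List ℕ) :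
    φ (evalList x l) = evalList (φ x) l := by
  induction l with
  | nil => simp [evalList]
  | cons a l ih => simp [evalList, ih]

lemma evalList_addList (hp : (p : A) = 0) (l m : List ℕ) :
    evalList x (addList p l m) = evalList x l + evalList x m := by
  induction l generalizing m with
  | nil => simp [addList, evalList]
  | cons a l ih =>
    cases m with
    | nil => simp [addList, evalList]
    | cons b m =>
      simp only [addList, evalList, ih, natCast_mod_of_natCast_eq_zero hp, Nat.cast_add]
      ring

lemma evalList_scaleList (hp : (p : A) = 0) (t : ℕ) (l : List ℕ) :
    evalList x (scaleList p t l) = t * evalList x l := by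
  induction l with
  | nil => simp [scaleList, evalList]
  | cons a l ih =>
    rw [scaleList] at ih ⊢
    simp only [List.map_cons, evalList, ih, natCast_mod_of_natCast_eq_zero hp, Nat.cast_mul]
    ring

lemma evalList_mulXList (hp : (p : A) = 0) (hx : x ^ c.length = evalList x c) (l : List ℕ) :
    evalList x (mulXList p c l) = x * evalList x l := by
  rw [mulXList]
  split_ifs with h
  · rw [evalList_addList hp, evalList_scaleList hp, ← hx, ← h]
    rcases List.eq_nil_or_concat l with rfl | ⟨l, a, rfl⟩
    · simp [evalList]
    · simp [evalList, evalList_append]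
      ring
  · simp [evalList]

lemma evalList_mulList (hp : (p : A) = 0) (hx : x ^ c.length = evalList x c) (l m : List ℕ) :
    evalList x (mulList p c l m) = evalList x l * evalList x m := by
  induction l with
  | nil => simp [mulList, evalList]
  | cons a l ih =>
    rw [mulList, evalList_addList hp, evalList_scaleList hp, evalList_mulXList hp hx, ih, evalList]
    ring

lemma evalList_powList (hp : (p : A) = 0) (hx : x ^ c.length = evalList x c) {fuel k : ℕ}
    (hk : k < 2 ^ fuel) (b : List ℕ) :
    evalList x (powList p c fuel b k) = evalList x b ^ k := by
  induction fuel generalizing b k with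
  | zero =>
    obtain rfl : k = 0 := by simpa using hk
    simp [powList, evalList]
  | succ fuel ih =>
    have h2 : k / 2 < 2 ^ fuel := by rw [pow_succ] at hk; omega
    rw [powList]
    split_ifs with h0 h1
    · simp [evalList, h0]
    · rw [evalList_mulList hp hx, ih h2, evalList_mulList hp hx, ← sq, ← pow_mul, ← pow_succ']
      congr 1
      omega
    · rw [ih h2, evalList_mulList hp hx, ← sq, ← pow_mul]
      congr 1
      omega

lemma evalList_eq_zero (hp : (p : A) = 0) {l : List ℕ} (h : l.all fun d => d % p == 0) :
    evalList x l = 0 := by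
  induction l with
  | nil => rfl
  | cons a l ih =>
    simp only [List.all_cons, Bool.and_eq_true, beq_iff_eq] at h
    rw [evalList, ih h.2, ← natCast_mod_of_natCast_eq_zero hp a, h.1]
    simp

lemma evalList_eq_of_isConstList (hp : (p : A) = 0) {a : ℕ} {l : List ℕ}
    (h : isConstList p a l) : evalList x l = a := by
  cases l with
  | nil =>
    simp only [isConstList, beq_iff_eq] at h
    rw [evalList, ← natCast_mod_of_natCast_eq_zero hp a, h, Nat.cast_zero]
  | cons b l =>
    simp only [isConstList, Bool.and_eq_true, beq_iff_eq] at h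
    rw [evalList, evalList_eq_zero hp h.2, ← natCast_mod_of_natCast_eq_zero hp b, h.1,
      natCast_mod_of_natCast_eq_zero hp]
    simp

lemma evalList_zero_one : evalList x [0, 1] = x := by simp [evalList]

end evalList

/-- Verifies that `x` has order exactly `N` whenever `x ^ c.length = c` in characteristic `p`,
by checking that `x ^ N = 1` and that `x ^ (N / ℓ) - 1` is invertible for `ℓ ∣ N` prime. -/
def orderCheck (p N : ℕ) (c : List ℕ) : Bool :=
  N < 2 ^ 20 && isConstList p 1 (powList p c 20 [0, 1] N) &&
    ((trialDivision 1000 2 N).any fun P => P.all fun ℓ =>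
      isConstList p 1 (powList p c 20 (addList p (powList p c 20 [0, 1] (N / ℓ)) [p - 1]) N))

/-- Verifies that `∑ i < n, x ^ (k * q ^ i) = a` whenever `x ^ c.length = c` in
characteristic `p`, and that `k > 0` has greatest common divisor `2` with `q ^ n - 1`. -/
def traceCheck (p q n : ℕ) (c : List ℕ) (a k : ℕ) : Bool :=
  0 < k && k.gcd (q ^ n - 1) == 2 && k * q ^ n < 2 ^ 30 &&
    isConstList p a ((List.range n).foldr
      (fun i l => addList p (powList p c 30 [0, 1] (k * q ^ i)) l) [])

section certificates

variable {p q n N : ℕ} {c : List ℕ}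

lemma pow_eq_one_of_orderCheck {A : Type*} [CommRing A] {x : A} (hp : (p : A) = 0)
    (hx : x ^ c.length = evalList x c) (h : orderCheck p N c) : x ^ N = 1 := by
  simp only [orderCheck, Bool.and_eq_true, decide_eq_true_eq] at h
  have := evalList_eq_of_isConstList (x := x) hp h.1.2
  rwa [evalList_powList hp hx h.1.1, evalList_zero_one, Nat.cast_one] at this

lemma orderOf_eq_of_orderCheck {F : Type*} [Field F] {x : F} (hp : (p : F) = 0) (hp0 : 1 ≤ p)
    (hN : 0 < N) (hx : x ^ c.length = evalList x c) (h : orderCheck p N c) : orderOf x = N := by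
  refine orderOf_eq_of_pow_and_pow_div_prime hN (pow_eq_one_of_orderCheck hp hx h)
    fun ℓ hℓ hdvd heq => ?_
  simp only [orderCheck, Bool.and_eq_true, decide_eq_true_eq, Option.any_eq_true,
    List.all_eq_true] at h
  obtain ⟨⟨hlt, -⟩, P, hP, hall⟩ := h
  have hmem := mem_of_trialDivision le_rfl hN.ne' hP (fun ℓ hℓ _ => hℓ.two_le) ℓ hℓ hdvd
  have h1 := evalList_eq_of_isConstList (x := x) hp (hall ℓ hmem)
  rw [evalList_powList hp hx hlt, evalList_addList hp,
    evalList_powList hp hx ((Nat.div_le_self _ _).trans_lt hlt), evalList_zero_one, heq] at h1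
  simp [evalList, Nat.cast_sub hp0, hp, hN.ne'] at h1

open Polynomial in
lemma degree_evalList_lt {R : Type*} [CommRing R] (c : List ℕ) :
    (evalList (X : R[X]) c).degree < c.length := by
  induction c with
  | nil => simp [evalList]
  | cons a c ih =>
    rw [evalList]
    refine (degree_add_le _ _).trans_lt (max_lt ?_ ?_)
    · refine (degree_natCast_le a).trans_lt ?_
      exact_mod_cast Nat.succ_pos _
    · nontriviality R
      rw [mul_comm, degree_mul_X, List.length_cons, Nat.cast_succ]
      exact WithBot.add_lt_add_right (by simp) ih

open Polynomial in
lemma splits_X_pow_card_sub_X (F : Type*) [Field F] [Fintype F] :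
    (X ^ Fintype.card F - X : F[X]).Splits := by
  rw [splits_iff_card_roots, FiniteField.roots_X_pow_card_sub_X,
    FiniteField.X_pow_card_sub_X_natDegree_eq F Fintype.one_lt_card]
  rfl

open Polynomial in
lemma exists_pow_length_eq_evalList {F : Type*} [Field F] [Fintype F] [Fact p.Prime] [CharP F p]
    (hc : c ≠ []) (h : orderCheck p (Fintype.card F - 1) c) :
    ∃ x : F, x ^ c.length = evalList x c := by
  set f : F[X] := X ^ c.length - evalList X c with hf
  have hmonic : f.Monic := by
    rw [hf, sub_eq_add_neg]
    exact monic_X_pow_add (by rw [degree_neg]; exact degree_evalList_lt c)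
  have hdeg : f.degree = c.length := by
    rw [hf, degree_sub_eq_left_of_degree_lt, degree_X_pow]
    rw [degree_X_pow]
    exact degree_evalList_lt c
  have hroot : AdjoinRoot.root f ^ c.length = evalList (AdjoinRoot.root f) c := by
    have := AdjoinRoot.mk_self (f := f)
    rw [← AdjoinRoot.mk_X, ← map_evalList, ← map_pow, ← sub_eq_zero, ← map_sub]
    exact this
  have hp : (p : AdjoinRoot f) = 0 := by
    rw [← map_natCast (AdjoinRoot.of f), CharP.cast_eq_zero, map_zero]
  have hone := pow_eq_one_of_orderCheck hp hroot h
  have hdvd : f ∣ X ^ Fintype.card F - X := by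
    rw [← AdjoinRoot.mk_eq_zero, map_sub, map_pow, AdjoinRoot.mk_X,
      ← Nat.sub_add_cancel (Fintype.card_pos (α := F)), pow_succ, hone, one_mul, sub_self]
  obtain ⟨x, hx⟩ := ((splits_X_pow_card_sub_X F).of_dvd
    (FiniteField.X_pow_card_sub_X_ne_zero F Fintype.one_lt_card) hdvd).exists_eval_eq_zero
    (by rw [hdeg]; simpa using hc)
  refine ⟨x, ?_⟩
  have h2 : evalRingHom x (evalList X c) = evalList x c := by
    rw [map_evalList]; simp
  rw [hf, eval_sub, eval_pow, eval_X, sub_eq_zero] at hx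
  rw [hx, ← h2]; rfl

lemma evalList_foldr_addList {A : Type*} [CommRing A] {x : A} (hp : (p : A) = 0)
    (g : ℕ → List ℕ) (l : List ℕ) :
    evalList x (l.foldr (fun i m => addList p (g i) m) []) =
      (l.map fun i => evalList x (g i)).sum := by
  induction l with
  | nil => simp [evalList]
  | cons a l ih => simp [evalList_addList hp, ih]

lemma sum_pow_eq_of_traceCheck {A : Type*} [CommRing A] {x : A} (hp : (p : A) = 0) (hq : 0 < q)
    (hx : x ^ c.length = evalList x c) {a k : ℕ} (h : traceCheck p q n c a k) :
    ∑ i ∈ range n, (x ^ k) ^ q ^ i = a := by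
  simp only [traceCheck, Bool.and_eq_true, decide_eq_true_eq] at h
  have h1 := evalList_eq_of_isConstList (x := x) hp h.2
  rw [evalList_foldr_addList hp] at h1
  rw [← h1, ← List.sum_toFinset _ List.nodup_range, List.toFinset_range]
  refine sum_congr rfl fun i hi => ?_
  have hle : k * q ^ i ≤ k * q ^ n :=
    Nat.mul_le_mul_left _ (Nat.pow_le_pow_right hq (mem_range.1 hi).le)
  rw [evalList_powList hp hx (hle.trans_lt h.1.2), evalList_zero_one, pow_mul]

theorem exists_orderOf_eq_of_certificate [Fact p.Prime] {K L : Type*} [Field K] [Field L]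
    [Algebra K L] [Fintype K] [Fintype L] [CharP L p]
    (hK : Fintype.card K = q) (hL : Fintype.card L = q ^ n) (hc : c ≠ [])
    (h : orderCheck p (q ^ n - 1) c) {a k : ℕ} (ht : traceCheck p q n c a k) :
    ∃ β : L, orderOf β = (q ^ n - 1) / 2 ∧ Algebra.trace K L β = a := by
  obtain ⟨x, hx⟩ := exists_pow_length_eq_evalList (F := L) (p := p) hc (by rwa [hL])
  have hp : (p : L) = 0 := CharP.cast_eq_zero L p
  have hN : 0 < q ^ n - 1 := by
    have := Fintype.one_lt_card (α := L)
    omega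
  have hq0 : 0 < q := hK ▸ Fintype.card_pos
  have hord := orderOf_eq_of_orderCheck hp (Fact.out : p.Prime).one_le hN hx h
  obtain ⟨hk, hgcd⟩ : 0 < k ∧ k.gcd (q ^ n - 1) = 2 := by
    simp only [traceCheck, Bool.and_eq_true, beq_iff_eq, decide_eq_true_eq] at ht
    exact ht.1.1
  refine ⟨x ^ k, ?_, ?_⟩
  · rw [orderOf_pow' x hk.ne', hord, Nat.gcd_comm, hgcd]
  · have hfin : Module.finrank K L = n := by
      have := Module.card_eq_pow_finrank (K := K) (V := L)
      rw [hK, hL] at this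
      exact (Nat.pow_right_injective (hK ▸ Fintype.one_lt_card) this).symm
    apply FaithfulSMul.algebraMap_injective K L
    rw [FiniteField.algebraMap_trace_eq_sum_pow, hfin, Nat.card_eq_fintype_card, hK,
      sum_pow_eq_of_traceCheck hp hq0 hx ht, map_natCast]

end certificates

/-- Verifies that the entries of `ks` are exponents realizing the traces `0, 1, …, p - 1`. -/
def traceTableCheck (p n : ℕ) (c ks : List ℕ) : Bool :=
  orderCheck p (p ^ n - 1) c &&
    (List.range p).all fun a => traceCheck p p n c a (ks.getD a 0)

theorem exists_orderOf_eq_of_traceTable {p n : ℕ} (hp : p.Prime) {K L : Type*} [Field K] [Field L]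
    [Algebra K L] [Fintype K] [Fintype L] (hK : Fintype.card K = p)
    (hL : Fintype.card L = p ^ n) {c ks : List ℕ} (hc : c ≠ []) (h : traceTableCheck p n c ks)
    (α : K) : ∃ β : L, orderOf β = (p ^ n - 1) / 2 ∧ Algebra.trace K L β = α := by
  have : Fact p.Prime := ⟨hp⟩
  have : CharP L p := charP_of_card_eq_prime_pow hL
  simp only [traceTableCheck, Bool.and_eq_true, List.all_eq_true, List.mem_range] at h
  let e := ZMod.ringEquivOfPrime K hp hK
  have hα : (((e.symm α).val : ℕ) : K) = α := by
    rw [← map_natCast e, ZMod.natCast_zmod_val, RingEquiv.apply_symm_apply]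
  rw [← hα]
  exact exists_orderOf_eq_of_certificate hK hL hc h.1 (h.2 _ (ZMod.val_lt _))

theorem exists_orderOf_eq_of_exceptional {q n : ℕ} {K L : Type*} [Field K] [Field L]
    [Algebra K L] [Fintype K] [Fintype L] (hK : Fintype.card K = q)
    (hL : Fintype.card L = q ^ n) (h : n = 3 ∧ q ∈ [5, 13] ∨ n = 4 ∧ q ∈ [3, 5])
    (α : K) : ∃ β : L, orderOf β = (q ^ n - 1) / 2 ∧ Algebra.trace K L β = α := by
  simp only [List.mem_cons, List.not_mem_nil, or_false] at h
  rcases h with ⟨rfl, rfl | rfl⟩ | ⟨rfl, rfl | rfl⟩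
  · exact exists_orderOf_eq_of_traceTable (by norm_num) hK hL (c := [2, 1, 0])
      (ks := [42, 14, 2, 38, 6]) (by simp) (by decide +kernel) α
  · exact exists_orderOf_eq_of_traceTable (by norm_num) hK hL (c := [6, 2, 0])
      (ks := [262, 10, 22, 46, 2, 58, 202, 158, 98, 106, 74, 14, 62]) (by simp)
      (by decide +kernel) α
  · exact exists_orderOf_eq_of_traceTable (by norm_num) hK hL (c := [1, 1, 0, 0])
      (ks := [2, 26, 22]) (by simp) (by decide +kernel) α
  · exact exists_orderOf_eq_of_traceTable (by norm_num) hK hL (c := [2, 1, 1, 0])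
      (ks := [14, 74, 2, 46, 22]) (by simp) (by decide +kernel) α

theorem exists_orderOf_eq_trace_zero_of_check {p t q n : ℕ} (hp : p.Prime) (hq : q = p ^ t)
    {K L : Type*} [Field K] [Field L] [Algebra K L] [Fintype K] [Fintype L]
    (hK : Fintype.card K = q) (hL : Fintype.card L = q ^ n) {c : List ℕ} {k : ℕ} (hc : c ≠ [])
    (h : orderCheck p (q ^ n - 1) c) (hk : traceCheck p q n c 0 k) :
    ∃ β : L, orderOf β = (q ^ n - 1) / 2 ∧ Algebra.trace K L β = 0 := by
  have : Fact p.Prime := ⟨hp⟩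
  have : CharP L p := charP_of_card_eq_prime_pow (p := p) (f := t * n) (by rw [hL, hq, pow_mul])
  simpa using exists_orderOf_eq_of_certificate hK hL hc h hk

theorem exists_orderOf_eq_trace_zero_of_exceptional {q : ℕ} {K L : Type*} [Field K] [Field L]
    [Algebra K L] [Fintype K] [Fintype L] (hK : Fintype.card K = q)
    (hL : Fintype.card L = q ^ 4) (h : q ∈ [3, 5, 9, 11, 13, 17, 23]) :
    ∃ β : L, orderOf β = (q ^ 4 - 1) / 2 ∧ Algebra.trace K L β = 0 := by
  simp only [List.mem_cons, List.not_mem_nil, or_false] at h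
  rcases h with rfl | rfl | rfl | rfl | rfl | rfl | rfl
  · exact exists_orderOf_eq_of_exceptional hK hL (by simp) 0
  · exact exists_orderOf_eq_of_exceptional hK hL (by simp) 0
  · exact exists_orderOf_eq_trace_zero_of_check (p := 3) (t := 2) (by norm_num) (by norm_num)
      hK hL (c := [1, 0, 0, 1, 0, 0, 0, 0]) (k := 22) (by simp) (by decide +kernel)
      (by decide +kernel)
  · exact exists_orderOf_eq_trace_zero_of_check (p := 11) (t := 1) (by norm_num) (by norm_num)
      hK hL (c := [9, 1, 0, 0]) (k := 2) (by simp) (by decide +kernel) (by decide +kernel)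
  · exact exists_orderOf_eq_trace_zero_of_check (p := 13) (t := 1) (by norm_num) (by norm_num)
      hK hL (c := [6, 2, 1, 0]) (k := 46) (by simp) (by decide +kernel) (by decide +kernel)
  · exact exists_orderOf_eq_trace_zero_of_check (p := 17) (t := 1) (by norm_num) (by norm_num)
      hK hL (c := [6, 1, 0, 0]) (k := 2) (by simp) (by decide +kernel) (by decide +kernel)
  · exact exists_orderOf_eq_trace_zero_of_check (p := 23) (t := 1) (by norm_num) (by norm_num)
      hK hL (c := [12, 1, 0, 0]) (k := 2) (by simp) (by decide +kernel) (by decide +kernel)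

lemma trace_zero_main_term {q n S : ℕ} (hq : 1 ≤ q) (hS : (q - 1) * S = q ^ (n - 1) - 1) :
    ((q : ℝ) - 1) * √((q : ℝ) ^ (n - 2)) * (S / √((q : ℝ) ^ (n - 2))) =
      (q : ℝ) ^ (n - 1) - 1 := by
  have hq0 : (0 : ℝ) < q := by exact_mod_cast hq
  have hne : √((q : ℝ) ^ (n - 2)) ≠ 0 := by positivity
  have h : ((q : ℝ) - 1) * S = (q : ℝ) ^ (n - 1) - 1 := by
    have := congrArg (Nat.cast : ℕ → ℝ) hS
    rwa [Nat.cast_mul, Nat.cast_sub hq, Nat.cast_sub (Nat.one_le_pow _ _ hq), Nat.cast_pow,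
      Nat.cast_one] at this
  rw [← h]
  field_simp

theorem exists_orderOf_eq_trace_zero {q n M : ℕ} (hq : Odd q) (hq3 : 3 ≤ q) (hn : 3 ≤ n)
    {K L : Type*} [Field K] [Field L] [Algebra K L] [Fintype K] [Fintype L]
    (hK : Fintype.card K = q) (hL : Fintype.card L = q ^ n) (hM : q ^ n - 1 = 2 * M) :
    ∃ β : L, orderOf β = M ∧ Algebra.trace K L β = 0 := by
  obtain ⟨S, hS⟩ := Nat.sub_one_dvd_pow_sub_one q (n - 1)
  obtain ⟨R, hR⟩ := Nat.sub_one_dvd_pow_sub_one q n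
  have hZ := trace_zero_main_term (by omega) hS.symm
  have hRodd : Odd R ↔ Odd n := by
    have hsum : R = ∑ k ∈ range n, q ^ k := by
      rw [Nat.geomSum_eq (by omega), hR, Nat.mul_div_cancel_left _ (by omega)]
    rw [hsum, odd_sum_iff_odd_card_odd, filter_true_of_mem fun k _ => hq.pow, card_range]
  rcases Nat.even_or_odd n with heven | hodd
  · by_cases hex : n = 4 ∧ q ∈ [3, 5, 9, 11, 13, 17, 23]
    · obtain ⟨rfl, hex⟩ := hex
      obtain ⟨β, hβ⟩ := exists_orderOf_eq_trace_zero_of_exceptional hK hL hex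
      exact ⟨β, by rw [hβ.1, hM, Nat.mul_div_cancel_left _ two_pos], hβ.2⟩
    · have hReven : Even R := by
        rw [← Nat.not_odd_iff_even, hRodd, Nat.not_odd_iff_even]; exact heven
      obtain ⟨r, rfl⟩ := hReven
      have hn4 : 4 ≤ n := by
        obtain ⟨m, rfl⟩ := heven
        omega
      refine exists_orderOf_eq_trace_zero_of_even (by omega) hK hL hM (r := r) (by lia) hZ
        (sieveCriterion_trace_zero_of_even hq hq3 hn4 (Nat.even_iff.1 heven) hS.symm
          (by rw [two_mul]; exact hR.symm) fun h4 hmem => hex ⟨h4, hmem⟩)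
  · exact exists_orderOf_eq_trace_zero_of_odd (by omega) hK hL hM hR.symm (hRodd.2 hodd) hZ
      (sieveCriterion_trace_zero_of_odd hq hq3 hn (Nat.odd_iff.1 hodd) hS.symm hR.symm)

/-- Let `q` be a power of an odd prime `p` and `n ≥ 3` such that either `gcd(p, n) = 1` or
`p ≥ 5`. Then for every `α ∈ F_q` there exists a `2`-primitive `β ∈ F_{q^n}` with
`Tr_{F_{q^n}/F_q}(β) = α`. -/
theorem stmt_10 (p t q n : ℕ) (hp : p.Prime) (hodd : Odd p) (ht : 1 ≤ t) (hq : q = p ^ t)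
    (hn : 3 ≤ n) (hcond : Nat.gcd p n = 1 ∨ 5 ≤ p)
    (K L : Type*) [Field K] [Field L] [Algebra K L] [Fintype K] [Fintype L]
    (hK : Fintype.card K = q) (hL : Fintype.card L = q ^ n) :
    ∀ α : K, ∃ β : L, orderOf β = (q ^ n - 1) / 2 ∧ Algebra.trace K L β = α := by
  intro α
  have hqodd : Odd q := hq ▸ hodd.pow
  have hq3 : 3 ≤ q := by
    have h1 : 1 < q := hK ▸ Fintype.one_lt_card
    obtain ⟨m, rfl⟩ := hqodd
    omega
  have hM : q ^ n - 1 = 2 * ((q ^ n - 1) / 2) := by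
    have : Odd (q ^ n) := hqodd.pow
    obtain ⟨m, hm⟩ := this
    omega
  rcases eq_or_ne α 0 with rfl | hα
  · exact exists_orderOf_eq_trace_zero hqodd hq3 hn hK hL hM
  by_cases hex : n = 3 ∧ q ∈ [5, 13] ∨ n = 4 ∧ q ∈ [3, 5]
  · exact exists_orderOf_eq_of_exceptional hK hL hex α
  · have hnot : n = 3 → ¬ 3 ∣ q := by
      rintro rfl h3
      obtain rfl : 3 = p :=
        (Nat.prime_dvd_prime_iff_eq Nat.prime_three hp).1 (Nat.prime_three.dvd_of_dvd_pow (hq ▸ h3))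
      simp at hcond
    refine exists_orderOf_eq_of_ne_zero (by omega) hK hL hM hα
      (sieveCriterion_of_odd hqodd hq3 hn hM ?_ fun h4 hmem => hex (Or.inr ⟨h4, hmem⟩))
    intro h3 hmem
    have := hnot h3
    simp only [List.mem_cons, List.not_mem_nil, or_false] at hmem hex
    omega
end

section
/- Let q be a power of a prime p and write n = p^k u with gcd(u, p) = 1, and set T(x) = (x^u − 1)/(x − 1) ∈ F_q[x]. An element α ∈ F_{q^n} has F_q-order m_α(x) = (x^n − 1)/(x − 1) if and only if α is T(x)-free and the element β = Tr_{F_{q^n}/F_{q^{p^k}}}(α) ∈ F_{q^{p^k}} has F_q-order m_β(x) = (x^{p^k} − 1)/(x − 1). -/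
open Polynomial

/-- For `g = Σ aᵢ xⁱ ∈ F_q[x]` and `α ∈ F_{q^n}`, the action `g ∘ α = Σ aᵢ α^{qⁱ}`. -/
noncomputable def qAction {K L : Type*} [Field K] [Field L] [Algebra K L]
    (q : ℕ) (g : Polynomial K) (α : L) : L :=
  ∑ i ∈ g.support, g.coeff i • α ^ q ^ i

/-- `m` is the `F_q`-order of `α`: the monic generator of the ideal `{g : g ∘ α = 0}`. -/
def IsFqOrder {K L : Type*} [Field K] [Field L] [Algebra K L]
    (q : ℕ) (α : L) (m : Polynomial K) : Prop :=
  m.Monic ∧ ∀ g : Polynomial K, qAction q g α = 0 ↔ m ∣ g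

/-- `α` is `f`-free: if `α = h ∘ β` for a monic divisor `h` of `f`, then `h = 1`. -/
def IsPolyFree {K L : Type*} [Field K] [Field L] [Algebra K L]
    (q : ℕ) (f : Polynomial K) (α : L) : Prop :=
  ∀ h : Polynomial K, ∀ β : L, h.Monic → h ∣ f → qAction q h β = α → h = 1

/-- The polynomial action of `K[X]` on a finite extension `L` of a finite field `K` is evaluation
at the Frobenius endomorphism. -/
theorem qAction_eq_aeval_frobenius {K L : Type*} [Field K] [Field L] [Algebra K L] [Fintype K]
    (g : K[X]) (α : L) :
    qAction (Fintype.card K) g α =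
      aeval (FiniteField.frobeniusAlgHom K L).toLinearMap g α := by
  rw [qAction, aeval_eq_sum_range, LinearMap.sum_apply,
    Finset.sum_subset supp_subset_range_natDegree_succ
      fun i _ hi => by rw [notMem_support_iff.1 hi, zero_smul]]
  refine Finset.sum_congr rfl fun i _ => ?_
  have h : ((FiniteField.frobeniusAlgHom K L).toLinearMap ^ i) α
      = α ^ Fintype.card K ^ i := by
    rw [Module.End.coe_pow]
    change (fun x : L => x ^ Fintype.card K)^[i] α = _
    rw [pow_iterate]
  rw [LinearMap.smul_apply, h]

theorem qAction_X_pow {K L : Type*} [Field K] [Field L] [Algebra K L] (q i : ℕ) (α : L) :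
    qAction q (X ^ i : K[X]) α = α ^ q ^ i := by
  simp [qAction]

section Action

variable {K L : Type*} [Field K] [Field L] [Algebra K L] [Fintype K]

theorem qAction_mul (f g : K[X]) (α : L) :
    qAction (Fintype.card K) (f * g) α =
      qAction (Fintype.card K) f (qAction (Fintype.card K) g α) := by
  simp only [qAction_eq_aeval_frobenius, map_mul, Module.End.mul_apply]

theorem qAction_eq_zero_of_dvd {f g : K[X]} (h : f ∣ g) {α : L}
    (hf : qAction (Fintype.card K) f α = 0) : qAction (Fintype.card K) g α = 0 := by
  obtain ⟨c, rfl⟩ := h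
  rw [mul_comm, qAction_mul, hf, qAction_eq_aeval_frobenius, map_zero]

/-- The annihilator of an element under the polynomial action is principal. -/
theorem exists_forall_qAction_eq_zero_iff_dvd (α : L) :
    ∃ m : K[X], ∀ g : K[X], qAction (Fintype.card K) g α = 0 ↔ m ∣ g := by
  let I : Ideal K[X] :=
    { carrier := {g | qAction (Fintype.card K) g α = 0}
      add_mem' := fun {a b} ha hb => by
        simp only [Set.mem_ofPred_eq, qAction_eq_aeval_frobenius] at *
        rw [map_add, LinearMap.add_apply, ha, hb, add_zero]
      zero_mem' := by simp [qAction]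
      smul_mem' := fun c g hg => qAction_eq_zero_of_dvd (dvd_mul_left g c) hg }
  obtain ⟨m, hm⟩ := IsPrincipalIdealRing.principal I
  refine ⟨m, fun g => ?_⟩
  rw [← Ideal.mem_span_singleton]
  change g ∈ I ↔ _
  rw [hm, Ideal.submodule_span_eq]

variable [Finite L]

theorem qAction_X_pow_finrank_sub_one (α : L) :
    qAction (Fintype.card K) (X ^ Module.finrank K L - 1 : K[X]) α = 0 := by
  rw [qAction_eq_aeval_frobenius, ← FiniteField.minpoly_frobeniusAlgHom, minpoly.aeval,
    LinearMap.zero_apply]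

variable (K L) in
/-- A normal element generates `L` under the polynomial action. -/
theorem exists_forall_exists_qAction_eq :
    ∃ γ : L, ∀ α : L, ∃ g : K[X], qAction (Fintype.card K) g γ = α := by
  refine ⟨IsGalois.normalBasis K L 1, fun α => ?_⟩
  induction (IsGalois.normalBasis K L).mem_span α using Submodule.span_induction with
  | mem x hx =>
    obtain ⟨σ, rfl⟩ := hx
    obtain ⟨i, rfl⟩ := (FiniteField.bijective_frobeniusAlgEquivOfAlgebraic_pow K L).2 σ
    refine ⟨X ^ i.1, ?_⟩
    rw [IsGalois.normalBasis_apply (FiniteField.frobeniusAlgEquivOfAlgebraic K L ^ i.1),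
      AlgEquiv.coe_pow, FiniteField.coe_frobeniusAlgEquivOfAlgebraic_iterate, qAction_X_pow]
  | zero => exact ⟨0, by simp [qAction]⟩
  | add x y _ _ hx hy =>
    obtain ⟨f, rfl⟩ := hx
    obtain ⟨g, rfl⟩ := hy
    exact ⟨f + g, by simp only [qAction_eq_aeval_frobenius, map_add, LinearMap.add_apply]⟩
  | smul c x _ hx =>
    obtain ⟨f, rfl⟩ := hx
    exact ⟨c • f, by simp only [qAction_eq_aeval_frobenius, map_smul, LinearMap.smul_apply]⟩

/-- If `f * g = X ^ n - 1` with `n = [L : K]`, the kernel of `g` is contained in the image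
of `f`. -/
theorem exists_qAction_eq_of_mul_eq {f g : K[X]} (hfg : f * g = X ^ Module.finrank K L - 1)
    {α : L} (hα : qAction (Fintype.card K) g α = 0) :
    ∃ β : L, qAction (Fintype.card K) f β = α := by
  obtain ⟨γ, hγ⟩ := exists_forall_exists_qAction_eq K L
  obtain ⟨a, rfl⟩ := hγ α
  rw [← qAction_mul] at hα
  have hzero : aeval (FiniteField.frobeniusAlgHom K L).toLinearMap (g * a) = 0 := by
    ext β
    obtain ⟨b, rfl⟩ := hγ β
    rw [← qAction_eq_aeval_frobenius, ← qAction_mul, LinearMap.zero_apply]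
    exact qAction_eq_zero_of_dvd (dvd_mul_right _ _) hα
  have hdvd := minpoly.dvd K _ hzero
  have hg : g ≠ 0 := by
    rintro rfl
    rw [mul_zero] at hfg
    exact X_pow_sub_C_ne_zero (Module.finrank_pos (R := K) (M := L)) (1 : K)
      (by simpa using hfg.symm)
  rw [FiniteField.minpoly_frobeniusAlgHom, ← hfg, mul_comm f g, mul_dvd_mul_iff_left hg] at hdvd
  obtain ⟨c, rfl⟩ := hdvd
  exact ⟨qAction (Fintype.card K) c γ, (qAction_mul _ _ _).symm⟩

end Action

/-- The trace to an intermediate field `M` with `#M = (#K) ^ m` is the action of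
`∑ i < [L : M], X ^ (m * i)`. -/
theorem algebraMap_trace_eq_qAction {K M L : Type*} [Field K] [Field M] [Field L] [Algebra M L]
    [Algebra K L] [Fintype K] [Fintype M] [Finite L] {m : ℕ}
    (hM : Fintype.card M = Fintype.card K ^ m) (α : L) :
    algebraMap M L (Algebra.trace M L α) =
      qAction (Fintype.card K)
        (∑ i ∈ Finset.range (Module.finrank M L), (X ^ m : K[X]) ^ i) α := by
  rw [FiniteField.algebraMap_trace_eq_sum_pow, qAction_eq_aeval_frobenius, map_sum,
    LinearMap.sum_apply]
  refine Finset.sum_congr rfl fun i _ => ?_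
  rw [Nat.card_eq_fintype_card, hM, ← pow_mul, ← pow_mul, ← qAction_eq_aeval_frobenius, qAction_X_pow]

/-- A common divisor of `X - 1` and `∑ i < u, X ^ i` is a unit if `u` is invertible. -/
theorem isUnit_of_dvd_X_sub_one_of_dvd_geom_sum {R : Type*} [Field R] {u : ℕ} (hu : (u : R) ≠ 0)
    {h : R[X]} (h₁ : h ∣ X - 1) (h₂ : h ∣ ∑ i ∈ Finset.range u, (X : R[X]) ^ i) : IsUnit h := by
  have h₃ := X_sub_C_dvd_sub_C_eval (a := (1 : R)) (p := ∑ i ∈ Finset.range u, (X : R[X]) ^ i)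
  have h₄ : eval 1 (∑ i ∈ Finset.range u, (X : R[X]) ^ i) = u := by simp [eval_finsetSum]
  rw [h₄, C_1] at h₃
  exact isUnit_of_dvd_unit ((dvd_sub_right h₂).1 (h₁.trans h₃))
    (isUnit_C.2 (isUnit_iff_ne_zero.2 hu))

/-- Let `n = p^k u` with `gcd(u, p) = 1` and `T(x) = (x^u - 1)/(x - 1)`. Then
`α ∈ F_{q^n}` has `F_q`-order `(x^n - 1)/(x - 1)` iff `α` is `T(x)`-free and
`β = Tr_{F_{q^n}/F_{q^{p^k}}}(α)` has `F_q`-order `(x^{p^k} - 1)/(x - 1)`. -/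
theorem stmt_11 (p t q n k u : ℕ) (hp : p.Prime) (ht : 1 ≤ t) (hq : q = p ^ t)
    (hgcd : Nat.gcd u p = 1) (hn : n = p ^ k * u)
    (K M L : Type*) [Field K] [Field M] [Field L] [Algebra K M] [Algebra M L] [Algebra K L]
    [IsScalarTower K M L] [Fintype K] [Fintype M] [Fintype L]
    (hK : Fintype.card K = q) (hM : Fintype.card M = q ^ p ^ k)
    (hL : Fintype.card L = q ^ n) (α : L) :
    IsFqOrder q α (∑ i ∈ Finset.range n, (X : Polynomial K) ^ i) ↔
      (IsPolyFree q (∑ i ∈ Finset.range u, (X : Polynomial K) ^ i) α ∧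
        IsFqOrder q (algebraMap M L (Algebra.trace M L α))
          (∑ i ∈ Finset.range (p ^ k), (X : Polynomial K) ^ i)) := by
  have hpk : p ^ k ≠ 0 := pow_ne_zero _ hp.ne_zero
  have hu : u ≠ 0 := by
    rintro rfl
    exact hp.ne_one (by simpa using hgcd)
  have hn0 : n ≠ 0 := hn ▸ mul_ne_zero hpk hu
  have : Fact p.Prime := ⟨hp⟩
  have : CharP K p := by
    obtain ⟨r, hr⟩ := CharP.exists K
    obtain ⟨s, hrp, hs⟩ := FiniteField.card K r
    rw [hK, hq] at hs
    rwa [(Nat.prime_dvd_prime_iff_eq hp hrp).1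
      (hp.dvd_of_dvd_pow (hs ▸ dvd_pow_self p (by lia)))]
  have huK : (u : K) ≠ 0 := fun h => hp.one_lt.ne' <| Nat.dvd_one.1 <|
    hgcd ▸ Nat.dvd_gcd ((CharP.cast_eq_zero_iff K p u).1 h) dvd_rfl
  have hq1 : 1 < q := hK ▸ Fintype.one_lt_card
  have hKL : Module.finrank K L = n := by
    have h := Module.card_eq_pow_finrank (K := K) (V := L)
    rw [hL, hK] at h
    exact (Nat.pow_right_injective hq1 h).symm
  have hML : Module.finrank M L = u := by
    have h := Module.card_eq_pow_finrank (K := M) (V := L)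
    rw [hL, hM, ← pow_mul, hn] at h
    exact (Nat.eq_of_mul_eq_mul_left (Nat.pos_of_ne_zero hpk) (Nat.pow_right_injective hq1 h)).symm
  subst hK
  rw [algebraMap_trace_eq_qAction hM, hML]
  have hrange : ∀ f g : K[X], f * g = X ^ n - 1 → qAction (Fintype.card K) g α = 0 →
      ∃ β : L, qAction (Fintype.card K) f β = α := fun f g hfg =>
    exists_qAction_eq_of_mul_eq (hKL ▸ hfg)
  have hNX := geom_sum_mul (X : K[X]) n
  have hSX := geom_sum_mul (X : K[X]) (p ^ k)
  have hCX := geom_sum_mul (X ^ p ^ k : K[X]) u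
  rw [← pow_mul, ← hn, ← hNX, ← hSX, ← mul_assoc] at hCX
  have hCS := mul_right_cancel₀ (X_sub_C_ne_zero (1 : K)) hCX
  have hCT : ∑ i ∈ Finset.range u, (X ^ p ^ k : K[X]) ^ i =
      (∑ i ∈ Finset.range u, (X : K[X]) ^ i) ^ p ^ k := by
    rw [sum_pow_char_pow]
    simp only [← pow_mul, mul_comm]
  have hNm := monic_geom_sum_X (R := K) hn0
  have hSm := monic_geom_sum_X (R := K) hpk
  have hTm := monic_geom_sum_X (R := K) hu
  have hunit := fun h : K[X] => isUnit_of_dvd_X_sub_one_of_dvd_geom_sum (h := h) huK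
  have hCm := hTm.pow (p ^ k)
  rw [← hCT] at hCm
  generalize (∑ i ∈ Finset.range n, (X : K[X]) ^ i) = N at *
  generalize (∑ i ∈ Finset.range (p ^ k), (X : K[X]) ^ i) = S at *
  generalize (∑ i ∈ Finset.range u, (X ^ p ^ k : K[X]) ^ i) = C at *
  generalize (∑ i ∈ Finset.range u, (X : K[X]) ^ i) = T at *
  constructor
  · rintro ⟨-, hα⟩
    refine ⟨fun h β hm hT hβ => ?_, hSm, fun g => ?_⟩
    · have hhN : h ∣ N := hT.trans ((hCT ▸ dvd_pow_self T hpk).trans (hCS ▸ dvd_mul_right C S))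
      obtain ⟨G, hG⟩ := hhN.mul_right (X - 1)
      have hG0 : qAction (Fintype.card K) G α = 0 := by
        rw [← hβ, ← qAction_mul, mul_comm, ← hG, hNX, ← hKL, qAction_X_pow_finrank_sub_one]
      obtain ⟨c, rfl⟩ := (hα G).1 hG0
      have hX : X - 1 = h * c := mul_left_cancel₀ hNm.ne_zero (by rw [hG]; ring)
      exact hm.eq_one_of_isUnit (hunit h ⟨c, hX⟩ hT)
    · rw [← qAction_mul, hα, ← hCS, mul_comm g, mul_dvd_mul_iff_left hCm.ne_zero]
  · rintro ⟨hfree, -, hβ⟩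
    obtain ⟨m, hm⟩ := exists_forall_qAction_eq_zero_iff_dvd (K := K) α
    have hmN : m ∣ N := by
      rw [← hm, ← hCS, mul_comm, qAction_mul, hβ]
    have hSm' : S ∣ m := by
      rw [← hβ, ← qAction_mul, hm]
      exact dvd_mul_right _ _
    obtain ⟨D, rfl⟩ := hSm'
    obtain ⟨E, hE⟩ := hmN
    have hCDE : C = D * E :=
      mul_left_cancel₀ hSm.ne_zero (by rw [← mul_assoc, ← hE, ← hCS, mul_comm])
    have hEunit : IsUnit E := by
      by_contra hE'
      obtain ⟨P, hPm, hP, R, rfl⟩ := exists_monic_irreducible_factor E hE'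
      have hPT : P ∣ T := hP.prime.dvd_of_dvd_pow (n := p ^ k)
        (hCT ▸ hCDE ▸ ⟨D * R, by ring⟩)
      obtain ⟨β, hβ'⟩ := hrange P (S * D * R * (X - 1)) (by rw [← hNX, hE]; ring)
        ((hm _).2 ⟨R * (X - 1), by ring⟩)
      exact hP.not_isUnit (hfree P β hPm hPT hβ' ▸ isUnit_one)
    refine ⟨hNm, fun g => ?_⟩
    rw [hm, hE, hEunit.mul_right_dvd]
end

section
/- Let q be a power of an odd prime p and write n = p^k u with gcd(u, p) = 1. Let m be a divisor of n with m < n, let f ∈ F_q[x] be a monic divisor of x^u − 1 not divisible by x − 1, and assume that m = 1 or m is a power of p whenever f ≠ 1. Let β ∈ F_{q^m}, and let N(f, m, β) denote the number of w ∈ F_{q^n} such that w is primitive (of multiplicative order q^n − 1), w^2 is f-free over F_q, and Tr_{F_{q^n}/F_{q^m}}(w^2) = β. Then N(f, m, β) · ((q^n − 1)/φ(q^n − 1)) · (q^{deg f}/Φ(f)) > q^{n−m} − 2 q^{n/2} W(q^n − 1) W(f). -/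
open Polynomial

/-- `W(t) = 2^{ω(t)}`, the number of squarefree divisors of the positive integer `t`. -/
def Wnat (t : ℕ) : ℕ := 2 ^ t.primeFactors.card

/-- `W(f)`, the number of monic squarefree divisors of `f` in `F_q[x]`. -/
noncomputable def Wpoly {K : Type*} [Field K] (f : Polynomial K) : ℕ :=
  Set.ncard {d : Polynomial K | d.Monic ∧ Squarefree d ∧ d ∣ f}

/-- `Φ(f)`, the number of units of `F_q[x]/(f)`. -/
noncomputable def PhiPoly {K : Type*} [Field K] (f : Polynomial K) : ℕ :=
  Nat.card (Polynomial K ⧸ Ideal.span {f})ˣ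

open scoped Classical in
/-- The characters of `A` that are trivial on the subgroup `B`. -/
noncomputable def annihilatorChars {A : Type*} [AddCommGroup A] [Finite A] (B : AddSubgroup A) :
    Finset (AddChar A ℂ) :=
  Finset.univ.filter fun ψ => ∀ x ∈ B, ψ x = 1

section Expansion

variable {A : Type*} [AddCommGroup A] [Finite A]

lemma mem_annihilatorChars {B : AddSubgroup A} {ψ : AddChar A ℂ} :
    ψ ∈ annihilatorChars B ↔ ∀ x ∈ B, ψ x = 1 := by
  simp [annihilatorChars]

lemma one_mem_annihilatorChars (B : AddSubgroup A) : 1 ∈ annihilatorChars B := by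
  simp [mem_annihilatorChars]

lemma mul_mem_annihilatorChars {B : AddSubgroup A} {ψ χ : AddChar A ℂ}
    (hψ : ψ ∈ annihilatorChars B) (hχ : χ ∈ annihilatorChars B) :
    ψ * χ ∈ annihilatorChars B := by
  rw [mem_annihilatorChars] at *
  intro x hx
  simp [hψ x hx, hχ x hx]

lemma annihilatorChars_anti {B C : AddSubgroup A} (h : B ≤ C) :
    annihilatorChars C ⊆ annihilatorChars B := by
  intro ψ hψ
  rw [mem_annihilatorChars] at *
  exact fun x hx => hψ x (h hx)

lemma eq_one_of_mem_annihilatorChars {B C : AddSubgroup A} (h : B ⊔ C = ⊤) {ψ : AddChar A ℂ}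
    (hB : ψ ∈ annihilatorChars B) (hC : ψ ∈ annihilatorChars C) : ψ = 1 := by
  rw [mem_annihilatorChars] at *
  ext x
  obtain ⟨b, hb, c, hc, rfl⟩ := AddSubgroup.mem_sup.1 (h ▸ AddSubgroup.mem_top x : x ∈ B ⊔ C)
  simp [AddChar.map_add_eq_mul, hB b hb, hC c hc]

open scoped Classical in
lemma sum_annihilatorChars_apply (B : AddSubgroup A) (x : A) :
    ∑ ψ ∈ annihilatorChars B, ψ x = if x ∈ B then ((annihilatorChars B).card : ℂ) else 0 := by
  split_ifs with hx
  · rw [Finset.sum_congr rfl fun ψ hψ => mem_annihilatorChars.1 hψ x hx]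
    simp
  · obtain ⟨χ, hχ⟩ := (AddChar.exists_apply_ne_zero (a := (x : A ⧸ B))).2
      (by rwa [Ne, QuotientAddGroup.eq_zero_iff])
    set χ₀ : AddChar A ℂ := χ.compAddMonoidHom (QuotientAddGroup.mk' B)
    have hχ₀ : χ₀ ∈ annihilatorChars B := by
      rw [mem_annihilatorChars]
      intro b hb
      have : (b : A ⧸ B) = 0 := by rwa [QuotientAddGroup.eq_zero_iff]
      simp [χ₀, this]
    have hinv : χ₀⁻¹ ∈ annihilatorChars B := by
      rw [mem_annihilatorChars] at *
      intro b hb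
      rw [AddChar.inv_apply]
      exact hχ₀ _ (B.neg_mem hb)
    have key : χ₀ x * ∑ ψ ∈ annihilatorChars B, ψ x = ∑ ψ ∈ annihilatorChars B, ψ x := by
      rw [Finset.mul_sum]
      refine Finset.sum_bij' (fun ψ _ => χ₀ * ψ) (fun ψ _ => χ₀⁻¹ * ψ) ?_ ?_ ?_ ?_ ?_
      · exact fun ψ hψ => mul_mem_annihilatorChars hχ₀ hψ
      · exact fun ψ hψ => mul_mem_annihilatorChars hinv hψ
      · intros; simp
      · intros; simp
      · intros; simp
    have h1 : χ₀ x ≠ 1 := hχ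
    have : (χ₀ x - 1) * ∑ ψ ∈ annihilatorChars B, ψ x = 0 := by rw [sub_mul, key]; ring
    exact (mul_eq_zero.1 this).resolve_left (sub_ne_zero.2 h1)

lemma card_annihilatorChars (B : AddSubgroup A) : (annihilatorChars B).card = B.index := by
  classical
  have := Fintype.ofFinite A
  have h1 : ∑ x : A, ∑ ψ ∈ annihilatorChars B, ψ x = Nat.card A := by
    rw [Finset.sum_comm]
    simp_rw [AddChar.sum_eq_ite]
    rw [Finset.sum_ite_eq' (annihilatorChars B) (0 : AddChar A ℂ)]
    simp [one_mem_annihilatorChars, ← AddChar.one_eq_zero]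
  have h2 : ∑ x : A, ∑ ψ ∈ annihilatorChars B, ψ x
      = Nat.card B * (annihilatorChars B).card := by
    simp_rw [sum_annihilatorChars_apply]
    rw [← Finset.sum_filter, Finset.sum_const, nsmul_eq_mul]
    congr 2
    rw [Nat.card_eq_fintype_card, Fintype.card_subtype]
  have h3 : Nat.card B * (annihilatorChars B).card = Nat.card B * B.index := by
    rw [B.card_mul_index]
    exact_mod_cast h2.symm.trans h1
  exact Nat.eq_of_mul_eq_mul_left Nat.card_pos h3

/-- `g` is a combination of characters trivial on `B`, in which the trivial character has
coefficient `c` and the absolute values of the coefficients sum to at most `N`. -/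
def HasCharExpansion (B : AddSubgroup A) (g : A → ℂ) (c N : ℝ) : Prop :=
  ∃ a : AddChar A ℂ → ℂ, (∀ ψ, ψ ∉ annihilatorChars B → a ψ = 0) ∧ a 1 = c ∧
    ∑ ψ, ‖a ψ‖ ≤ N ∧ ∀ x, g x = ∑ ψ, a ψ * ψ x

lemma HasCharExpansion.mul {B C : AddSubgroup A} {g h : A → ℂ} {c d N P : ℝ}
    (hg : HasCharExpansion B g c N) (hh : HasCharExpansion C h d P) (hBC : B ⊔ C = ⊤) :
    HasCharExpansion (B ⊓ C) (fun x => g x * h x) (c * d) (N * P) := by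
  obtain ⟨a, haB, ha1, haN, hag⟩ := hg
  obtain ⟨b, hbC, hb1, hbP, hbh⟩ := hh
  refine ⟨fun ψ => ∑ χ, a χ * b (χ⁻¹ * ψ), ?_, ?_, ?_, ?_⟩
  · intro ψ hψ
    refine Finset.sum_eq_zero fun χ _ => ?_
    by_contra hne
    have h1 : χ ∈ annihilatorChars B := by
      by_contra h; exact hne (by rw [haB χ h, zero_mul])
    have h2 : χ⁻¹ * ψ ∈ annihilatorChars C := by
      by_contra h; exact hne (by rw [hbC _ h, mul_zero])
    apply hψ
    have := mul_mem_annihilatorChars (annihilatorChars_anti (inf_le_left : B ⊓ C ≤ B) h1)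
      (annihilatorChars_anti (inf_le_right : B ⊓ C ≤ C) h2)
    simpa using this
  · change ∑ χ, a χ * b (χ⁻¹ * 1) = _
    rw [Finset.sum_eq_single 1]
    · simp [ha1, hb1]
    · intro χ _ hχ
      by_contra hne
      have h1 : χ ∈ annihilatorChars B := by
        by_contra h; exact hne (by rw [haB χ h, zero_mul])
      have h2 : χ⁻¹ ∈ annihilatorChars C := by
        by_contra h; exact hne (by rw [hbC _ (by simpa using h), mul_zero])
      have h3 : χ ∈ annihilatorChars C := by
        rw [mem_annihilatorChars] at *
        intro x hx
        simpa [AddChar.inv_apply] using h2 (-x) (C.neg_mem hx)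
      exact hχ (eq_one_of_mem_annihilatorChars hBC h1 h3)
    · simp
  · calc ∑ ψ, ‖∑ χ, a χ * b (χ⁻¹ * ψ)‖
        ≤ ∑ ψ, ∑ χ, ‖a χ‖ * ‖b (χ⁻¹ * ψ)‖ := by
          gcongr with ψ _
          exact (norm_sum_le _ _).trans_eq (by simp)
      _ = ∑ χ, ‖a χ‖ * ∑ ψ, ‖b ψ‖ := by
          rw [Finset.sum_comm]
          refine Finset.sum_congr rfl fun χ _ => ?_
          rw [← Finset.mul_sum, ← Equiv.sum_comp (Equiv.mulLeft χ⁻¹) (fun ψ => ‖b ψ‖)]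
          simp
      _ = (∑ χ, ‖a χ‖) * ∑ ψ, ‖b ψ‖ := by rw [Finset.sum_mul]
      _ ≤ N * P := by
          have : 0 ≤ ∑ χ, ‖a χ‖ := by positivity
          gcongr
          exact this.trans haN
  · intro x
    simp only [hag, hbh]
    simp_rw [Finset.sum_mul]
    rw [Finset.sum_comm]
    refine Finset.sum_congr rfl fun χ _ => ?_
    rw [← Equiv.sum_comp (Equiv.mulLeft χ⁻¹) (fun ψ => b ψ * ψ x), Finset.mul_sum]
    refine Finset.sum_congr rfl fun ψ _ => ?_
    have : χ x * (χ⁻¹ * ψ) x = ψ x := by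
      rw [← AddChar.mul_apply]; simp
    simp only [Equiv.coe_mulLeft]
    rw [← this]; ring

open scoped Classical in
lemma hasCharExpansion_coset (B : AddSubgroup A) (y : A) :
    HasCharExpansion B (fun x => if x - y ∈ B then 1 else 0) (1 / B.index) 1 := by
  have hidx : (B.index : ℂ) ≠ 0 := by
    exact_mod_cast AddSubgroup.index_ne_zero_of_finite
  refine ⟨fun ψ => if ψ ∈ annihilatorChars B then ψ (-y) / B.index else 0, ?_, ?_, ?_, ?_⟩
  · intro ψ hψ
    simp [hψ]
  · simp [one_mem_annihilatorChars]
  · have : ∀ ψ : AddChar A ℂ, ‖if ψ ∈ annihilatorChars B then ψ (-y) / B.index else 0‖ =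
        if ψ ∈ annihilatorChars B then (1 / B.index : ℝ) else 0 := by
      intro ψ
      split_ifs <;> simp [AddChar.norm_apply]
    simp_rw [this]
    rw [Finset.sum_ite_mem, Finset.univ_inter, Finset.sum_const, card_annihilatorChars,
      nsmul_eq_mul, mul_one_div_cancel (by exact_mod_cast hidx)]
  · intro x
    simp only [ite_mul, zero_mul]
    rw [Finset.sum_ite_mem, Finset.univ_inter]
    have : ∀ ψ : AddChar A ℂ, ψ (-y) / B.index * ψ x = ψ (x - y) / B.index := by
      intro ψ
      rw [sub_eq_add_neg, AddChar.map_add_eq_mul]; ring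
    simp_rw [this, ← Finset.sum_div, sum_annihilatorChars_apply, card_annihilatorChars]
    split_ifs <;> simp [hidx]

open scoped Classical in
lemma hasCharExpansion_notMem (B : AddSubgroup A) :
    HasCharExpansion B (fun x => if x ∉ B then 1 else 0) (1 - 1 / B.index)
      (2 * (1 - 1 / B.index)) := by
  have hidx : (B.index : ℂ) ≠ 0 := by
    exact_mod_cast AddSubgroup.index_ne_zero_of_finite
  have hidx' : (B.index : ℝ) ≠ 0 := by exact_mod_cast hidx
  have hone : (1 : ℝ) ≤ B.index := by
    exact_mod_cast Nat.one_le_iff_ne_zero.2 AddSubgroup.index_ne_zero_of_finite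
  have hle : (1 / B.index : ℝ) ≤ 1 := by
    rw [div_le_one (by linarith)]; exact hone
  refine ⟨fun ψ => (if ψ = 1 then 1 else 0) -
    if ψ ∈ annihilatorChars B then (1 / B.index : ℂ) else 0, ?_, ?_, ?_, ?_⟩
  · intro ψ hψ
    have : ψ ≠ 1 := by
      rintro rfl; exact hψ (one_mem_annihilatorChars B)
    simp [hψ, this]
  · simp [one_mem_annihilatorChars]
  · rw [← Finset.add_sum_erase _ _ (Finset.mem_univ (1 : AddChar A ℂ))]
    have h1 : ∀ ψ ∈ Finset.univ.erase (1 : AddChar A ℂ), ‖(if ψ = 1 then 1 else 0) -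
        if ψ ∈ annihilatorChars B then (1 / B.index : ℂ) else 0‖ =
        if ψ ∈ annihilatorChars B then (1 / B.index : ℝ) else 0 := by
      intro ψ hψ
      rw [if_neg (Finset.ne_of_mem_erase hψ)]
      split_ifs <;> simp
    rw [Finset.sum_congr rfl h1, Finset.sum_ite_mem]
    have h2 : Finset.univ.erase (1 : AddChar A ℂ) ∩ annihilatorChars B =
        (annihilatorChars B).erase 1 := by
      ext; simp [and_comm]
    have h3 : (((annihilatorChars B).erase 1).card : ℝ) = B.index - 1 := by
      rw [Finset.card_erase_of_mem (one_mem_annihilatorChars B), card_annihilatorChars,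
        Nat.cast_sub (by exact_mod_cast hone), Nat.cast_one]
    have h4 : ‖(1 - 1 / B.index : ℂ)‖ = 1 - 1 / B.index := by
      have : (1 - 1 / B.index : ℂ) = ((1 - 1 / B.index : ℝ) : ℂ) := by push_cast; rfl
      rw [this, Complex.norm_real, Real.norm_of_nonneg (by linarith)]
    rw [h2, Finset.sum_const, nsmul_eq_mul, h3]
    simp only [if_true, if_pos (one_mem_annihilatorChars B), h4]
    field_simp
    linarith
  · intro x
    simp only [sub_mul, ite_mul, zero_mul, one_mul, Finset.sum_sub_distrib]
    rw [Finset.sum_ite_mem, Finset.univ_inter, ← Finset.mul_sum, sum_annihilatorChars_apply,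
      card_annihilatorChars]
    by_cases hx : x ∈ B <;> simp [hx, hidx]

open scoped Classical in
lemma hasCharExpansion_forall_notMem {ι : Type*} (B : ι → AddSubgroup A) (S : Finset ι)
    (hB : ∀ i ∈ S, ∀ T ⊆ S, i ∉ T → B i ⊔ ⨅ j ∈ T, B j = ⊤) :
    HasCharExpansion (⨅ j ∈ S, B j) (fun x => if ∀ i ∈ S, x ∉ B i then 1 else 0)
      (∏ i ∈ S, (1 - 1 / ((B i).index : ℝ))) (∏ i ∈ S, (2 * (1 - 1 / ((B i).index : ℝ)))) := by
  induction S using Finset.induction_on with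
  | empty =>
    have := hasCharExpansion_coset (⊤ : AddSubgroup A) 0
    simpa using this
  | insert i S hi ih =>
    have h1 := ih fun j hj T hT => hB j (Finset.mem_insert_of_mem hj) T
      (hT.trans (Finset.subset_insert i S))
    have h2 := (hasCharExpansion_notMem (B i)).mul h1
      (hB i (Finset.mem_insert_self i S) S (Finset.subset_insert i S) hi)
    rw [Finset.prod_insert hi, Finset.prod_insert hi, Finset.iInf_insert]
    convert h2 using 2 with x
    by_cases hx : x ∈ B i <;> simp [hx]

end Expansion

section ExponentialSums

variable {L : Type*} [Field L]

lemma units_eq_or_eq_neg_of_sq_eq {v w : Lˣ} (h : (v : L) ^ 2 = (w : L) ^ 2) :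
    v = w ∨ v = -w := by
  rcases sq_eq_sq_iff_eq_or_eq_neg.1 h with h | h
  · exact Or.inl (Units.ext h)
  · exact Or.inr (Units.ext (by simpa using h))

variable [Fintype L] [DecidableEq L]

lemma card_units_sq_eq_le_two (y : L) :
    (Finset.univ.filter fun v : Lˣ => (v : L) ^ 2 = y).card ≤ 2 := by
  rcases (Finset.univ.filter fun v : Lˣ => (v : L) ^ 2 = y).eq_empty_or_nonempty with h | ⟨v, hv⟩
  · simp [h]
  · refine (Finset.card_le_card (t := {v, -v}) ?_).trans Finset.card_le_two
    intro w hw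
    simp only [Finset.mem_filter, Finset.mem_univ, true_and] at hv hw
    simpa using units_eq_or_eq_neg_of_sq_eq (hw.trans hv.symm)

/-- The sum over `w ≠ 0` of `χ(w) γ(y w²)`. -/
noncomputable def quadraticCharSum (χ : AddChar (Additive Lˣ) ℂ) (γ : AddChar L ℂ) (y : L) : ℂ :=
  ∑ w : Lˣ, χ (Additive.ofMul w) * γ (y * (w : L) ^ 2)

lemma norm_quadraticCharSum_sq (χ : AddChar (Additive Lˣ) ℂ) (γ : AddChar L ℂ) (v : Lˣ) :
    ‖quadraticCharSum χ γ ((v : L) ^ 2)‖ = ‖quadraticCharSum χ γ 1‖ := by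
  have h : χ (Additive.ofMul v) * quadraticCharSum χ γ ((v : L) ^ 2) =
      quadraticCharSum χ γ 1 := by
    unfold quadraticCharSum
    rw [← Equiv.sum_comp (Equiv.mulLeft v)
      (fun w : Lˣ => χ (Additive.ofMul w) * γ (1 * (w : L) ^ 2)), Finset.mul_sum]
    refine Finset.sum_congr rfl fun w _ => ?_
    rw [Equiv.coe_mulLeft, ofMul_mul, AddChar.map_add_eq_mul, Units.val_mul, mul_pow, one_mul]
    ring
  rw [← h, norm_mul, AddChar.norm_apply, one_mul]

lemma sum_norm_sq_quadraticCharSum_le (χ : AddChar (Additive Lˣ) ℂ) {γ : AddChar L ℂ}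
    (hγ : γ ≠ 1) :
    ∑ y : L, ‖quadraticCharSum χ γ y‖ ^ 2 ≤
      Fintype.card L * (2 * (Fintype.card Lˣ : ℝ)) := by
  have h1 : ((∑ y : L, ‖quadraticCharSum χ γ y‖ ^ 2 : ℝ) : ℂ) =
      ∑ w : Lˣ, ∑ v : Lˣ, χ (Additive.ofMul w) * χ (-Additive.ofMul v) *
        if (w : L) ^ 2 - (v : L) ^ 2 = 0 then (Fintype.card L : ℂ) else 0 := by
    push_cast
    have h2 : ∀ y : L, (‖quadraticCharSum χ γ y‖ : ℂ) ^ 2 =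
        ∑ w : Lˣ, ∑ v : Lˣ, χ (Additive.ofMul w) * χ (-Additive.ofMul v) *
          γ (y * ((w : L) ^ 2 - (v : L) ^ 2)) := by
      intro y
      rw [← Complex.mul_conj']
      unfold quadraticCharSum
      rw [map_sum, Finset.sum_mul_sum]
      refine Finset.sum_congr rfl fun w _ => Finset.sum_congr rfl fun v _ => ?_
      rw [map_mul (starRingEnd ℂ), ← AddChar.map_neg_eq_conj, ← AddChar.map_neg_eq_conj, mul_sub,
        sub_eq_add_neg, AddChar.map_add_eq_mul]
      ring
    simp_rw [h2]
    rw [Finset.sum_comm]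
    refine Finset.sum_congr rfl fun w _ => ?_
    rw [Finset.sum_comm]
    refine Finset.sum_congr rfl fun v _ => ?_
    rw [← Finset.mul_sum, AddChar.sum_mulShift _ (AddChar.IsPrimitive.of_ne_one hγ)]
    split_ifs <;> simp
  have h3 : ∑ y : L, ‖quadraticCharSum χ γ y‖ ^ 2 =
      ‖((∑ y : L, ‖quadraticCharSum χ γ y‖ ^ 2 : ℝ) : ℂ)‖ := by
    rw [Complex.norm_real, Real.norm_of_nonneg (by positivity)]
  rw [h3, h1]
  calc _ ≤ ∑ w : Lˣ, ∑ v : Lˣ, if (v : L) ^ 2 = (w : L) ^ 2 then (Fintype.card L : ℝ) else 0 := by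
        refine (norm_sum_le _ _).trans (Finset.sum_le_sum fun w _ => ?_)
        refine (norm_sum_le _ _).trans (Finset.sum_le_sum fun v _ => ?_)
        rw [norm_mul, norm_mul, AddChar.norm_apply, AddChar.norm_apply, one_mul, one_mul]
        simp only [sub_eq_zero]
        by_cases h : (w : L) ^ 2 = (v : L) ^ 2
        · simp [h]
        · simp [h, Ne.symm h]
    _ ≤ ∑ _w : Lˣ, (Fintype.card L * 2 : ℝ) := by
        refine Finset.sum_le_sum fun w _ => ?_
        rw [← Finset.sum_filter, Finset.sum_const, nsmul_eq_mul, mul_comm]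
        gcongr
        exact Nat.cast_le_ofNat.2 (card_units_sq_eq_le_two ((w : L) ^ 2))
    _ = _ := by
        rw [Finset.sum_const, nsmul_eq_mul, Finset.card_univ]; ring

lemma norm_quadraticCharSum_one_le (χ : AddChar (Additive Lˣ) ℂ) {γ : AddChar L ℂ}
    (hγ : γ ≠ 1) :
    ‖quadraticCharSum χ γ 1‖ ≤ 2 * √(Fintype.card L) := by
  have hpos : (0 : ℝ) < Fintype.card Lˣ := Nat.cast_pos.2 Fintype.card_pos
  have h1 : Fintype.card Lˣ * ‖quadraticCharSum χ γ 1‖ ^ 2 ≤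
      2 * ∑ y : L, ‖quadraticCharSum χ γ y‖ ^ 2 := by
    calc Fintype.card Lˣ * ‖quadraticCharSum χ γ 1‖ ^ 2
        = ∑ v : Lˣ, ‖quadraticCharSum χ γ ((v : L) ^ 2)‖ ^ 2 := by
          simp_rw [norm_quadraticCharSum_sq]
          rw [Finset.sum_const, nsmul_eq_mul, Finset.card_univ]
      _ = ∑ y : L, ∑ v ∈ Finset.univ.filter fun v : Lˣ => (v : L) ^ 2 = y,
            ‖quadraticCharSum χ γ ((v : L) ^ 2)‖ ^ 2 :=
          (Finset.sum_fiberwise _ _ _).symm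
      _ ≤ ∑ y : L, 2 * ‖quadraticCharSum χ γ y‖ ^ 2 := by
          refine Finset.sum_le_sum fun y _ => ?_
          rw [Finset.sum_congr rfl (g := fun _ => ‖quadraticCharSum χ γ y‖ ^ 2)
            (fun v hv => by rw [(Finset.mem_filter.1 hv).2]), Finset.sum_const, nsmul_eq_mul]
          exact mul_le_mul_of_nonneg_right (Nat.cast_le_ofNat.2 (card_units_sq_eq_le_two y))
            (by positivity)
      _ = _ := by rw [Finset.mul_sum]
  have h2 := h1.trans (mul_le_mul_of_nonneg_left (sum_norm_sq_quadraticCharSum_le χ hγ) zero_le_two)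
  have h3 : ‖quadraticCharSum χ γ 1‖ ^ 2 ≤ 4 * Fintype.card L := by
    refine le_of_mul_le_mul_left ?_ hpos
    linarith
  refine abs_le_of_sq_le_sq' ?_ (by positivity) |>.2
  rw [mul_pow, Real.sq_sqrt (by positivity)]
  linarith

lemma quadraticCharSum_one_char {χ : AddChar (Additive Lˣ) ℂ} (hχ : χ ≠ 1) :
    quadraticCharSum χ (1 : AddChar L ℂ) 1 = 0 := by
  simp only [quadraticCharSum, AddChar.one_apply, mul_one]
  exact (Equiv.sum_comp Additive.ofMul fun x => χ x).trans
    (AddChar.sum_eq_zero_iff_ne_zero.2 hχ)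

lemma norm_sum_units_sub_le {B : AddSubgroup (Additive Lˣ)} {C : AddSubgroup L}
    {P : Additive Lˣ → ℂ} {F : L → ℂ} {c d N R : ℝ} (hP : HasCharExpansion B P c N)
    (hF : HasCharExpansion C F d R) (hd : 0 ≤ d) :
    ‖∑ w : Lˣ, P (Additive.ofMul w) * F ((w : L) ^ 2) - c * d * (Fintype.card Lˣ : ℝ)‖ ≤
      2 * √(Fintype.card L) * N * (R - d) := by
  classical
  obtain ⟨a, -, ha1, haN, haP⟩ := hP
  obtain ⟨b, -, hb1, hbR, hbF⟩ := hF
  have h1 : ∑ w : Lˣ, P (Additive.ofMul w) * F ((w : L) ^ 2) =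
      ∑ γ, ∑ χ, a χ * b γ * quadraticCharSum χ γ 1 := by
    simp_rw [haP, hbF, Finset.sum_mul_sum, quadraticCharSum, Finset.mul_sum]
    rw [Finset.sum_comm, Finset.sum_comm (s := Finset.univ (α := AddChar L ℂ))]
    refine Finset.sum_congr rfl fun χ _ => ?_
    rw [Finset.sum_comm]
    refine Finset.sum_congr rfl fun γ _ => Finset.sum_congr rfl fun w _ => ?_
    rw [one_mul]; ring
  have h2 : ∑ χ, a χ * b 1 * quadraticCharSum χ (1 : AddChar L ℂ) 1 =
      c * d * (Fintype.card Lˣ : ℝ) := by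
    rw [Finset.sum_eq_single 1]
    · rw [ha1, hb1]
      simp [quadraticCharSum]
    · intro χ _ hχ
      rw [quadraticCharSum_one_char hχ, mul_zero]
    · simp
  have h3 : ∑ γ ∈ Finset.univ.erase 1, ‖b γ‖ ≤ R - d := by
    have := Finset.add_sum_erase _ (fun γ => ‖b γ‖) (Finset.mem_univ (1 : AddChar L ℂ))
    simp only [hb1, Complex.norm_real, Real.norm_of_nonneg hd] at this
    linarith
  have hN : 0 ≤ N := le_trans (by positivity) haN
  rw [h1, ← Finset.add_sum_erase _ _ (Finset.mem_univ (1 : AddChar L ℂ)), h2, add_sub_cancel_left]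
  calc _ ≤ ∑ γ ∈ Finset.univ.erase (1 : AddChar L ℂ), ∑ χ : AddChar (Additive Lˣ) ℂ,
        ‖a χ‖ * ‖b γ‖ * (2 * √(Fintype.card L)) := by
        refine (norm_sum_le _ _).trans (Finset.sum_le_sum fun γ hγ => ?_)
        refine (norm_sum_le _ _).trans (Finset.sum_le_sum fun χ _ => ?_)
        rw [norm_mul, norm_mul]
        gcongr
        exact norm_quadraticCharSum_one_le χ (Finset.ne_of_mem_erase hγ)
    _ = 2 * √(Fintype.card L) * (∑ χ, ‖a χ‖) * ∑ γ ∈ Finset.univ.erase 1, ‖b γ‖ := by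
        simp_rw [← Finset.sum_mul, ← Finset.mul_sum]
        ring
    _ ≤ _ := by gcongr

end ExponentialSums

section Primitive

variable {G : Type*} [CommGroup G]

/-- The subgroup of `d`-th powers of `G`, written additively. -/
def powerSubgroup (G : Type*) [CommGroup G] (d : ℕ) : AddSubgroup (Additive G) :=
  (powMonoidHom d : G →* G).range.toAddSubgroup

lemma ofMul_mem_powerSubgroup {d : ℕ} {x : G} :
    Additive.ofMul x ∈ powerSubgroup G d ↔ ∃ y : G, y ^ d = x :=
  Iff.rfl

lemma powerSubgroup_sup_eq_top {d e : ℕ} (h : d.Coprime e) :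
    powerSubgroup G d ⊔ powerSubgroup G e = ⊤ := by
  rw [eq_top_iff]
  intro x _
  obtain ⟨a, b, hab⟩ := Nat.isCoprime_iff_coprime.2 h
  rw [AddSubgroup.mem_sup]
  refine ⟨Additive.ofMul ((x.toMul ^ a) ^ d), ⟨_, rfl⟩, Additive.ofMul ((x.toMul ^ b) ^ e),
    ⟨_, rfl⟩, ?_⟩
  rw [← ofMul_mul, ← zpow_natCast, ← zpow_natCast, ← zpow_mul, ← zpow_mul, ← zpow_add, hab,
    zpow_one, ofMul_toMul]

lemma powerSubgroup_le_of_dvd {d e : ℕ} (h : d ∣ e) : powerSubgroup G e ≤ powerSubgroup G d := by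
  obtain ⟨r, rfl⟩ := h
  rintro _ ⟨y, rfl⟩
  exact ⟨y ^ r, by rw [mul_comm d r]; exact (pow_mul y r d).symm⟩

variable [IsCyclic G] [Finite G]

lemma index_powerSubgroup {d : ℕ} (h : d ∣ Nat.card G) : (powerSubgroup G d).index = d := by
  rw [powerSubgroup, Subgroup.index_toAddSubgroup, IsCyclic.index_powMonoidHom_range,
    Nat.gcd_eq_right h]

lemma orderOf_eq_card_iff_forall_notMem (x : G) :
    orderOf x = Nat.card G ↔
      ∀ ℓ ∈ (Nat.card G).primeFactors, Additive.ofMul x ∉ powerSubgroup G ℓ := by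
  have hpos : 0 < Nat.card G := Nat.card_pos
  constructor
  · intro hx ℓ hℓ hmem
    obtain ⟨y, rfl⟩ := ofMul_mem_powerSubgroup.1 hmem
    obtain ⟨hp, ⟨r, hr⟩, -⟩ := Nat.mem_primeFactors.1 hℓ
    have h1 : (y ^ ℓ) ^ r = 1 := by rw [← pow_mul, ← hr, pow_card_eq_one']
    have hr0 : 0 < r := Nat.pos_of_ne_zero fun h => by simp [h] at hr; omega
    have h2 := Nat.le_of_dvd hr0 (orderOf_dvd_of_pow_eq_one h1)
    rw [hx, hr] at h2
    nlinarith [hp.two_le]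
  · intro h
    refine orderOf_eq_of_pow_and_pow_div_prime hpos pow_card_eq_one' fun ℓ hp hdvd hx => ?_
    refine h ℓ (Nat.mem_primeFactors.2 ⟨hp, hdvd, hpos.ne'⟩) (ofMul_mem_powerSubgroup.2 ?_)
    obtain ⟨g, hg⟩ := IsCyclic.exists_generator (α := G)
    obtain ⟨k, rfl⟩ := (mem_powers_iff_mem_zpowers (x := g)).2 (hg x)
    have hog : orderOf g = Nat.card G := orderOf_eq_card_of_forall_mem_zpowers hg
    simp only at hx
    rw [← pow_mul, ← orderOf_dvd_iff_pow_eq_one, hog] at hx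
    obtain ⟨r, hr⟩ := hdvd
    rw [hr, Nat.mul_div_cancel_left _ hp.pos, mul_comm ℓ r, mul_comm k r] at hx
    have hr0 : 0 < r := Nat.pos_of_ne_zero fun h => by simp [h] at hr; omega
    obtain ⟨s, rfl⟩ := Nat.dvd_of_mul_dvd_mul_left hr0 hx
    exact ⟨g ^ s, by simp [← pow_mul, mul_comm]⟩

open scoped Classical in
lemma exists_hasCharExpansion_orderOf_eq_card :
    ∃ B : AddSubgroup (Additive G), HasCharExpansion B
      (fun x => if orderOf x.toMul = Nat.card G then 1 else 0)
      ((Nat.card G).totient / Nat.card G)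
      (Wnat (Nat.card G) * ((Nat.card G).totient / Nat.card G)) := by
  have hprod : ((Nat.card G).totient / Nat.card G : ℝ) = ∏ ℓ ∈ (Nat.card G).primeFactors,
      (1 - 1 / ((powerSubgroup G ℓ).index : ℝ)) := by
    have h := congrArg (fun x : ℚ => (x : ℝ)) (Nat.totient_eq_mul_prod_factors (Nat.card G))
    push_cast at h
    rw [h, mul_div_cancel_left₀ _ (by exact_mod_cast Nat.card_pos.ne')]
    refine Finset.prod_congr rfl fun ℓ hℓ => ?_
    rw [index_powerSubgroup (Nat.dvd_of_mem_primeFactors hℓ), one_div]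
  have key := hasCharExpansion_forall_notMem (powerSubgroup G) (Nat.card G).primeFactors ?_
  · refine ⟨⨅ ℓ ∈ (Nat.card G).primeFactors, powerSubgroup G ℓ, ?_⟩
    convert key using 1
    · funext x
      exact if_congr (orderOf_eq_card_iff_forall_notMem x.toMul) rfl rfl
    · rw [Finset.prod_mul_distrib, ← hprod, Finset.prod_const, Wnat]
      push_cast
      rfl
  · intro ℓ hℓ T hT hnot
    have hcop : ℓ.Coprime (∏ j ∈ T, j) := Nat.Coprime.prod_right fun j hj =>
      (Nat.coprime_primes (Nat.prime_of_mem_primeFactors hℓ)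
        (Nat.prime_of_mem_primeFactors (hT hj))).2 fun h => hnot (h ▸ hj)
    rw [eq_top_iff, ← powerSubgroup_sup_eq_top hcop]
    have hle : powerSubgroup G (∏ j ∈ T, j) ≤ ⨅ j ∈ T, powerSubgroup G j :=
      le_iInf₂ fun j hj => powerSubgroup_le_of_dvd (Finset.dvd_prod_of_mem (fun j => j) hj)
    exact sup_le_sup_left hle _

end Primitive

section FrobeniusModule

variable {K L : Type*} [Field K] [Fintype K] [Field L] [Algebra K L]

/-- The action of a polynomial on `L` through the Frobenius `x ↦ x ^ |K|`. -/
noncomputable def frobeniusAeval (L : Type*) {K : Type*} [Field K] [Fintype K] [Field L]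
    [Algebra K L] (g : K[X]) : Module.End K L :=
  aeval (FiniteField.frobeniusAlgHom K L).toLinearMap g

lemma frobenius_toLinearMap_pow_apply (i : ℕ) (x : L) :
    ((FiniteField.frobeniusAlgHom K L).toLinearMap ^ i) x = x ^ Fintype.card K ^ i := by
  induction i generalizing x with
  | zero => simp
  | succ i ih =>
    rw [pow_succ, Module.End.mul_apply, ih]
    simp [← pow_mul, pow_succ']

lemma frobeniusAeval_apply (g : K[X]) (x : L) :
    frobeniusAeval L g x = ∑ i ∈ g.support, g.coeff i • x ^ Fintype.card K ^ i := by
  rw [frobeniusAeval, aeval_def, eval₂_eq_sum, Polynomial.sum, LinearMap.sum_apply]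
  refine Finset.sum_congr rfl fun i _ => ?_
  rw [← Algebra.smul_def, LinearMap.smul_apply, frobenius_toLinearMap_pow_apply]

lemma frobeniusAeval_mul_apply (g h : K[X]) (x : L) :
    frobeniusAeval L (g * h) x = frobeniusAeval L g (frobeniusAeval L h x) := by
  simp [frobeniusAeval]

/-- The image of `L` under the Frobenius action of `g`. -/
noncomputable def frobeniusRange (L : Type*) {K : Type*} [Field K] [Fintype K] [Field L]
    [Algebra K L] (g : K[X]) : AddSubgroup L :=
  (frobeniusAeval L g).range.toAddSubgroup

lemma frobeniusRange_le_of_dvd {g h : K[X]} (hgh : g ∣ h) :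
    frobeniusRange L h ≤ frobeniusRange L g := by
  obtain ⟨r, rfl⟩ := hgh
  rintro _ ⟨y, rfl⟩
  exact ⟨_, (frobeniusAeval_mul_apply g r y).symm⟩

lemma frobeniusRange_sup_eq_top {g h : K[X]} (hgh : IsCoprime g h) :
    frobeniusRange L g ⊔ frobeniusRange L h = ⊤ := by
  obtain ⟨a, b, hab⟩ := hgh
  rw [eq_top_iff]
  intro x _
  rw [AddSubgroup.mem_sup]
  refine ⟨_, ⟨frobeniusAeval L a x, rfl⟩, _, ⟨frobeniusAeval L b x, rfl⟩, ?_⟩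
  rw [← frobeniusAeval_mul_apply, ← frobeniusAeval_mul_apply, ← LinearMap.add_apply]
  have : frobeniusAeval L (g * a) + frobeniusAeval L (h * b) = 1 := by
    rw [frobeniusAeval, frobeniusAeval, ← map_add, mul_comm g, mul_comm h, hab, map_one]
  rw [this, Module.End.one_apply]

lemma card_ker_frobeniusAeval_le {g : K[X]} (hg : g.Monic) :
    Nat.card (frobeniusAeval L g).ker ≤ Fintype.card K ^ g.natDegree := by
  classical
  have hK : 1 < Fintype.card K := Fintype.one_lt_card
  set G : L[X] := ∑ i ∈ g.support, C (algebraMap K L (g.coeff i)) * X ^ Fintype.card K ^ i with hG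
  have hcoeff : G.coeff (Fintype.card K ^ g.natDegree) = 1 := by
    simp_rw [hG, finsetSum_coeff, coeff_C_mul, coeff_X_pow, Nat.pow_right_inj hK]
    rw [Finset.sum_eq_single g.natDegree]
    · simp [hg.coeff_natDegree]
    · intro i _ hi
      simp [hi.symm]
    · simp +contextual
  have hG0 : G ≠ 0 := fun h => by simp [h] at hcoeff
  have hdeg : G.natDegree ≤ Fintype.card K ^ g.natDegree := by
    refine natDegree_sum_le_of_forall_le _ _ fun i hi => ?_
    refine (natDegree_C_mul_X_pow_le _ _).trans ?_
    exact Nat.pow_le_pow_right hK.le (le_natDegree_of_mem_supp i hi)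
  have hsub : ((frobeniusAeval L g).ker : Set L) ⊆ G.roots.toFinset := by
    intro x hx
    have hx' : frobeniusAeval L g x = 0 := hx
    simp only [Finset.mem_coe, Multiset.mem_toFinset, mem_roots hG0, IsRoot.def]
    rw [← hx', frobeniusAeval_apply, hG, eval_finsetSum]
    simp [Algebra.smul_def]
  calc Nat.card (frobeniusAeval L g).ker = ((frobeniusAeval L g).ker : Set L).ncard := rfl
    _ ≤ (G.roots.toFinset : Set L).ncard := Set.ncard_le_ncard hsub (Finset.finite_toSet _)
    _ = G.roots.toFinset.card := Set.ncard_coe_finset _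
    _ ≤ G.natDegree := (Multiset.toFinset_card_le _).trans (card_roots' G)
    _ ≤ _ := hdeg

lemma index_frobeniusRange [Finite L] {g : K[X]} {n : ℕ} (hg : g.Monic) (hn : n ≠ 0)
    (hdvd : g ∣ X ^ n - 1) (hL : Nat.card L = Fintype.card K ^ n) :
    (frobeniusRange L g).index = Fintype.card K ^ g.natDegree := by
  obtain ⟨r, hr⟩ := hdvd
  have hmonic : (X ^ n - 1 : K[X]).Monic := monic_X_pow_sub_C (1 : K) hn
  have hrm : r.Monic := by
    rw [hr] at hmonic
    exact hg.of_mul_monic_left hmonic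
  have hdeg : n = g.natDegree + r.natDegree := by
    rw [← hg.natDegree_mul hrm, ← hr]
    exact (natDegree_X_pow_sub_C (r := (1 : K))).symm
  have hzero : ∀ x : L, frobeniusAeval L r (frobeniusAeval L g x) = 0 := by
    intro x
    have := Fintype.ofFinite L
    rw [← frobeniusAeval_mul_apply, mul_comm, ← hr, frobeniusAeval, map_sub, map_pow, aeval_X,
      map_one, LinearMap.sub_apply, frobenius_toLinearMap_pow_apply, Module.End.one_apply, ← hL,
      Nat.card_eq_fintype_card, FiniteField.pow_card, sub_self]
  have hle : Nat.card (frobeniusRange L g) ≤ Fintype.card K ^ r.natDegree := by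
    refine le_trans ?_ (card_ker_frobeniusAeval_le (L := L) hrm)
    refine Nat.card_mono (Set.toFinite ((frobeniusAeval L r).ker : Set L)) ?_
    rintro _ ⟨x, rfl⟩
    exact hzero x
  have h1 := (frobeniusRange L g).card_mul_index
  have h2 : Nat.card (frobeniusRange L g) * Nat.card (frobeniusAeval L g).ker = Nat.card L := by
    have e := (frobeniusAeval L g).quotKerEquivRange.toEquiv
    have := (frobeniusAeval L g).ker.card_eq_card_quotient_mul_card
    rw [this, Nat.card_congr e, mul_comm]
    rfl
  have hpos : 0 < Nat.card (frobeniusRange L g) := Nat.card_pos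
  have h3 : (frobeniusRange L g).index = Nat.card (frobeniusAeval L g).ker :=
    Nat.eq_of_mul_eq_mul_left hpos (h1.trans h2.symm)
  refine le_antisymm (h3 ▸ card_ker_frobeniusAeval_le (L := L) hg) ?_
  refine Nat.le_of_mul_le_mul_left ?_ (pow_pos (Fintype.card_pos (α := K)) r.natDegree)
  calc Fintype.card K ^ r.natDegree * Fintype.card K ^ g.natDegree = Nat.card L := by
        rw [hL, hdeg, pow_add, mul_comm]
    _ ≤ _ := by rw [← h1]; gcongr

end FrobeniusModule

section Factorization

variable {K : Type*} [Field K]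

lemma Polynomial.Monic.exists_finset_prod_eq {f : K[X]} (hf : f.Monic) (hsq : Squarefree f) :
    ∃ S : Finset K[X], (∀ P ∈ S, P.Monic ∧ Irreducible P) ∧ ∏ P ∈ S, P = f := by
  classical
  have hf0 : f ≠ 0 := hf.ne_zero
  refine ⟨(UniqueFactorizationMonoid.normalizedFactors f).toFinset, fun P hP => ?_, ?_⟩
  · rw [Multiset.mem_toFinset] at hP
    have hirr := UniqueFactorizationMonoid.irreducible_of_normalized_factor P hP
    refine ⟨?_, hirr⟩
    rw [← UniqueFactorizationMonoid.normalize_normalized_factor P hP]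
    exact monic_normalize hirr.ne_zero
  · have hnodup := (UniqueFactorizationMonoid.squarefree_iff_nodup_normalizedFactors hf0).1 hsq
    rw [Finset.prod_eq_multiset_prod, Multiset.toFinset_val, hnodup.dedup, Multiset.map_id',
      UniqueFactorizationMonoid.prod_normalizedFactors_eq hf0, hf.normalize_eq_self]

variable {S : Finset K[X]}

lemma eq_of_irreducible_dvd {P Q : K[X]} (hP : P.Monic ∧ Irreducible P)
    (hQ : Q.Monic ∧ Irreducible Q) (h : P ∣ Q) : P = Q :=
  eq_of_monic_of_associated hP.1 hQ.1 (hP.2.associated_of_dvd hQ.2 h)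

lemma isCoprime_prod_of_notMem (hS : ∀ P ∈ S, P.Monic ∧ Irreducible P) {P : K[X]}
    (hP : P.Monic ∧ Irreducible P) (hPS : P ∉ S) : IsCoprime P (∏ Q ∈ S, Q) :=
  IsCoprime.prod_right fun Q hQ => (hP.2.coprime_iff_not_dvd).2 fun h =>
    hPS (eq_of_irreducible_dvd hP (hS Q hQ) h ▸ hQ)

lemma monic_finset_prod_of_irreducible (hS : ∀ P ∈ S, P.Monic ∧ Irreducible P) :
    (∏ P ∈ S, P).Monic :=
  monic_prod_of_monic _ _ fun P hP => (hS P hP).1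

lemma PhiPoly_one : PhiPoly (1 : K[X]) = 1 := by
  have : Subsingleton (K[X] ⧸ Ideal.span {(1 : K[X])}) :=
    Ideal.Quotient.subsingleton_iff.2 (by simp)
  exact Nat.card_unique

lemma PhiPoly_mul {f g : K[X]} (h : IsCoprime f g) : PhiPoly (f * g) = PhiPoly f * PhiPoly g := by
  have hcop : IsCoprime (Ideal.span {f}) (Ideal.span {g}) :=
    (Ideal.isCoprime_span_singleton_iff f g).2 h
  rw [PhiPoly, PhiPoly, PhiPoly, ← Ideal.span_singleton_mul_span_singleton, ← Nat.card_prod]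
  exact Nat.card_congr ((Units.mapEquiv
    (Ideal.quotientMulEquivQuotientProd _ _ hcop).toMulEquiv).trans MulEquiv.prodUnits).toEquiv

variable [Fintype K]

lemma card_quotient_span {P : K[X]} (hP : P ≠ 0) :
    Nat.card (K[X] ⧸ Ideal.span {P}) = Fintype.card K ^ P.natDegree := by
  have := (AdjoinRoot.powerBasis hP).finite
  have h := Module.natCard_eq_pow_finrank (K := K) (V := AdjoinRoot P)
  rw [(AdjoinRoot.powerBasis hP).finrank, AdjoinRoot.powerBasis_dim,
    Nat.card_eq_fintype_card (α := K)] at h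
  exact h

lemma PhiPoly_of_irreducible {P : K[X]} (hP : Irreducible P) :
    (PhiPoly P : ℝ) = (Fintype.card K : ℝ) ^ P.natDegree - 1 := by
  have : Fact (Irreducible P) := ⟨hP⟩
  have hunits : PhiPoly P = Nat.card (AdjoinRoot P) - 1 := Nat.card_units (AdjoinRoot P)
  have hcard : Nat.card (AdjoinRoot P) = Fintype.card K ^ P.natDegree :=
    card_quotient_span hP.ne_zero
  rw [hunits, hcard, Nat.cast_sub (Nat.one_le_pow _ _ Fintype.card_pos)]
  simp

lemma PhiPoly_prod_div (hS : ∀ P ∈ S, P.Monic ∧ Irreducible P) :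
    (PhiPoly (∏ P ∈ S, P) : ℝ) / (Fintype.card K : ℝ) ^ (∏ P ∈ S, P).natDegree =
      ∏ P ∈ S, (1 - 1 / (Fintype.card K : ℝ) ^ P.natDegree) := by
  classical
  have hq : (Fintype.card K : ℝ) ≠ 0 := by simp
  induction S using Finset.induction_on with
  | empty => simp [PhiPoly_one]
  | insert P S hP ih =>
    have hS' : ∀ Q ∈ S, Q.Monic ∧ Irreducible Q := fun Q hQ => hS Q (Finset.mem_insert_of_mem hQ)
    have hPi := hS P (Finset.mem_insert_self P S)
    rw [Finset.prod_insert hP, Finset.prod_insert hP, ← ih hS',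
      PhiPoly_mul (isCoprime_prod_of_notMem hS' hPi hP),
      hPi.1.natDegree_mul (monic_finset_prod_of_irreducible hS'), pow_add, Nat.cast_mul,
      mul_div_mul_comm, PhiPoly_of_irreducible hPi.2, sub_div, div_self (pow_ne_zero _ hq)]

lemma two_pow_card_le_Wpoly (hS : ∀ P ∈ S, P.Monic ∧ Irreducible P)
    (hsq : Squarefree (∏ P ∈ S, P)) : 2 ^ S.card ≤ Wpoly (∏ P ∈ S, P) := by
  classical
  have hmonic := monic_finset_prod_of_irreducible hS
  have hfin : {d : K[X] | d.Monic ∧ Squarefree d ∧ d ∣ ∏ P ∈ S, P}.Finite := by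
    have : Finite (degreeLT K ((∏ P ∈ S, P).natDegree + 1)) :=
      Finite.of_equiv _ (degreeLTEquiv K _).symm.toEquiv
    refine (Set.toFinite (degreeLT K ((∏ P ∈ S, P).natDegree + 1) : Set K[X])).subset ?_
    rintro d ⟨hd, -, hdvd⟩
    rw [SetLike.mem_coe, mem_degreeLT, ← natDegree_lt_iff_degree_lt hd.ne_zero]
    exact Nat.lt_succ_of_le (natDegree_le_of_dvd hdvd hmonic.ne_zero)
  rw [Wpoly, ← Finset.card_powerset, ← Set.ncard_coe_finset]
  refine Set.ncard_le_ncard_of_injOn (fun T => ∏ P ∈ T, P) ?_ ?_ hfin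
  · intro T hT
    have hTS : T ⊆ S := Finset.mem_powerset.1 hT
    have hdvd := Finset.prod_dvd_prod_of_subset T S (fun P => P) hTS
    exact ⟨monic_finset_prod_of_irreducible fun P hP => hS P (hTS hP),
      hsq.squarefree_of_dvd hdvd, hdvd⟩
  · intro T hT U hU hTU
    have key : ∀ V ⊆ S, ∀ P ∈ S, P ∈ V ↔ P ∣ ∏ Q ∈ V, Q := by
      intro V hV P hP
      refine ⟨fun h => Finset.dvd_prod_of_mem (fun Q => Q) h, fun h => ?_⟩
      obtain ⟨Q, hQ, hPQ⟩ := (Prime.dvd_finsetProd_iff (hS P hP).2.prime _).1 h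
      exact eq_of_irreducible_dvd (hS P hP) (hS Q (hV hQ)) hPQ ▸ hQ
    have hT' : T ⊆ S := Finset.mem_powerset.1 hT
    have hU' : U ⊆ S := Finset.mem_powerset.1 hU
    have hTU' : ∏ P ∈ T, P = ∏ P ∈ U, P := hTU
    ext P
    constructor
    · intro h
      rw [key U hU' P (hT' h), ← hTU', ← key T hT' P (hT' h)]
      exact h
    · intro h
      rw [key T hT' P (hU' h), hTU', ← key U hU' P (hU' h)]
      exact h

variable {L : Type*} [Field L] [Algebra K L]

lemma isPolyFree_prod_iff (hS : ∀ P ∈ S, P.Monic ∧ Irreducible P) (α : L) :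
    IsPolyFree (Fintype.card K) (∏ P ∈ S, P) α ↔ ∀ P ∈ S, α ∉ frobeniusRange L P := by
  have hact : ∀ (g : K[X]) (β : L), qAction (Fintype.card K) g β = frobeniusAeval L g β :=
    fun g β => (frobeniusAeval_apply g β).symm
  constructor
  · rintro h P hP ⟨β, hβ⟩
    refine (hS P hP).2.ne_one (h P β (hS P hP).1 (Finset.dvd_prod_of_mem (fun Q => Q) hP) ?_)
    rw [hact]
    exact hβ
  · intro h g β hg hgdvd hβ
    by_contra hne
    obtain ⟨r, hr, hrg⟩ := WfDvdMonoid.exists_irreducible_factor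
      (fun hu => hne (hg.eq_one_of_isUnit hu)) hg.ne_zero
    obtain ⟨P, hP, hrP⟩ := (Prime.dvd_finsetProd_iff hr.prime _).1 (hrg.trans hgdvd)
    have hPg : P ∣ g := ((hr.associated_of_dvd (hS P hP).2 hrP).symm.dvd).trans hrg
    exact h P hP (frobeniusRange_le_of_dvd hPg ⟨β, (hact g β).symm.trans hβ⟩)

open scoped Classical in
lemma hasCharExpansion_isPolyFree [Finite L] (hS : ∀ P ∈ S, P.Monic ∧ Irreducible P) {n : ℕ}
    (hn : n ≠ 0) (hdvd : ∏ P ∈ S, P ∣ X ^ n - 1) (hL : Nat.card L = Fintype.card K ^ n) :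
    HasCharExpansion (⨅ P ∈ S, frobeniusRange L P)
      (fun x => if IsPolyFree (Fintype.card K) (∏ P ∈ S, P) x then 1 else 0)
      (PhiPoly (∏ P ∈ S, P) / (Fintype.card K : ℝ) ^ (∏ P ∈ S, P).natDegree)
      (2 ^ S.card *
        (PhiPoly (∏ P ∈ S, P) / (Fintype.card K : ℝ) ^ (∏ P ∈ S, P).natDegree)) := by
  have hidx : ∀ P ∈ S, ((frobeniusRange L P).index : ℝ) = (Fintype.card K : ℝ) ^ P.natDegree := by
    intro P hP
    rw [index_frobeniusRange (hS P hP).1 hn ((Finset.dvd_prod_of_mem (fun Q => Q) hP).trans hdvd) hL]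
    push_cast
    rfl
  have hprod : ∏ P ∈ S, (1 - 1 / ((frobeniusRange L P).index : ℝ)) =
      PhiPoly (∏ P ∈ S, P) / (Fintype.card K : ℝ) ^ (∏ P ∈ S, P).natDegree := by
    rw [PhiPoly_prod_div hS]
    exact Finset.prod_congr rfl fun P hP => by rw [hidx P hP]
  have key := hasCharExpansion_forall_notMem (fun P => frobeniusRange L P) S fun P hP T hT hPT => by
    rw [eq_top_iff, ← frobeniusRange_sup_eq_top
      (isCoprime_prod_of_notMem (fun Q hQ => hS Q (hT hQ)) (hS P hP) hPT)]
    have hle : frobeniusRange L (∏ Q ∈ T, Q) ≤ ⨅ Q ∈ T, frobeniusRange L Q :=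
      le_iInf₂ fun Q hQ => frobeniusRange_le_of_dvd (Finset.dvd_prod_of_mem (fun Q => Q) hQ)
    exact sup_le_sup_left hle _
  rw [Finset.prod_mul_distrib, hprod, Finset.prod_const] at key
  convert key using 1
  funext x
  exact if_congr (isPolyFree_prod_iff hS x) rfl rfl

end Factorization

section TraceFibre

variable {K M L : Type*} [Field K] [Field M] [Field L] [Algebra K L] [Algebra M L] [Fintype K]
  [Fintype M] [Finite L]

lemma index_ker_trace :
    (Algebra.trace M L).toAddMonoidHom.ker.index = Fintype.card M := by
  have hsurj : Function.Surjective (Algebra.trace M L).toAddMonoidHom :=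
    Algebra.trace_surjective M L
  rw [AddSubgroup.index_ker, AddMonoidHom.range_eq_top.2 hsurj, AddSubgroup.card_top,
    Nat.card_eq_fintype_card]

lemma frobeniusRange_le_ker_trace {m : ℕ} (hM : Fintype.card M = Fintype.card K ^ m) :
    frobeniusRange L (X ^ m - 1 : K[X]) ≤ (Algebra.trace M L).toAddMonoidHom.ker := by
  rintro _ ⟨x, rfl⟩
  change Algebra.trace M L (frobeniusAeval L (X ^ m - 1 : K[X]) x) = 0
  have htr := Algebra.trace_eq_of_algEquiv (FiniteField.frobeniusAlgEquivOfAlgebraic M L) x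
  rw [FiniteField.coe_frobeniusAlgEquivOfAlgebraic] at htr
  rw [frobeniusAeval, map_sub, map_pow, aeval_X, map_one, LinearMap.sub_apply,
    frobenius_toLinearMap_pow_apply, Module.End.one_apply, map_sub, ← hM, sub_eq_zero]
  exact htr

end TraceFibre

lemma isCoprime_X_pow_sub_one {K : Type*} [Field K] {p j : ℕ} [Fact p.Prime] [CharP K p] {f : K[X]}
    (hf : ¬ (X - 1 : K[X]) ∣ f) : IsCoprime f (X ^ p ^ j - 1) := by
  have hirr : Irreducible (X - 1 : K[X]) := by
    simpa using irreducible_X_sub_C (1 : K)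
  have : (X ^ p ^ j - 1 : K[X]) = (X - 1) ^ p ^ j := by
    rw [sub_pow_char_pow, one_pow]
  rw [this]
  exact ((hirr.coprime_iff_not_dvd).2 hf).symm.pow_right

open scoped Classical in
lemma ncard_orderOf_eq_card_units {L : Type*} [Field L] [Fintype L] (hL : 2 < Fintype.card L)
    (p : L → Prop) :
    ((Set.ncard {w : L | orderOf w = Fintype.card L - 1 ∧ p (w ^ 2)} : ℝ) : ℂ) =
      ∑ w : Lˣ, (if orderOf w = Nat.card Lˣ then 1 else 0) * if p ((w : L) ^ 2) then 1 else 0 := by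
  have hcard : Nat.card Lˣ = Fintype.card L - 1 := by
    rw [Nat.card_eq_fintype_card, Fintype.card_units]
  have himage : {w : L | orderOf w = Fintype.card L - 1 ∧ p (w ^ 2)} =
      Set.image Units.val {w : Lˣ | orderOf w = Nat.card Lˣ ∧ p ((w : L) ^ 2)} := by
    ext w
    simp only [Set.mem_ofPred_eq, Set.mem_image, hcard]
    constructor
    · rintro ⟨h1, h2⟩
      have hw : w ≠ 0 := by
        rintro rfl
        rw [orderOf_zero] at h1
        omega
      exact ⟨Units.mk0 w hw, ⟨by rw [← orderOf_units]; exact h1, h2⟩, rfl⟩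
    · rintro ⟨v, ⟨h1, h2⟩, rfl⟩
      exact ⟨by rw [orderOf_units]; exact h1, h2⟩
  rw [himage, Set.ncard_image_of_injective _ Units.val_injective, Set.ncard_eq_toFinset_card']
  simp_rw [ite_zero_mul_ite_zero, mul_one]
  rw [Finset.sum_boole]
  simp

/-- Let `n = p^k u` with `gcd(u, p) = 1`, let `m ∣ n` with `m < n`, let `f` be a monic divisor
of `x^u - 1` not divisible by `x - 1`, with `m = 1` or `m` a power of `p` whenever `f ≠ 1`.
For `β ∈ F_{q^m}`, if `N(f, m, β)` counts the `w ∈ F_{q^n}` that are primitive, with `w²`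
`f`-free and `Tr_{F_{q^n}/F_{q^m}}(w²) = β`, then
`N(f, m, β) ((q^n-1)/φ(q^n-1)) (q^{deg f}/Φ(f)) > q^{n-m} - 2 q^{n/2} W(q^n-1) W(f)`. -/
theorem stmt_13 (p t q n k u m : ℕ) (hp : p.Prime) (hodd : Odd p) (ht : 1 ≤ t)
    (hq : q = p ^ t) (hgcd : Nat.gcd u p = 1) (hn : n = p ^ k * u)
    (hm : m ∣ n) (hmn : m < n)
    (K M L : Type*) [Field K] [Field M] [Field L] [Algebra K M] [Algebra M L] [Algebra K L]
    [IsScalarTower K M L] [Fintype K] [Fintype M] [Fintype L]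
    (hK : Fintype.card K = q) (hM : Fintype.card M = q ^ m) (hL : Fintype.card L = q ^ n)
    (f : Polynomial K) (hf : f.Monic) (hfdvd : f ∣ (X : Polynomial K) ^ u - 1)
    (hfx : ¬ ((X : Polynomial K) - 1 ∣ f))
    (hmf : f ≠ 1 → m = 1 ∨ ∃ j : ℕ, m = p ^ j)
    (β : M) :
    (Set.ncard {w : L | orderOf w = q ^ n - 1 ∧ IsPolyFree q f (w ^ 2) ∧
          Algebra.trace M L (w ^ 2) = β} : ℝ) *
        (((q ^ n - 1 : ℕ) : ℝ) / ((q ^ n - 1).totient : ℝ)) *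
        ((q : ℝ) ^ f.natDegree / (PhiPoly f : ℝ)) >
      (q : ℝ) ^ (n - m) - 2 * (q : ℝ) ^ ((n : ℝ) / 2) *
        (Wnat (q ^ n - 1) : ℝ) * (Wpoly f : ℝ) := by
  classical
  have : Fact p.Prime := ⟨hp⟩
  have hchar : CharP K p := charP_of_card_eq_prime_pow (hK.trans hq)
  have hn0 : n ≠ 0 := by omega
  have hq3 : 2 < q := by
    have hp3 : 2 < p := lt_of_le_of_ne hp.two_le fun h => by
      rw [← h] at hodd
      exact absurd hodd (by decide)
    exact hp3.trans_le (hq ▸ Nat.le_self_pow (by omega) p)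
  have hcardL : 2 < Fintype.card L := hL ▸ hq3.trans_le (Nat.le_self_pow hn0 q)
  have hsq : Squarefree f := by
    have hpu : ¬ p ∣ u := fun h =>
      hp.ne_one (Nat.dvd_one.1 (hgcd ▸ Nat.dvd_gcd h dvd_rfl))
    have hsep : (X ^ u - C 1 : K[X]).Separable :=
      separable_X_pow_sub_C' p u 1 hpu one_ne_zero
    rw [C_1] at hsep
    exact hsep.squarefree.squarefree_of_dvd hfdvd
  have hfn : f ∣ X ^ n - 1 := hfdvd.trans (by
    rw [hn, mul_comm, pow_mul]
    simpa using sub_dvd_pow_sub_pow (X ^ u : K[X]) 1 (p ^ k))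
  obtain ⟨S, hS, hSf⟩ := hf.exists_finset_prod_eq hsq
  obtain ⟨B, hB⟩ := exists_hasCharExpansion_orderOf_eq_card (G := Lˣ)
  have hfree := hasCharExpansion_isPolyFree (L := L) hS hn0 (hSf.symm ▸ hfn)
    (by rw [Nat.card_eq_fintype_card, hL, hK])
  have hΘprod := PhiPoly_prod_div hS
  rw [hSf] at hfree hΘprod
  obtain ⟨y, hy⟩ := Algebra.trace_surjective M L β
  have htrace := hasCharExpansion_coset (Algebra.trace M L).toAddMonoidHom.ker y
  have hsup : (⨅ P ∈ S, frobeniusRange L P) ⊔ (Algebra.trace M L).toAddMonoidHom.ker = ⊤ := by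
    have hle : frobeniusRange L f ≤ ⨅ P ∈ S, frobeniusRange L P :=
      le_iInf₂ fun P hP => frobeniusRange_le_of_dvd (hSf ▸ Finset.dvd_prod_of_mem (fun Q => Q) hP)
    have hcop : IsCoprime f (X ^ m - 1) := by
      by_cases hf1 : f = 1
      · rw [hf1]
        exact isCoprime_one_left
      · rcases hmf hf1 with rfl | ⟨j, rfl⟩
        · exact isCoprime_X_pow_sub_one (p := p) (j := 0) hfx
        · exact isCoprime_X_pow_sub_one hfx
    rw [eq_top_iff, ← frobeniusRange_sup_eq_top hcop]
    exact sup_le_sup hle (frobeniusRange_le_ker_trace (by rw [hM, hK]))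
  have hF := hfree.mul htrace hsup
  have hbound := norm_sum_units_sub_le hB hF (by positivity)
  have hcount := ncard_orderOf_eq_card_units hcardL
    fun x : L => IsPolyFree q f x ∧ Algebra.trace M L x = β
  have hker (x : L) : x - y ∈ (Algebra.trace M L).toAddMonoidHom.ker ↔
      Algebra.trace M L x = β := by
    rw [← hy, ← sub_eq_zero (b := Algebra.trace M L y), ← map_sub]
    rfl
  simp only [toMul_ofMul, hker, hK, ite_zero_mul_ite_zero, mul_one] at hbound hcount
  rw [← hcount, hL, index_ker_trace, hM] at hbound
  have hunits : Nat.card Lˣ = q ^ n - 1 := by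
    rw [Nat.card_eq_fintype_card, Fintype.card_units, hL]
  rw [← Nat.card_eq_fintype_card (α := Lˣ), hunits] at hbound
  set N : ℝ := (Set.ncard {w : L | orderOf w = q ^ n - 1 ∧ IsPolyFree q f (w ^ 2) ∧
    Algebra.trace M L (w ^ 2) = β} : ℝ)
  set θ : ℝ := ((q ^ n - 1).totient : ℝ) / ((q ^ n - 1 : ℕ) : ℝ)
  set Θ : ℝ := (PhiPoly f : ℝ) / (q : ℝ) ^ f.natDegree with hΘ
  have hqn : 1 < q ^ n := Nat.one_lt_pow hn0 (by omega)
  have hqpos : (0 : ℝ) < q := by exact_mod_cast (by omega : 0 < q)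
  have hθpos : 0 < θ := by
    have h1 : 0 < q ^ n - 1 := by omega
    have h2 := Nat.totient_pos.2 h1
    positivity
  have hΘpos : 0 < Θ := by
    rw [hΘ, ← hK, hΘprod]
    refine Finset.prod_pos fun P hP => sub_pos.2 ?_
    have h1 : (1 : ℝ) < Fintype.card K := by exact_mod_cast Fintype.one_lt_card
    rw [one_div]
    exact inv_lt_one_of_one_lt₀ (one_lt_pow₀ h1 (hS P hP).2.natDegree_pos.ne')
  have hW : (2 : ℝ) ^ S.card ≤ Wpoly f := by
    have h := two_pow_card_le_Wpoly hS (hSf.symm ▸ hsq)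
    rw [hSf] at h
    exact_mod_cast h
  have hW1 : (1 : ℝ) ≤ Wnat (q ^ n - 1) := by exact_mod_cast Nat.one_le_two_pow
  have hsqrt : √((q ^ n : ℕ) : ℝ) = (q : ℝ) ^ ((n : ℝ) / 2) := by
    rw [Real.sqrt_eq_rpow, Nat.cast_pow, ← Real.rpow_natCast, ← Real.rpow_mul hqpos.le]
    ring_nf
  have hsqrt1 : (1 : ℝ) ≤ √((q ^ n : ℕ) : ℝ) := Real.one_le_sqrt.2 (by exact_mod_cast hqn.le)
  rw [← hsqrt]
  set R : ℝ := √((q ^ n : ℕ) : ℝ)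
  set W : ℝ := (Wnat (q ^ n - 1) : ℝ)
  have hreal : |N - θ * (Θ * (1 / (q : ℝ) ^ m)) * ((q : ℝ) ^ n - 1)| ≤
      2 * R * (W * θ) * (2 ^ S.card * Θ - Θ * (1 / (q : ℝ) ^ m)) := by
    rw [← Real.norm_eq_abs, ← Complex.norm_real]
    have hcast : ((q ^ n - 1 : ℕ) : ℝ) = (q : ℝ) ^ n - 1 := by
      rw [Nat.cast_sub hqn.le]; push_cast; rfl
    rw [hcast] at hbound
    convert hbound using 2
    · push_cast
      rfl
    · push_cast
      ring
  have hlow := (abs_le.1 hreal).1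
  have hqm : (0 : ℝ) < (q : ℝ) ^ m := by positivity
  have hpow : (q : ℝ) ^ n = (q : ℝ) ^ (n - m) * (q : ℝ) ^ m := by
    rw [← pow_add, Nat.sub_add_cancel hmn.le]
  have hinv : ((q ^ n - 1 : ℕ) : ℝ) / ((q ^ n - 1).totient : ℝ) = θ⁻¹ := (inv_div _ _).symm
  have hinv' : (q : ℝ) ^ f.natDegree / (PhiPoly f : ℝ) = Θ⁻¹ := (inv_div _ _).symm
  rw [hinv, hinv', gt_iff_lt, mul_assoc N, ← mul_inv, ← div_eq_mul_inv,
    lt_div_iff₀ (by positivity)]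
  have hRW : 1 ≤ R * W := one_le_mul_of_one_le_of_one_le hsqrt1 hW1
  have hmain : θ * (Θ * (1 / (q : ℝ) ^ m)) * ((q : ℝ) ^ n - 1) =
      θ * Θ * ((q : ℝ) ^ (n - m) - 1 / (q : ℝ) ^ m) := by
    rw [hpow]
    field_simp
  have hpos : 0 < θ * Θ * (1 / (q : ℝ) ^ m) * (2 * (R * W) - 1) := by
    have : 0 < 2 * (R * W) - 1 := by linarith
    positivity
  have hgap : 0 ≤ 2 * (R * W) * (θ * Θ) * (Wpoly f - 2 ^ S.card) := by
    have := sub_nonneg.2 hW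
    positivity
  rw [hmain] at hlow
  nlinarith
end

section
/- Let q be a prime power, n a positive integer, and q' the largest squarefree divisor of q^n − 1. For a divisor r of q', let N_2(n)_r denote the number of w ∈ F_{q^n}* such that w is r-free and w^2 is normal over F_q. Let r_1, …, r_s be divisors of q' such that gcd(r_i, r_j) = q_0 for all i ≠ j and lcm(r_1, …, r_s) = q'. Then N_2(n)_{q'} ≥ Σ_{i=1}^s N_2(n)_{r_i} − (s − 1) N_2(n)_{q_0}. -/
/-- The `F_q`-span of the conjugates `α, α^q, …, α^{q^{n-1}}` of `α ∈ F_{q^n}`. -/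
def conjSpan (K : Type*) {L : Type*} [Field K] [Field L] [Algebra K L]
    (q n : ℕ) (α : L) : Submodule K L :=
  Submodule.span K (Set.range fun i : Fin n => α ^ q ^ (i : ℕ))

/-- `w` is `d`-free: if `w = β^e` for a divisor `e` of `d`, then `e = 1`. -/
def MultFree {L : Type*} [Monoid L] (d : ℕ) (w : L) : Prop :=
  ∀ e : ℕ, ∀ β : L, e ∣ d → β ^ e = w → e = 1

theorem MultFree.of_dvd {L : Type*} [Monoid L] {d d' : ℕ} {w : L} (h : MultFree d' w)
    (hd : d ∣ d') : MultFree d w :=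
  fun e β he hβ => h e β (he.trans hd) hβ

theorem MultFree.lcm {ι L : Type*} [Monoid L] {S : Finset ι} {r : ι → ℕ} {w : L}
    (h : ∀ i ∈ S, MultFree (r i) w) : MultFree (S.lcm r) w := by
  intro e β he hβ
  by_contra hne
  obtain ⟨ℓ, hℓ, k, rfl⟩ := Nat.exists_prime_and_dvd hne
  have hprod : S.lcm r ∣ ∏ i ∈ S, r i :=
    Finset.lcm_dvd fun i hi => Finset.dvd_prod_of_mem r hi
  obtain ⟨i, hi, hdvd⟩ :=
    (hℓ.prime.dvd_finsetProd_iff r).1 (((dvd_mul_right ℓ k).trans he).trans hprod)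
  exact hℓ.ne_one (h i hi ℓ (β ^ k) hdvd (by rw [← pow_mul, mul_comm k ℓ, hβ]))

/-- A Bonferroni-type bound for the common part of finitely many subsets `A i` of `B`. -/
theorem sum_ncard_sub_le_ncard {ι α : Type*} [Fintype ι] [Finite α] {A : ι → Set α}
    {B C : Set α} (hA : ∀ i, A i ⊆ B) (hC : ∀ w ∈ B, (∀ i, w ∈ A i) → w ∈ C) :
    (∑ i, ((A i).ncard : ℤ)) - ((Fintype.card ι : ℤ) - 1) * (B.ncard : ℤ) ≤ (C.ncard : ℤ) := by
  have hsub : B ⊆ C ∪ ⋃ i, B \ A i := by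
    intro w hw
    by_cases h : ∀ i, w ∈ A i
    · exact Or.inl (hC w hw h)
    · push Not at h
      obtain ⟨i, hi⟩ := h
      exact Or.inr (Set.mem_iUnion.2 ⟨i, hw, hi⟩)
  have hunion : (⋃ i, B \ A i).ncard ≤ ∑ i, (B \ A i).ncard := by
    simpa using Set.ncard_iUnion_le_of_fintype fun i => B \ A i
  have hle : (B.ncard : ℤ) ≤ C.ncard + ∑ i, ((B \ A i).ncard : ℤ) := by
    exact_mod_cast (Set.ncard_le_ncard hsub).trans
      ((Set.ncard_union_le _ _).trans (Nat.add_le_add_left hunion _))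
  have hdiff : ∀ i, ((B \ A i).ncard : ℤ) = B.ncard - (A i).ncard := fun i => by
    have := Set.ncard_sdiff_add_ncard_of_subset (hA i)
    lia
  simp only [hdiff, Finset.sum_sub_distrib, Finset.sum_const, Finset.card_univ,
    nsmul_eq_mul] at hle
  linarith

/-- Sieving inequality: let `q'` be the largest squarefree divisor of `q^n - 1` and let
`r_1, …, r_s` be divisors of `q'` with pairwise gcd `q₀` and lcm `q'`. If `N₂(n)_r` counts
the nonzero `r`-free `w ∈ F_{q^n}` with `w²` normal over `F_q`, then
`N₂(n)_{q'} ≥ Σᵢ N₂(n)_{rᵢ} - (s - 1) N₂(n)_{q₀}`. -/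
theorem stmt_14 (p t q n : ℕ) (hp : p.Prime) (ht : 1 ≤ t) (hq : q = p ^ t) (hn : 1 ≤ n)
    (K L : Type*) [Field K] [Field L] [Algebra K L] [Fintype K] [Fintype L]
    (hK : Fintype.card K = q) (hL : Fintype.card L = q ^ n)
    (s q₀ : ℕ) (r : Fin s → ℕ)
    (hdvd : ∀ i, r i ∣ ∏ ℓ ∈ (q ^ n - 1).primeFactors, ℓ)
    (hgcd : ∀ i j, i ≠ j → Nat.gcd (r i) (r j) = q₀)
    (hlcm : Finset.univ.lcm r = ∏ ℓ ∈ (q ^ n - 1).primeFactors, ℓ) :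
    (Set.ncard {w : L | w ≠ 0 ∧ MultFree (∏ ℓ ∈ (q ^ n - 1).primeFactors, ℓ) w ∧
          conjSpan K q n (w ^ 2) = ⊤} : ℤ) ≥
      (∑ i, (Set.ncard {w : L | w ≠ 0 ∧ MultFree (r i) w ∧
          conjSpan K q n (w ^ 2) = ⊤} : ℤ)) -
        ((s : ℤ) - 1) *
          (Set.ncard {w : L | w ≠ 0 ∧ MultFree q₀ w ∧ conjSpan K q n (w ^ 2) = ⊤} : ℤ) := by
  rw [← hlcm]
  by_cases hs : s = 1
  · subst hs
    simp
  · have hq₀ : ∀ i, q₀ ∣ r i := fun i => by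
      have : Nontrivial (Fin s) := Fin.nontrivial_iff_two_le.2 (by have := i.pos; lia)
      obtain ⟨j, hj⟩ := exists_ne i
      exact hgcd i j hj.symm ▸ Nat.gcd_dvd_left _ _
    have key := sum_ncard_sub_le_ncard
      (A := fun i => {w : L | w ≠ 0 ∧ MultFree (r i) w ∧ conjSpan K q n (w ^ 2) = ⊤})
      (B := {w : L | w ≠ 0 ∧ MultFree q₀ w ∧ conjSpan K q n (w ^ 2) = ⊤})
      (C := {w : L | w ≠ 0 ∧ MultFree (Finset.univ.lcm r) w ∧ conjSpan K q n (w ^ 2) = ⊤})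
      (fun i w hw => ⟨hw.1, hw.2.1.of_dvd (hq₀ i), hw.2.2⟩)
      (fun w hw hA => ⟨hw.1, MultFree.lcm fun i _ => (hA i).2.1, hw.2.2⟩)
    rwa [Fintype.card_fin] at key
end
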